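/- arXiv:2102.08654 — 4 statements merged into one kernel-verified Lean document; each statement's English description precedes it below -/
import Mathlib

section
/- For every nonzero algebraic number α, the number e^α is transcendental over ℚ. -/
open Polynomial

namespace HermiteLindemann

theorem exists_intPolynomial_vanishing_on {K : Type*} [Field K] [Algebra.IsAlgebraic ℤ K]
    (s : Finset K) (hs : (0 : K) ∉ s) :
    ∃ f : ℤ[X], f.eval 0 ≠ 0 ∧ ∀ x ∈ s, aeval x f = 0 := by
  have key (x : K) : ∃ q : ℤ[X], q.coeff 0 ≠ 0 ∧ (x ∈ s → aeval x q = 0) := by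
    by_cases hx : x ∈ s
    · obtain ⟨q, hq, hqx⟩ := (Algebra.IsAlgebraic.isAlgebraic (R := ℤ) x)
        |>.exists_nonzero_coeff_and_aeval_eq_zero
        (mem_nonZeroDivisors_of_ne_zero (ne_of_mem_of_not_mem hx hs))
      exact ⟨q, hq, fun _ ↦ hqx⟩
    · exact ⟨1, by simp, fun h ↦ absurd h hx⟩
  choose q hq hqx using key
  refine ⟨∏ x ∈ s, q x, ?_, fun x hx ↦ ?_⟩
  · rw [eval_prod]
    exact Finset.prod_ne_zero_iff.mpr fun x _ ↦ by simpa [coeff_zero_eq_eval_zero] using hq x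
  · rw [map_prod]
    exact Finset.prod_eq_zero hx (hqx x hx)

theorem isIntegral_pow_smul_aeval {K : Type*} [Field K] {a : ℤ} {x : K}
    (hx : IsIntegral ℤ (a • x)) (g : ℤ[X]) {d : ℕ} (hg : g.natDegree ≤ d) :
    IsIntegral ℤ ((a : K) ^ d * aeval x g) := by
  rw [aeval_eq_sum_range' (Nat.lt_succ_of_le hg), Finset.mul_sum]
  refine IsIntegral.sum _ fun i hi ↦ ?_
  have hi : i ≤ d := Nat.lt_succ_iff.mp (Finset.mem_range.mp hi)
  have : (a : K) ^ d * g.coeff i • x ^ i =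
      ((a ^ (d - i) * g.coeff i : ℤ) : K) * (a • x) ^ i := by
    rw [← Nat.sub_add_cancel hi, pow_add]
    simp only [zsmul_eq_mul, mul_pow, Nat.sub_add_cancel hi]
    push_cast
    ring
  rw [this]
  exact (isIntegral_algebraMap (R := ℤ) (A := K) (x := a ^ (d - i) * g.coeff i)).mul (hx.pow i)

theorem exists_int_eq_of_isIntegral_of_fixed {K : Type*} [Field K] [NumberField K]
    [IsGalois ℚ K] {x : K} (hx : IsIntegral ℤ x) (hfix : ∀ σ : Gal(K/ℚ), σ x = x) :
    ∃ m : ℤ, x = m := by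
  obtain ⟨q, rfl⟩ := IntermediateField.mem_bot.mp ((IsGalois.mem_bot_iff_fixed x).mpr hfix)
  have hq : IsIntegral ℤ q := (isIntegral_algebraMap_iff (algebraMap ℚ K).injective).mp hx
  obtain ⟨m, rfl⟩ := IsIntegrallyClosed.isIntegral_iff.mp hq
  exact ⟨m, by simp⟩

open Filter Topology in
theorem eventually_mul_pow_div_factorial_lt (B E : ℝ) :
    ∀ᶠ p : ℕ in atTop, B * (E ^ p / (p - 1).factorial) < 1 := by
  have h := ((FloorSemiring.tendsto_pow_div_factorial_atTop E).const_mul (B * E)).comp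
    (tendsto_sub_atTop_nat 1)
  rw [mul_zero] at h
  filter_upwards [h.eventually_lt_const one_pos, eventually_ge_atTop 1] with p hp hp1
  refine lt_of_eq_of_lt ?_ hp
  obtain ⟨k, rfl⟩ := Nat.exists_eq_add_of_le' hp1
  simp only [Function.comp, Nat.add_sub_cancel, pow_succ]
  ring

theorem int_add_sum_exp_ne_zero {K : Type*} [Field K] [NumberField K] [IsGalois ℚ K]
    [Algebra K ℂ] (s : Finset K) (hs0 : (0 : K) ∉ s)
    (hs : ∀ σ : Gal(K/ℚ), ∀ x ∈ s, σ x ∈ s)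
    (h : K → ℤ) (hinv : ∀ (σ : Gal(K/ℚ)) (x : K), h (σ x) = h x) {c : ℤ} (hc : c ≠ 0) :
    (c : ℂ) + ∑ x ∈ s, h x * Complex.exp (algebraMap K ℂ x) ≠ 0 := by
  intro hzero
  have : Algebra.IsAlgebraic ℤ K := IsLocalization.isAlgebraic ℚ (nonZeroDivisors ℤ) |>.trans _ _ _
  obtain ⟨f, hf0, hf⟩ := exists_intPolynomial_vanishing_on s hs0
  obtain ⟨a, ha0, ha⟩ := Algebra.IsAlgebraic.exists_integral_multiples ℤ s
  obtain ⟨C, hC⟩ := LindemannWeierstrass.exp_polynomial_approx f hf0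
  have hfroot (x : K) (hx : x ∈ s) : algebraMap K ℂ x ∈ f.aroots ℂ := by
    rw [mem_aroots]
    refine ⟨fun h ↦ hf0 (by simp [h]), ?_⟩
    rw [aeval_algebraMap_apply, hf x hx, map_zero]
  set D := f.natDegree
  set B : ℝ := ∑ x ∈ s, ‖(h x : ℂ)‖
  obtain ⟨P, hP⟩ := Filter.eventually_atTop.mp
    (eventually_mul_pow_div_factorial_lt B (‖(a : ℂ)‖ ^ D * C))
  obtain ⟨p, hple, hp⟩ := Nat.exists_infinite_primes
    (max P ((eval 0 f).natAbs + a.natAbs + c.natAbs + 1))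
  have hPp := hP p (le_of_max_le_left hple)
  have hple := le_of_max_le_right hple
  obtain ⟨n, hpn, g, hgdeg, hg⟩ := hC p (by lia) hp
  have hstable (σ : Gal(K/ℚ)) (F : K → K) : ∑ x ∈ s, F (σ x) = ∑ x ∈ s, F x :=
    Finset.sum_bijective σ σ.bijective
      (fun x ↦ ⟨hs σ x, fun hx ↦ by simpa using! hs σ⁻¹ _ hx⟩) fun _ _ ↦ rfl
  obtain ⟨m, hm⟩ : ∃ m : ℤ, (a : K) ^ (p * D) * ∑ x ∈ s, h x * aeval x g = m := by
    apply exists_int_eq_of_isIntegral_of_fixed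
    · rw [Finset.mul_sum]
      refine IsIntegral.sum _ fun x hx ↦ ?_
      rw [mul_left_comm]
      exact (isIntegral_algebraMap (R := ℤ) (A := K) (x := h x)).mul
        (isIntegral_pow_smul_aeval (ha x hx) g (hgdeg.trans (Nat.sub_le _ _)))
    · intro σ
      simp only [map_mul, map_pow, map_intCast, map_sum]
      congr 1
      rw [← hstable σ (fun x ↦ (h x : K) * aeval x g)]
      refine Finset.sum_congr rfl fun x _ ↦ ?_
      rw [hinv]
      congr 1
      exact (aeval_algHom_apply (σ.toAlgHom.restrictScalars ℤ) x g).symm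
  have hmC : (a : ℂ) ^ (p * D) * ∑ x ∈ s, h x * aeval (algebraMap K ℂ x) g = m := by
    have := congrArg (algebraMap K ℂ) hm
    simpa [aeval_algebraMap_apply] using this
  have hint : ((a ^ (p * D) * n * c + p * m : ℤ) : ℂ) =
      -((a : ℂ) ^ (p * D) * ∑ x ∈ s, h x * (n • Complex.exp (algebraMap K ℂ x) -
        p • aeval (algebraMap K ℂ x) g)) := by
    push_cast
    rw [← hmC]
    simp only [mul_sub, Finset.sum_sub_distrib, zsmul_eq_mul, nsmul_eq_mul]
    have h1 : ∑ x ∈ s, (h x : ℂ) * (n * Complex.exp (algebraMap K ℂ x)) = n * (-c) := by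
      rw [← eq_neg_of_add_eq_zero_right hzero, Finset.mul_sum]
      exact Finset.sum_congr rfl fun x _ ↦ by ring
    have h2 : ∑ x ∈ s, (h x : ℂ) * (p * aeval (algebraMap K ℂ x) g) =
        p * ∑ x ∈ s, h x * aeval (algebraMap K ℂ x) g := by
      rw [Finset.mul_sum]
      exact Finset.sum_congr rfl fun x _ ↦ by ring
    rw [h1, h2]
    ring
  have hbound : ‖((a ^ (p * D) * n * c + p * m : ℤ) : ℂ)‖ < 1 := by
    refine lt_of_le_of_lt ?_ hPp
    calc _ ≤ ‖(a : ℂ)‖ ^ (p * D) * ∑ x ∈ s, ‖(h x : ℂ)‖ * (C ^ p / (p - 1).factorial) := by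
          rw [hint, norm_neg, norm_mul, norm_pow]
          gcongr
          refine norm_sum_le_of_le _ fun x hx ↦ ?_
          rw [norm_mul]
          gcongr
          exact hg (hfroot x hx)
      _ = _ := by
          rw [← Finset.sum_mul, mul_pow, ← pow_mul, mul_comm D p]
          ring
  have hint0 : a ^ (p * D) * n * c + p * m = 0 := by
    rw [Complex.norm_intCast] at hbound
    exact Int.abs_lt_one_iff.mp (by exact_mod_cast hbound)
  have hdvd : (p : ℤ) ∣ a ^ (p * D) * n * c :=
    (Int.dvd_add_left (dvd_mul_right _ m)).mp (hint0 ▸ dvd_zero _)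
  have hpZ := Nat.prime_iff_prime_int.mp hp
  have hsmall {z : ℤ} (hz : z ≠ 0) (hlt : z.natAbs < p) : ¬ (p : ℤ) ∣ z := fun hd ↦
    hlt.not_ge (Nat.le_of_dvd (Int.natAbs_pos.mpr hz) (Int.natCast_dvd.mp hd))
  rcases hpZ.dvd_or_dvd hdvd with hd | hd
  · rcases hpZ.dvd_or_dvd hd with hd | hd
    · exact hsmall ha0 (by lia) (hpZ.dvd_of_dvd_pow hd)
    · exact hpn hd
  · exact hsmall hc (by lia) hd

section ExpEval

variable {K : Type*} [Field K]

/-- Evaluation of a formal integer combination of elements of `K ⊆ ℂ`, sending the formal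
generator attached to `x` to `exp x`. -/
noncomputable def expEval (K : Type*) [Field K] [Algebra K ℂ] : AddMonoidAlgebra ℤ K →ₐ[ℤ] ℂ :=
  AddMonoidAlgebra.lift ℤ ℂ K
    (Complex.expMonoidHom.comp (algebraMap K ℂ).toAddMonoidHom.toMultiplicative)

theorem expEval_single [Algebra K ℂ] (x : K) (n : ℤ) :
    expEval K (.single x n) = n * Complex.exp (algebraMap K ℂ x) := by
  simp [expEval, Complex.expMonoidHom]

theorem expEval_apply [Algebra K ℂ] (z : AddMonoidAlgebra ℤ K) :
    expEval K z = ∑ x ∈ z.coeff.support, z.coeff x * Complex.exp (algebraMap K ℂ x) :=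
  AddMonoidAlgebra.lift_apply' _ z

/-- The action of the Galois group on formal integer combinations of elements of `K`. -/
noncomputable def galAct [Algebra ℚ K] (σ : Gal(K/ℚ)) :
    AddMonoidAlgebra ℤ K →+* AddMonoidAlgebra ℤ K :=
  AddMonoidAlgebra.mapDomainRingHom ℤ (σ : K →+ K)

theorem galAct_single [Algebra ℚ K] (σ : Gal(K/ℚ)) (x : K) (n : ℤ) :
    galAct σ (.single x n) = .single (σ x) n := by
  simp [galAct]

theorem galAct_one [Algebra ℚ K] (z : AddMonoidAlgebra ℤ K) : galAct (1 : Gal(K/ℚ)) z = z :=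
  congrArg AddMonoidAlgebra.ofCoeff Finsupp.mapDomain_id

theorem galAct_mul [Algebra ℚ K] (σ τ : Gal(K/ℚ)) (z : AddMonoidAlgebra ℤ K) :
    galAct (σ * τ) z = galAct σ (galAct τ z) :=
  congrArg AddMonoidAlgebra.ofCoeff (Finsupp.mapDomain_comp (f := τ) (g := σ))

theorem coeff_galAct [Algebra ℚ K] (σ : Gal(K/ℚ)) (z : AddMonoidAlgebra ℤ K) (x : K) :
    (galAct σ z).coeff (σ x) = z.coeff x :=
  Finsupp.mapDomain_apply σ.injective _ _

variable [NumberField K] [IsGalois ℚ K] [Algebra K ℂ]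

theorem expEval_ne_zero_of_coeff_zero_ne_zero {z : AddMonoidAlgebra ℤ K}
    (hz : ∀ σ : Gal(K/ℚ), galAct σ z = z) (hz0 : z.coeff 0 ≠ 0) : expEval K z ≠ 0 := by
  classical
  have hinv (σ : Gal(K/ℚ)) (x : K) : z.coeff (σ x) = z.coeff x := by
    conv_lhs => rw [← hz σ]
    exact coeff_galAct σ z x
  have key := int_add_sum_exp_ne_zero (z.coeff.support.erase 0) (Finset.notMem_erase _ _)
    (fun σ x hx ↦ by simpa [hinv] using hx) z.coeff hinv hz0
  rw [expEval_apply, ← Finset.add_sum_erase _ _ (Finsupp.mem_support_iff.mpr hz0)]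
  simpa using key

theorem expEval_ne_zero_of_galAct_eq {z : AddMonoidAlgebra ℤ K}
    (hz : ∀ σ : Gal(K/ℚ), galAct σ z = z) (hz0 : z ≠ 0) : expEval K z ≠ 0 := by
  obtain ⟨b, hb⟩ : ∃ b, z.coeff b ≠ 0 := by
    by_contra! h
    exact hz0 (AddMonoidAlgebra.ext (Finsupp.ext h))
  have hinv (σ : Gal(K/ℚ)) : z.coeff (σ b) = z.coeff b := by
    conv_lhs => rw [← hz σ]
    exact coeff_galAct σ z b
  have key : expEval K (z * ∑ σ : Gal(K/ℚ), .single (-(σ b)) 1) ≠ 0 := by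
    refine expEval_ne_zero_of_coeff_zero_ne_zero (fun τ ↦ ?_) ?_
    · rw [map_mul, hz, map_sum]
      congr 1
      refine Fintype.sum_equiv (Equiv.mulLeft τ) _ _ fun σ ↦ ?_
      simp [galAct_single]
    · have (σ : Gal(K/ℚ)) :
          (z * AddMonoidAlgebra.single (-(σ b)) (1 : ℤ)).coeff 0 = z.coeff b := by
        rw [AddMonoidAlgebra.coeff_mul_single_eq_coeff_mul (σ b)
          (fun x _ ↦ by rw [← sub_eq_add_neg, sub_eq_zero]), mul_one, hinv]
      simp [Finset.mul_sum, this, hb]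
  rw [map_mul] at key
  exact left_ne_zero_of_mul key

theorem expEval_ne_zero {z : AddMonoidAlgebra ℤ K} (hz : z ≠ 0) : expEval K z ≠ 0 := by
  have hact (σ : Gal(K/ℚ)) : galAct σ z ≠ 0 := fun h ↦ hz <| by
    rw [← galAct_one z, ← inv_mul_cancel σ, galAct_mul, h, map_zero]
  have key : expEval K (∏ σ : Gal(K/ℚ), galAct σ z) ≠ 0 := by
    refine expEval_ne_zero_of_galAct_eq (fun τ ↦ ?_) (Finset.prod_ne_zero_iff.mpr fun σ _ ↦ hact σ)
    rw [map_prod]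
    exact Fintype.prod_equiv (Equiv.mulLeft τ) _ _ fun σ ↦ (galAct_mul τ σ z).symm
  rw [map_prod] at key
  simpa [galAct_one] using Finset.prod_ne_zero_iff.mp key 1 (Finset.mem_univ _)

end ExpEval

theorem aeval_single_ne_zero {K : Type*} [Field K] [CharZero K] {a : K} (ha : a ≠ 0) {q : ℤ[X]}
    (hq : q ≠ 0) : aeval (AddMonoidAlgebra.single a (1 : ℤ)) q ≠ 0 := by
  classical
  intro h
  have := congrArg (fun z ↦ AddMonoidAlgebra.coeff z (q.natDegree • a)) h
  exact hq (by simpa [aeval_eq_sum_range, AddMonoidAlgebra.single_pow, Finsupp.single_apply, ha]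
    using this)

end HermiteLindemann

/-- Hermite–Lindemann: for every nonzero algebraic number `α`, the number `e ^ α` is
transcendental over `ℚ`. -/
theorem hermite_lindemann (α : ℂ) (hα0 : α ≠ 0) (hα : IsAlgebraic ℚ α) :
    Transcendental ℚ (Complex.exp α) := by
  rw [Transcendental, ← IsFractionRing.isAlgebraic_iff ℤ ℚ ℂ]
  rintro ⟨q, hq, hqα⟩
  let K := IntermediateField.adjoin ℚ ((minpoly ℚ α).rootSet ℂ)
  have : (minpoly ℚ α).IsSplittingField ℚ K :=
    IntermediateField.adjoin_rootSet_isSplittingField (IsAlgClosed.splits _)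
  have : FiniteDimensional ℚ K := IsSplittingField.finiteDimensional K (minpoly ℚ α)
  have : IsGalois ℚ K :=
    .of_separable_splitting_field (minpoly.irreducible hα.isIntegral).separable
  have : NumberField K := ⟨⟩
  have hαK : α ∈ K := IntermediateField.subset_adjoin _ _ <|
    (mem_rootSet_of_ne (minpoly.ne_zero hα.isIntegral)).mpr (minpoly.aeval _ _)
  let a : K := ⟨α, hαK⟩
  have ha : a ≠ 0 := fun h ↦ hα0 (congrArg Subtype.val h)
  apply HermiteLindemann.expEval_ne_zero (HermiteLindemann.aeval_single_ne_zero ha hq)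
  rw [← aeval_algHom_apply, HermiteLindemann.expEval_single, Int.cast_one, one_mul]
  exact hqα
end

section
/- If ρ₁, …, ρₙ are algebraic numbers that are linearly independent over ℚ, then e^{ρ₁}, …, e^{ρₙ} are algebraically independent over ℚ (equivalently over the field of algebraic numbers). -/
open Polynomial in
theorem exists_int_polynomial_eval_zero_ne_zero {K : Type*} [Field K] [CharZero K]
    [Algebra.IsAlgebraic ℤ K] (S : Finset K) (hS : (0 : K) ∉ S) :
    ∃ f : ℤ[X], f.eval 0 ≠ 0 ∧ ∀ k ∈ S, aeval k f = 0 := by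
  have key (k : K) : ∃ q : ℤ[X], k ≠ 0 → q.coeff 0 ≠ 0 ∧ aeval k q = 0 := by
    by_cases hk : k = 0
    · exact ⟨0, fun h => absurd hk h⟩
    · obtain ⟨q, hq⟩ := (Algebra.IsAlgebraic.isAlgebraic (R := ℤ)
        k).exists_nonzero_coeff_and_aeval_eq_zero (mem_nonZeroDivisors_of_ne_zero hk)
      exact ⟨q, fun _ => hq⟩
  choose q hq using key
  refine ⟨∏ k ∈ S, q k, ?_, fun k hk => ?_⟩
  · rw [eval_prod, Finset.prod_ne_zero_iff]
    intro k hk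
    rw [← coeff_zero_eq_eval_zero]
    exact (hq k (ne_of_mem_of_not_mem hk hS)).1
  · rw [map_prod]
    exact Finset.prod_eq_zero hk (hq k (ne_of_mem_of_not_mem hk hS)).2

open Polynomial in
theorem IsIntegral.pow_mul_aeval {K : Type*} [CommRing K] {d : ℤ} {k : K}
    (h : IsIntegral ℤ (d • k)) (g : ℤ[X]) {m : ℕ} (hm : g.natDegree ≤ m) :
    IsIntegral ℤ ((d : K) ^ m * aeval k g) := by
  rw [aeval_eq_sum_range' (Nat.lt_succ_of_le hm), Finset.mul_sum]
  refine IsIntegral.sum _ fun i hi => ?_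
  have hi' : i ≤ m := Nat.lt_succ_iff.mp (Finset.mem_range.mp hi)
  have : (d : K) ^ m * (g.coeff i • k ^ i) =
      algebraMap ℤ K (d ^ (m - i) * g.coeff i) * (d • k) ^ i := by
    obtain ⟨j, rfl⟩ := Nat.exists_eq_add_of_le hi'
    simp only [zsmul_eq_mul, algebraMap_int_eq, map_mul, map_pow, eq_intCast,
      Nat.add_sub_cancel_left]
    ring
  rw [this]
  exact isIntegral_algebraMap.mul (h.pow i)

theorem IsGalois.exists_int_of_isIntegral_of_fixed {K : Type*} [Field K] [NumberField K]
    [IsGalois ℚ K] {x : K} (hx : IsIntegral ℤ x) (hfix : ∀ σ : K ≃ₐ[ℚ] K, σ x = x) :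
    ∃ t : ℤ, (t : K) = x := by
  obtain ⟨q, rfl⟩ := (IsGalois.mem_range_algebraMap_iff_fixed x).2 hfix
  obtain ⟨t, rfl⟩ := IsIntegrallyClosed.isIntegral_iff.1
    ((isIntegral_algebraMap_iff (algebraMap ℚ K).injective).1 hx)
  exact ⟨t, by simp⟩

theorem eventually_const_mul_pow_div_factorial_pred_lt_one (B A : ℝ) :
    ∀ᶠ p : ℕ in Filter.atTop, B * (A ^ p / (p - 1).factorial) < 1 := by
  have h : Filter.Tendsto (fun m : ℕ => B * A * (A ^ m / m.factorial)) Filter.atTop (nhds 0) := by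
    simpa using (FloorSemiring.tendsto_pow_div_factorial_atTop A).const_mul (B * A)
  filter_upwards [(h.comp (Filter.tendsto_sub_atTop_nat 1)).eventually_lt_const one_pos,
    Filter.eventually_ge_atTop 1] with p hp hp1
  obtain ⟨m, rfl⟩ := Nat.exists_eq_add_of_le' hp1
  simp only [Function.comp_apply, Nat.add_sub_cancel] at hp ⊢
  rwa [pow_succ', mul_div_assoc, ← mul_assoc]

open Polynomial in
/-- The Galois-invariant case of the Lindemann–Weierstrass theorem. -/
theorem sum_mul_exp_ne_zero_of_invariant {K : Type*} [Field K] [NumberField K] [IsGalois ℚ K]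
    (φ : K →+* ℂ) (w : K →₀ ℤ) (hw : ∀ (σ : K ≃ₐ[ℚ] K) k, w (σ k) = w k) (hw0 : w 0 ≠ 0) :
    w.sum (fun k a => (a : ℂ) * Complex.exp (φ k)) ≠ 0 := by
  classical
  intro h0
  have : Algebra.IsAlgebraic ℤ K := (IsFractionRing.comap_isAlgebraic_iff (A := ℤ) (K := ℚ)).2
    inferInstance
  set S := w.support.erase 0 with hS
  have hSσ (σ : K ≃ₐ[ℚ] K) (k : K) : σ k ∈ S ↔ k ∈ S := by simp [hS, hw]
  obtain ⟨f, hf0, hf⟩ := exists_int_polynomial_eval_zero_ne_zero S (by simp [hS])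
  obtain ⟨d, hd0, hd⟩ := Algebra.IsAlgebraic.exists_integral_multiples ℤ S
  obtain ⟨c, hc⟩ := LindemannWeierstrass.exp_polynomial_approx f hf0
  set D := f.natDegree
  set B := ∑ k ∈ S, |(w k : ℝ)|
  obtain ⟨N, hN⟩ := Filter.eventually_atTop.1
    (eventually_const_mul_pow_div_factorial_pred_lt_one B (|(d : ℝ)| ^ D * c))
  obtain ⟨p, hpN, hp⟩ := Nat.exists_infinite_primes
    (N + (f.eval 0).natAbs + (w 0).natAbs + d.natAbs + 1)
  obtain ⟨n, hn, g, hg, happrox⟩ := hc p (by omega) hp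
  have hroot {k : K} (hk : k ∈ S) : φ k ∈ f.aroots ℂ := by
    rw [mem_aroots]
    refine ⟨fun h => hf0 (by simp [h]), ?_⟩
    have := congrArg φ.toIntAlgHom (hf k hk)
    rwa [map_zero, ← aeval_algHom_apply] at this
  obtain ⟨t, ht⟩ : ∃ t : ℤ, (t : K) = ∑ k ∈ S, (w k : K) * ((d : K) ^ (p * D) * aeval k g) := by
    refine IsGalois.exists_int_of_isIntegral_of_fixed (IsIntegral.sum _ fun k hk => ?_) fun σ => ?_
    · have := (hd k hk).pow_mul_aeval g (hg.trans (Nat.sub_le _ 1))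
      exact (isIntegral_algebraMap (x := w k)).mul this
    · rw [map_sum]
      refine Finset.sum_equiv σ.toEquiv (fun k => (hSσ σ k).symm) fun k _ => ?_
      have : σ (aeval k g) = aeval (σ k) g :=
        (aeval_algHom_apply (σ.toRingEquiv.toRingHom.toIntAlgHom) k g).symm
      simp [hw, this]
  have htC : (t : ℂ) = ∑ k ∈ S, (w k : ℂ) * ((d : ℂ) ^ (p * D) * aeval (φ k) g) := by
    have hφ (k : K) : φ (aeval k g) = aeval (φ k) g :=
      (aeval_algHom_apply φ.toIntAlgHom k g).symm
    simpa [hφ] using congrArg φ ht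
  have hsum : (w 0 : ℂ) + ∑ k ∈ S, (w k : ℂ) * Complex.exp (φ k) = 0 := by
    rw [← h0, Finsupp.sum, ← Finset.add_sum_erase _ _ (Finsupp.mem_support_iff.2 hw0)]
    simp [hS]
  set M : ℤ := d ^ (p * D) * n * w 0 + p * t with hM
  have hMC : (M : ℂ) = -((d : ℂ) ^ (p * D) *
      ∑ k ∈ S, (w k : ℂ) * (n • Complex.exp (φ k) - p • aeval (φ k) g)) := by
    have h1 : (w 0 : ℂ) = -∑ k ∈ S, (w k : ℂ) * Complex.exp (φ k) := eq_neg_of_add_eq_zero_left hsum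
    rw [hM]
    push_cast
    rw [htC, h1]
    simp only [mul_neg, Finset.mul_sum, zsmul_eq_mul, nsmul_eq_mul]
    rw [← Finset.sum_neg_distrib, ← Finset.sum_neg_distrib, ← Finset.sum_add_distrib]
    exact Finset.sum_congr rfl fun k _ => by ring
  have hpZ : Prime (p : ℤ) := Nat.prime_iff_prime_int.1 hp
  have hndvd {a : ℤ} (ha : a ≠ 0) (hap : a.natAbs < p) : ¬ (p : ℤ) ∣ a := fun h =>
    absurd (Nat.le_of_dvd (Int.natAbs_pos.2 ha) (Int.natCast_dvd.1 h)) (by omega)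
  have hM0 : M ≠ 0 := by
    intro h
    have h2 : (p : ℤ) ∣ d ^ (p * D) * n * w 0 :=
      (Int.dvd_add_left (dvd_mul_right _ t)).1 (by rw [← hM, h]; exact dvd_zero _)
    rcases hpZ.dvd_or_dvd h2 with h3 | h3
    · rcases hpZ.dvd_or_dvd h3 with h4 | h4
      · exact hndvd hd0 (by omega) (hpZ.dvd_of_dvd_pow h4)
      · exact hn h4
    · exact hndvd hw0 (by omega) h3
  have hlow : (1 : ℝ) ≤ ‖(M : ℂ)‖ := by
    rw [Complex.norm_intCast]
    exact_mod_cast Int.one_le_abs hM0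
  have hup : ‖(M : ℂ)‖ ≤ B * ((|(d : ℝ)| ^ D * c) ^ p / (p - 1).factorial) := by
    rw [hMC, norm_neg, norm_mul, norm_pow, Complex.norm_intCast]
    calc _ ≤ |(d : ℝ)| ^ (p * D) * ∑ k ∈ S, |(w k : ℝ)| * (c ^ p / (p - 1).factorial) := by
          gcongr
          refine norm_sum_le_of_le _ fun k hk => ?_
          rw [norm_mul, Complex.norm_intCast]
          gcongr
          exact happrox (hroot hk)
      _ = _ := by
          rw [← Finset.sum_mul, mul_pow, ← pow_mul, mul_comm D p]
          ring
  linarith [hN p (by omega)]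

namespace AddMonoidAlgebra

variable {K : Type*} [Field K]

/-- The ring homomorphism `∑ a_k [k] ↦ ∑ a_k exp (φ k)`. -/
noncomputable def expEval (φ : K →+* ℂ) : AddMonoidAlgebra ℤ K →ₐ[ℤ] ℂ :=
  lift ℤ ℂ K
    { toFun := fun k => Complex.exp (φ k.toAdd)
      map_one' := by simp
      map_mul' := fun a b => by simp [Complex.exp_add] }

theorem expEval_apply (φ : K →+* ℂ) (x : AddMonoidAlgebra ℤ K) :
    expEval φ x = x.coeff.sum fun k a => (a : ℂ) * Complex.exp (φ k) := by
  simp [expEval, lift_apply]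

/-- The action of a field automorphism on exponents. -/
noncomputable abbrev conj [Algebra ℚ K] (σ : K ≃ₐ[ℚ] K) :
    AddMonoidAlgebra ℤ K ≃ₐ[ℤ] AddMonoidAlgebra ℤ K :=
  domCongr ℤ ℤ (σ : K ≃+ K)

theorem conj_mul_apply [Algebra ℚ K] (σ τ : K ≃ₐ[ℚ] K) (x : AddMonoidAlgebra ℤ K) :
    conj (σ * τ) x = conj σ (conj τ x) := by
  ext k
  simp only [conj, coeff_domCongr]
  rfl

/-- Linear independence over `ℤ` of exponentials of distinct algebraic numbers. -/
theorem expEval_ne_zero [NumberField K] [IsGalois ℚ K] (φ : K →+* ℂ)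
    {x : AddMonoidAlgebra ℤ K} (hx : x ≠ 0) : expEval φ x ≠ 0 := by
  classical
  intro h0
  set y := ∏ σ : K ≃ₐ[ℚ] K, conj σ x
  have hy : y ≠ 0 := Finset.prod_ne_zero_iff.2 fun σ _ => by simpa using hx
  have hyσ (τ : K ≃ₐ[ℚ] K) : conj τ y = y := by
    rw [map_prod]
    exact Fintype.prod_equiv (Equiv.mulLeft τ) _ _ fun σ => (conj_mul_apply τ σ x).symm
  have hy0 : expEval φ y = 0 := by
    rw [map_prod]
    refine Finset.prod_eq_zero (Finset.mem_univ 1) ?_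
    rw [← h0]
    congr 1
    ext k
    simp only [conj, coeff_domCongr]
    rfl
  have hycoeff (τ : K ≃ₐ[ℚ] K) (k : K) : y.coeff (τ k) = y.coeff k := by
    conv_lhs => rw [← hyσ τ, conj, coeff_domCongr]
    congr 1
    exact τ.symm_apply_apply k
  obtain ⟨k₀, hk₀⟩ : ∃ k, y.coeff k ≠ 0 := by
    by_contra! h
    exact hy (by ext k; simpa using h k)
  set z := y * ∑ σ : K ≃ₐ[ℚ] K, single (-σ k₀) (1 : ℤ) with hz
  have hzσ (τ : K ≃ₐ[ℚ] K) : conj τ z = z := by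
    rw [hz, map_mul, hyσ, map_sum]
    congr 1
    refine Fintype.sum_equiv (Equiv.mulLeft τ) _ _ fun σ => ?_
    rw [conj, domCongr_single, map_neg]
    rfl
  refine sum_mul_exp_ne_zero_of_invariant φ z.coeff (fun τ k => ?_) ?_ ?_
  · conv_lhs => rw [← hzσ τ, conj, coeff_domCongr]
    congr 1
    exact τ.symm_apply_apply k
  · have : z.coeff 0 = ∑ σ : K ≃ₐ[ℚ] K, y.coeff k₀ := by
      rw [hz, Finset.mul_sum, coeff_sum, Finsupp.finsetSum_apply]
      refine Finset.sum_congr rfl fun σ _ => ?_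
      simp [hycoeff]
    rw [this]
    simp [hk₀]
  · rw [← expEval_apply, hz, map_mul, hy0, zero_mul]

end AddMonoidAlgebra

/-- Finitely many algebraic numbers lie in a common Galois number field. -/
theorem IsAlgebraic.exists_isGalois_numberField {ι L : Type*} [Finite ι] [Field L] [CharZero L]
    [IsAlgClosed L] (ρ : ι → L) (halg : ∀ i, IsAlgebraic ℚ (ρ i)) :
    ∃ K : IntermediateField ℚ L, NumberField K ∧ IsGalois ℚ K ∧ ∀ i, ρ i ∈ K := by
  cases nonempty_fintype ι
  set P := ∏ i, minpoly ℚ (ρ i)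
  have hP : P ≠ 0 := Finset.prod_ne_zero_iff.2 fun i _ => minpoly.ne_zero (halg i).isIntegral
  have : P.IsSplittingField ℚ (IntermediateField.adjoin ℚ (P.rootSet L)) :=
    IntermediateField.adjoin_rootSet_isSplittingField (IsAlgClosed.splits (P.map (algebraMap ℚ L)))
  have := Normal.of_isSplittingField (E := IntermediateField.adjoin ℚ (P.rootSet L)) P
  have hfin := Polynomial.IsSplittingField.finiteDimensional
    (IntermediateField.adjoin ℚ (P.rootSet L)) P
  refine ⟨IntermediateField.adjoin ℚ (P.rootSet L), ⟨⟩, ⟨⟩, fun i => ?_⟩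
  refine IntermediateField.subset_adjoin _ _ ((Polynomial.mem_rootSet_of_ne hP).2 ?_)
  rw [map_prod]
  exact Finset.prod_eq_zero (Finset.mem_univ i) (minpoly.aeval _ _)

/-- Lindemann–Weierstrass: if `ρ₁, …, ρₙ` are algebraic numbers linearly independent over
`ℚ`, then `e^{ρ₁}, …, e^{ρₙ}` are algebraically independent over `ℚ`. -/
theorem lindemann_weierstrass (n : ℕ) (ρ : Fin n → ℂ)
    (halg : ∀ i, IsAlgebraic ℚ (ρ i)) (hli : LinearIndependent ℚ ρ) :
    AlgebraicIndependent ℚ (fun i => Complex.exp (ρ i)) := by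
  have := IsLocalization.isAlgebraic ℚ (nonZeroDivisors ℤ)
  rw [← Algebra.IsAlgebraic.algebraicIndependent_iff ℤ ℚ, algebraicIndependent_iff]
  obtain ⟨K, _, _, hK⟩ := IsAlgebraic.exists_isGalois_numberField ρ halg
  set r : Fin n → K := fun i => ⟨ρ i, hK i⟩
  have hr : LinearIndependent ℕ r :=
    (LinearIndependent.of_comp K.val.toLinearMap (v := r) hli).restrict_scalars
      (fun a b h => by simpa using h)
  set e : (Fin n →₀ ℕ) →+ K := (Finsupp.linearCombination ℕ r).toAddMonoidHom
  have he : Function.Injective e := hr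
  intro p hp
  by_contra hp0
  refine AddMonoidAlgebra.expEval_ne_zero (algebraMap K ℂ)
    (x := AddMonoidAlgebra.mapDomain e p) (fun h => hp0 ?_) ?_
  · exact AddMonoidAlgebra.mapDomain_injective he (by simpa using h)
  · have hcomp : (AddMonoidAlgebra.expEval (algebraMap K ℂ)).comp
        (AddMonoidAlgebra.mapDomainAlgHom ℤ ℤ e) =
        MvPolynomial.aeval fun i => Complex.exp (ρ i) := by
      refine MvPolynomial.algHom_ext fun i => ?_
      rw [MvPolynomial.aeval_X, MvPolynomial.X, MvPolynomial.monomial]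
      simp [AddMonoidAlgebra.expEval_apply, e, r]
    rw [← hp, ← hcomp]
    rfl
end

section
/- Let α be an irrational algebraic real number and ε > 0. Then there are only finitely many rationals p/q (q ≥ 1, gcd(p,q)=1) with |α - p/q| < 1/q^{2+ε}. -/
namespace Roth

open MvPolynomial Finset

noncomputable section

set_option linter.unusedSectionVars false

variable {σ : Type*} [Fintype σ]

/-! ### Divided partial derivatives -/

/-- The product of the binomial coefficients `(s h).choose (I h)`. -/
def multichoose (s I : σ →₀ ℕ) : ℕ := ∏ h, (s h).choose (I h)

/-- The divided (Hasse) derivative with multi-index `I`. -/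
def hasse (I : σ →₀ ℕ) : MvPolynomial σ ℝ →ₗ[ℝ] MvPolynomial σ ℝ :=
  (basisMonomials σ ℝ).constr ℝ fun s => monomial (s - I) (multichoose s I : ℝ)

lemma multichoose_eq_zero {s I : σ →₀ ℕ} (h : ¬ I ≤ s) : multichoose s I = 0 := by
  rw [Finsupp.le_def] at h
  push Not at h
  obtain ⟨i, hi⟩ := h
  exact prod_eq_zero (mem_univ i) (Nat.choose_eq_zero_of_lt hi)

lemma multichoose_zero_right (s : σ →₀ ℕ) : multichoose s 0 = 1 := by
  simp [multichoose]

lemma multichoose_self (s : σ →₀ ℕ) : multichoose s s = 1 := by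
  simp [multichoose]

lemma multichoose_le (s I : σ →₀ ℕ) : multichoose s I ≤ 2 ^ ∑ h, s h := by
  rw [← prod_pow_eq_pow_sum]
  exact prod_le_prod' fun h _ => Nat.choose_le_two_pow _ _

lemma hasse_monomial (I s : σ →₀ ℕ) (c : ℝ) :
    hasse I (monomial s c) = monomial (s - I) (multichoose s I * c) := by
  have h1 : (monomial s c : MvPolynomial σ ℝ) = c • basisMonomials σ ℝ s := by
    simp [smul_monomial]
  rw [h1, map_smul, hasse, Module.Basis.constr_basis, smul_monomial, smul_eq_mul, mul_comm]

lemma coeff_hasse (I t : σ →₀ ℕ) (P : MvPolynomial σ ℝ) :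
    coeff t (hasse I P) = multichoose (t + I) I * coeff (t + I) P := by
  classical
  induction P using MvPolynomial.induction_on' with
  | add p q hp hq => simp only [map_add, coeff_add, hp, hq, mul_add]
  | monomial s c =>
    rw [hasse_monomial, coeff_monomial, coeff_monomial]
    by_cases hI : I ≤ s
    · by_cases hs : s = t + I
      · subst hs
        simp
      · have : s - I ≠ t := fun h => hs (by rw [← h, tsub_add_cancel_of_le hI])
        simp [hs, this]
    · have hs : s ≠ t + I := fun h => hI (by rw [h]; exact le_add_self)
      simp [hs, multichoose_eq_zero hI]

lemma hasse_zero (P : MvPolynomial σ ℝ) : hasse 0 P = P := by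
  ext t
  simp [coeff_hasse, multichoose_zero_right]

lemma coeff_zero_hasse (I : σ →₀ ℕ) (P : MvPolynomial σ ℝ) :
    coeff 0 (hasse I P) = coeff I P := by
  simp [coeff_hasse, multichoose_self]

lemma pderiv_hasse (I : σ →₀ ℕ) (h : σ) (P : MvPolynomial σ ℝ) :
    pderiv h (hasse I P) = ((I h : ℝ) + 1) • hasse (I + Finsupp.single h 1) P := by
  classical
  ext t
  rw [coeff_pderiv, coeff_smul, coeff_hasse, coeff_hasse]
  have e : t + Finsupp.single h 1 + I = t + (I + Finsupp.single h 1) := by abel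
  rw [e, smul_eq_mul]
  have key : multichoose (t + (I + Finsupp.single h 1)) I * (t h + 1)
      = (I h + 1) * multichoose (t + (I + Finsupp.single h 1)) (I + Finsupp.single h 1) := by
    rw [multichoose, multichoose, ← mul_prod_erase univ _ (mem_univ h),
      ← mul_prod_erase univ _ (mem_univ h)]
    have h2 : ∏ x ∈ univ.erase h, ((t + (I + Finsupp.single h 1) : σ →₀ ℕ) x).choose
          ((I + Finsupp.single h 1 : σ →₀ ℕ) x)
        = ∏ x ∈ univ.erase h, ((t + (I + Finsupp.single h 1) : σ →₀ ℕ) x).choose (I x) := by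
      refine prod_congr rfl fun x hx => ?_
      have : h ≠ x := (ne_of_mem_erase hx).symm
      simp [this]
    rw [h2]
    simp only [Finsupp.add_apply, Finsupp.single_eq_same]
    have := Nat.choose_succ_right_eq (t h + (I h + 1)) (I h)
    have h3 : t h + (I h + 1) - I h = t h + 1 := by omega
    rw [h3] at this
    linear_combination (∏ x ∈ univ.erase h,
      (t x + (I x + (Finsupp.single h 1 : σ →₀ ℕ) x)).choose (I x)) * this.symm
  have key' : (multichoose (t + (I + Finsupp.single h 1)) I : ℝ) * (t h + 1)
      = (I h + 1) * multichoose (t + (I + Finsupp.single h 1)) (I + Finsupp.single h 1) := by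
    exact_mod_cast key
  linear_combination coeff (t + (I + Finsupp.single h 1)) P * key'

/-! ### Translation -/

/-- The polynomial `P(x + ξ)`. -/
def translate (ξ : σ → ℝ) : MvPolynomial σ ℝ →ₐ[ℝ] MvPolynomial σ ℝ :=
  aeval fun h => X h + C (ξ h)

lemma translate_translate_neg (ξ : σ → ℝ) (P : MvPolynomial σ ℝ) :
    translate (-ξ) (translate ξ P) = P := by
  have : (translate (-ξ)).comp (translate ξ) = AlgHom.id ℝ (MvPolynomial σ ℝ) := by
    ext h
    simp [translate, algebraMap_eq]
  exact DFunLike.congr_fun this P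

lemma translate_ne_zero (ξ : σ → ℝ) {P : MvPolynomial σ ℝ} (hP : P ≠ 0) :
    translate ξ P ≠ 0 := by
  intro h
  apply hP
  rw [← translate_translate_neg ξ P, h, map_zero]

lemma eval_translate (ξ η : σ → ℝ) (P : MvPolynomial σ ℝ) :
    eval η (translate ξ P) = eval (η + ξ) P := by
  induction P using MvPolynomial.induction_on with
  | C a => simp [translate, algebraMap_eq]
  | add p q hp hq => simp only [map_add, hp, hq]
  | mul_X p h hp => rw [map_mul, map_mul, map_mul, hp]; simp [translate]

lemma pderiv_translate (ξ : σ → ℝ) (h : σ) (P : MvPolynomial σ ℝ) :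
    pderiv h (translate ξ P) = translate ξ (pderiv h P) := by
  classical
  induction P using MvPolynomial.induction_on with
  | C a => simp [translate, algebraMap_eq]
  | add p q hp hq => simp only [map_add, hp, hq]
  | mul_X p j hp =>
    have : pderiv h (translate ξ (X j)) = translate ξ (pderiv h (X j)) := by
      by_cases hj : j = h
      · subst hj; simp [translate]
      · simp [translate, pderiv_X_of_ne hj]
    rw [map_mul, pderiv_mul, pderiv_mul, map_add, map_mul, map_mul, hp, this]

lemma hasse_translate (ξ : σ → ℝ) (I : σ →₀ ℕ) (P : MvPolynomial σ ℝ) :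
    hasse I (translate ξ P) = translate ξ (hasse I P) := by
  classical
  induction hn : ∑ h, I h generalizing I with
  | zero =>
    have : I = 0 := by
      ext h
      exact (sum_eq_zero_iff.mp hn) h (mem_univ h)
    simp [this, hasse_zero]
  | succ n ih =>
    obtain ⟨h, -, hh⟩ : ∃ h ∈ univ, I h ≠ 0 := by
      by_contra! hc
      rw [sum_eq_zero hc] at hn
      omega
    obtain ⟨J, rfl⟩ : ∃ J, I = J + Finsupp.single h 1 :=
      ⟨I - Finsupp.single h 1, (tsub_add_cancel_of_le (by
        rw [Finsupp.single_le_iff]; omega)).symm⟩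
    have hJ : ∑ h, J h = n := by
      have : ∑ x, (Finsupp.single h 1 : σ →₀ ℕ) x = 1 := by
        simp [Finsupp.single_apply]
      simp only [Finsupp.add_apply, sum_add_distrib, this] at hn
      omega
    have h1 := pderiv_translate ξ h (hasse J P)
    rw [← ih J hJ, pderiv_hasse, pderiv_hasse, map_smul] at h1
    exact smul_right_injective _ (by positivity : (J h : ℝ) + 1 ≠ 0) h1

lemma coeff_translate (ξ : σ → ℝ) (I : σ →₀ ℕ) (P : MvPolynomial σ ℝ) :
    coeff I (translate ξ P) = eval ξ (hasse I P) := by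
  rw [← coeff_zero_hasse, hasse_translate]
  have := eval_translate ξ 0 (hasse I P)
  rw [zero_add] at this
  rw [← this, eval_zero]
  rfl

/-! ### The length of a polynomial -/

/-- The sum of the absolute values of the coefficients. -/
def len (P : MvPolynomial σ ℝ) : ℝ := ∑ s ∈ P.support, |coeff s P|

lemma len_eq_sum {P : MvPolynomial σ ℝ} {T : Finset (σ →₀ ℕ)} (h : P.support ⊆ T) :
    len P = ∑ s ∈ T, |coeff s P| :=
  sum_subset h fun s _ hs => by rw [notMem_support_iff.mp hs, abs_zero]

lemma len_nonneg (P : MvPolynomial σ ℝ) : 0 ≤ len P := sum_nonneg fun _ _ => abs_nonneg _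

lemma abs_coeff_le_len (s : σ →₀ ℕ) (P : MvPolynomial σ ℝ) : |coeff s P| ≤ len P := by
  by_cases hs : s ∈ P.support
  · exact single_le_sum (f := fun s => |coeff s P|) (fun _ _ => abs_nonneg _) hs
  · rw [notMem_support_iff.mp hs, abs_zero]
    exact len_nonneg P

lemma len_add_le (P Q : MvPolynomial σ ℝ) : len (P + Q) ≤ len P + len Q := by
  classical
  rw [len_eq_sum support_add, len_eq_sum (subset_union_left (s₂ := Q.support)),
    len_eq_sum (P := Q) (subset_union_right (s₁ := P.support)), ← sum_add_distrib]
  exact sum_le_sum fun s _ => by rw [coeff_add]; exact abs_add_le _ _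

lemma len_zero : len (0 : MvPolynomial σ ℝ) = 0 := by simp [len]

lemma len_sum_le {ι : Type*} (T : Finset ι) (f : ι → MvPolynomial σ ℝ) :
    len (∑ i ∈ T, f i) ≤ ∑ i ∈ T, len (f i) :=
  le_sum_of_subadditive len len_zero.le len_add_le T f

lemma len_monomial_mul_le (s : σ →₀ ℕ) (c : ℝ) (P : MvPolynomial σ ℝ) :
    len (monomial s c * P) ≤ |c| * len P := by
  classical
  have h : (monomial s c * P).support ⊆ P.support.map (addLeftEmbedding s) := by
    intro t ht
    rw [mem_support_iff, coeff_monomial_mul'] at ht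
    split_ifs at ht with hst
    · rw [mem_map]
      exact ⟨t - s, mem_support_iff.mpr (right_ne_zero_of_mul ht), add_tsub_cancel_of_le hst⟩
    · exact absurd rfl ht
  rw [len_eq_sum h, sum_map, len, mul_sum]
  refine sum_le_sum fun t _ => ?_
  rw [addLeftEmbedding_apply, coeff_monomial_mul, abs_mul]

lemma len_monomial (s : σ →₀ ℕ) (c : ℝ) : len (monomial s c) = |c| := by
  classical
  rw [len_eq_sum support_monomial_subset]
  simp

lemma len_mul_le (P Q : MvPolynomial σ ℝ) : len (P * Q) ≤ len P * len Q := by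
  conv_lhs => rw [P.as_sum, sum_mul]
  refine (len_sum_le _ _).trans ?_
  rw [len, sum_mul]
  exact sum_le_sum fun s _ => len_monomial_mul_le _ _ _

lemma len_one : len (1 : MvPolynomial σ ℝ) = 1 := by
  have := len_monomial (0 : σ →₀ ℕ) 1
  rwa [abs_one] at this

lemma len_prod_le {ι : Type*} (T : Finset ι) (f : ι → MvPolynomial σ ℝ) :
    len (∏ i ∈ T, f i) ≤ ∏ i ∈ T, len (f i) := by
  classical
  induction T using Finset.induction_on with
  | empty => simp [len_one]
  | insert a T ha ih =>
    rw [prod_insert ha, prod_insert ha]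
    exact (len_mul_le _ _).trans (mul_le_mul_of_nonneg_left ih (len_nonneg _))

lemma len_neg (P : MvPolynomial σ ℝ) : len (-P) = len P := by
  simp [len]

lemma len_det_le {k : ℕ} (M : Matrix (Fin k) (Fin k) (MvPolynomial σ ℝ)) {B : ℝ}
    (hM : ∀ i j, len (M i j) ≤ B) : len M.det ≤ k.factorial * B ^ k := by
  rw [Matrix.det_apply]
  refine (len_sum_le _ _).trans ?_
  have : ∀ τ ∈ (univ : Finset (Equiv.Perm (Fin k))),
      len (Equiv.Perm.sign τ • ∏ i, M (τ i) i) ≤ B ^ k := by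
    intro τ _
    have h1 : len (Equiv.Perm.sign τ • ∏ i, M (τ i) i) = len (∏ i, M (τ i) i) := by
      rcases Int.units_eq_one_or (Equiv.Perm.sign τ) with h | h <;> simp [h, len_neg]
    rw [h1]
    refine (len_prod_le _ _).trans ?_
    refine (prod_le_prod (fun _ _ => len_nonneg _) fun i _ => hM (τ i) i).trans ?_
    simp
  refine (sum_le_sum this).trans ?_
  simp [Fintype.card_perm]

lemma len_hasse_le (I : σ →₀ ℕ) {P : MvPolynomial σ ℝ} {R : ℕ}
    (hP : ∀ s ∈ P.support, ∑ h, s h ≤ R) : len (hasse I P) ≤ 2 ^ R * len P := by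
  conv_lhs => rw [P.as_sum, map_sum]
  refine (len_sum_le _ _).trans ?_
  rw [len, mul_sum]
  refine sum_le_sum fun s hs => ?_
  rw [hasse_monomial, len_monomial, abs_mul, Nat.abs_cast]
  gcongr
  exact_mod_cast (multichoose_le s I).trans (Nat.pow_le_pow_right two_pos (hP s hs))

lemma len_translate_le (ξ : σ → ℝ) {A : ℝ} (hA : 0 ≤ A) (hξ : ∀ h, |ξ h| ≤ A)
    {P : MvPolynomial σ ℝ} {R : ℕ} (hP : ∀ s ∈ P.support, ∑ h, s h ≤ R) :
    len (translate ξ P) ≤ (1 + A) ^ R * len P := by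
  conv_lhs => rw [P.as_sum, map_sum]
  refine (len_sum_le _ _).trans ?_
  rw [len, mul_sum]
  refine sum_le_sum fun s hs => ?_
  rw [translate, aeval_monomial, Finsupp.prod_fintype _ _ (by simp), algebraMap_eq]
  refine (len_mul_le _ _).trans ?_
  rw [← monomial_zero', len_monomial, mul_comm]
  refine mul_le_mul_of_nonneg_right ?_ (abs_nonneg _)
  refine (len_prod_le _ _).trans ?_
  have h1 : ∀ h ∈ univ, len ((X h + C (ξ h)) ^ s h : MvPolynomial σ ℝ) ≤ (1 + A) ^ s h := by
    intro h _
    have h2 : len (X h + C (ξ h) : MvPolynomial σ ℝ) ≤ 1 + A := by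
      refine (len_add_le _ _).trans (add_le_add ?_ ?_)
      · rw [X, len_monomial, abs_one]
      · rw [← monomial_zero', len_monomial]
        exact hξ h
    rw [show (X h + C (ξ h) : MvPolynomial σ ℝ) ^ s h = ∏ _i ∈ range (s h), (X h + C (ξ h)) by simp]
    refine (len_prod_le _ _).trans ?_
    refine (prod_le_prod (fun _ _ => len_nonneg _) fun _ _ => h2).trans ?_
    simp
  refine (prod_le_prod (fun _ _ => len_nonneg _) h1).trans ?_
  rw [prod_pow_eq_pow_sum]
  exact pow_le_pow_right₀ (by linarith) (hP s hs)

lemma abs_eval_le {x : σ → ℝ} {P : MvPolynomial σ ℝ} {B : ℝ}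
    (hB : ∀ s ∈ P.support, ∏ h, |x h| ^ s h ≤ B) : |eval x P| ≤ len P * B := by
  rw [eval_eq', len, sum_mul]
  refine (abs_sum_le_sum_abs _ _).trans (sum_le_sum fun s hs => ?_)
  rw [abs_mul, abs_prod]
  simp only [abs_pow]
  exact mul_le_mul_of_nonneg_left (hB s hs) (abs_nonneg _)

/-! ### Degrees -/

lemma degreeOf_hasse_le (I : σ →₀ ℕ) (h : σ) (P : MvPolynomial σ ℝ) :
    degreeOf h (hasse I P) ≤ degreeOf h P := by
  rw [degreeOf_le_iff]
  intro s hs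
  rw [mem_support_iff, coeff_hasse] at hs
  have := degreeOf_le_iff.mp (le_refl (degreeOf h P)) _
    (mem_support_iff.mpr (right_ne_zero_of_mul hs))
  rw [Finsupp.add_apply] at this
  omega

lemma degreeOf_det_le {k : ℕ} {M : Matrix (Fin k) (Fin k) (MvPolynomial σ ℝ)} {h : σ} {D : ℕ}
    (hM : ∀ i j, degreeOf h (M i j) ≤ D) : degreeOf h M.det ≤ k * D := by
  rw [Matrix.det_apply]
  refine (degreeOf_sum_le _ _ _).trans (Finset.sup_le fun τ _ => ?_)
  have h1 : degreeOf h (Equiv.Perm.sign τ • ∏ i, M (τ i) i) = degreeOf h (∏ i, M (τ i) i) := by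
    rcases Int.units_eq_one_or (Equiv.Perm.sign τ) with h | h <;> simp [h, degreeOf_eq_sup]
  rw [h1]
  refine (degreeOf_prod_le _ _ _).trans ((sum_le_sum fun i _ => hM _ _).trans ?_)
  simp

lemma sum_le_of_degreeOf_le {P : MvPolynomial σ ℝ} {r : σ → ℕ} (hP : ∀ h, degreeOf h P ≤ r h) :
    ∀ s ∈ P.support, ∑ h, s h ≤ ∑ h, r h :=
  fun s hs => sum_le_sum fun h _ => degreeOf_le_iff.mp (hP h) s hs

/-! ### Weights of monomials -/

/-- The weight `∑ h, w h * s h` of the monomial with exponent `s`. -/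
def wt (w : σ → ℝ) (s : σ →₀ ℕ) : ℝ := ∑ h, w h * s h

lemma wt_add (w : σ → ℝ) (s t : σ →₀ ℕ) : wt w (s + t) = wt w s + wt w t := by
  simp [wt, mul_add, sum_add_distrib]

lemma wt_nonneg {w : σ → ℝ} (hw : ∀ h, 0 ≤ w h) (s : σ →₀ ℕ) : 0 ≤ wt w s :=
  sum_nonneg fun h _ => mul_nonneg (hw h) (Nat.cast_nonneg _)

/-- All monomials of `P` have weight at least `b`. -/
def WtGE (w : σ → ℝ) (b : ℝ) (P : MvPolynomial σ ℝ) : Prop := ∀ s ∈ P.support, b ≤ wt w s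

lemma WtGE.add {w : σ → ℝ} {b : ℝ} {P Q : MvPolynomial σ ℝ} (hP : WtGE w b P)
    (hQ : WtGE w b Q) : WtGE w b (P + Q) := by
  classical
  intro s hs
  rcases mem_union.mp (support_add hs) with h | h
  exacts [hP s h, hQ s h]

lemma WtGE.zero (w : σ → ℝ) (b : ℝ) : WtGE w b 0 := by
  intro s hs
  simp at hs

lemma WtGE.sum {ι : Type*} {T : Finset ι} {w : σ → ℝ} {b : ℝ} {f : ι → MvPolynomial σ ℝ}
    (hf : ∀ i ∈ T, WtGE w b (f i)) : WtGE w b (∑ i ∈ T, f i) :=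
  Finset.sum_induction f (WtGE w b) (fun _ _ => WtGE.add) (WtGE.zero w b) hf

lemma WtGE.mul {w : σ → ℝ} {b c : ℝ} {P Q : MvPolynomial σ ℝ} (hP : WtGE w b P)
    (hQ : WtGE w c Q) : WtGE w (b + c) (P * Q) := by
  classical
  intro s hs
  obtain ⟨t, ht, u, hu, rfl⟩ := Finset.mem_add.mp (support_mul P Q hs)
  rw [wt_add]
  exact add_le_add (hP t ht) (hQ u hu)

lemma WtGE.prod {ι : Type*} (T : Finset ι) {w : σ → ℝ} {b : ι → ℝ} {f : ι → MvPolynomial σ ℝ}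
    (hf : ∀ i ∈ T, WtGE w (b i) (f i)) : WtGE w (∑ i ∈ T, b i) (∏ i ∈ T, f i) := by
  classical
  induction T using Finset.induction_on with
  | empty =>
    intro s hs
    rw [prod_empty, mem_support_iff, coeff_one] at hs
    have : s = 0 := by
      by_contra h
      exact hs (if_neg fun h' => h h'.symm)
    simp [this, wt]
  | insert a T ha ih =>
    rw [prod_insert ha, sum_insert ha]
    exact (hf a (mem_insert_self a T)).mul (ih fun i hi => hf i (mem_insert_of_mem hi))

lemma WtGE.det {k : ℕ} {M : Matrix (Fin k) (Fin k) (MvPolynomial σ ℝ)} {w : σ → ℝ}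
    {b : Fin k → ℝ} (hM : ∀ i j, WtGE w (b j) (M i j)) : WtGE w (∑ j, b j) M.det := by
  rw [Matrix.det_apply]
  refine WtGE.sum fun τ _ => ?_
  have h1 := WtGE.prod univ (fun i (_ : i ∈ univ) => hM (τ i) i)
  rcases Int.units_eq_one_or (Equiv.Perm.sign τ) with h | h
  · simpa [h] using h1
  · intro s hs
    apply h1 s
    simpa [h] using hs

lemma WtGE.hasse {w : σ → ℝ} {b : ℝ} {P : MvPolynomial σ ℝ} (hP : WtGE w b P) (I : σ →₀ ℕ) :
    WtGE w (b - wt w I) (hasse I P) := by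
  intro s hs
  rw [mem_support_iff, coeff_hasse] at hs
  have := hP _ (mem_support_iff.mpr (right_ne_zero_of_mul hs))
  rw [wt_add] at this
  linarith

/-! ### Integral polynomials -/

/-- The subring of polynomials with integer coefficients. -/
def integralPolys (σ : Type*) : Subring (MvPolynomial σ ℝ) := (map (Int.castRingHom ℝ)).range

lemma mem_integralPolys {P : MvPolynomial σ ℝ} :
    P ∈ integralPolys σ ↔ ∀ s, ∃ z : ℤ, coeff s P = z := by
  constructor
  · rintro ⟨Q, rfl⟩ s
    exact ⟨coeff s Q, by simp [coeff_map]⟩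
  · intro h
    choose z hz using h
    refine ⟨∑ s ∈ P.support, monomial s (z s), ?_⟩
    conv_rhs => rw [P.as_sum]
    simp [map_monomial, hz]

lemma det_mem_integralPolys {k : ℕ} {M : Matrix (Fin k) (Fin k) (MvPolynomial σ ℝ)}
    (hM : ∀ i j, M i j ∈ integralPolys σ) : M.det ∈ integralPolys σ := by
  rw [Matrix.det_apply]
  refine Subring.sum_mem _ fun τ _ => ?_
  have h1 : ∏ i, M (τ i) i ∈ integralPolys σ := Subring.prod_mem _ fun i _ => hM _ _
  rcases Int.units_eq_one_or (Equiv.Perm.sign τ) with h | h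
  · simpa [h] using h1
  · simpa [h] using h1

lemma hasse_mem_integralPolys (I : σ →₀ ℕ) {P : MvPolynomial σ ℝ} (hP : P ∈ integralPolys σ) :
    hasse I P ∈ integralPolys σ := by
  rw [mem_integralPolys] at hP ⊢
  intro s
  obtain ⟨z, hz⟩ := hP (s + I)
  exact ⟨multichoose (s + I) I * z, by rw [coeff_hasse, hz]; push_cast; rfl⟩

lemma one_le_len {P : MvPolynomial σ ℝ} (hP : P ∈ integralPolys σ) (h0 : P ≠ 0) : 1 ≤ len P := by
  obtain ⟨s, hs⟩ := ne_zero_iff.mp h0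
  refine le_trans ?_ (abs_coeff_le_len s P)
  obtain ⟨z, hz⟩ := mem_integralPolys.mp hP s
  rw [hz] at hs ⊢
  exact_mod_cast Int.one_le_abs (by exact_mod_cast hs)

/-! ### Products of polynomials in disjoint sets of variables -/

/-- Only variables in `S` occur in `P`. -/
def SupportedOn (S : Set σ) (P : MvPolynomial σ ℝ) : Prop := ∀ h ∉ S, degreeOf h P = 0

lemma SupportedOn.eq_zero {S : Set σ} {P : MvPolynomial σ ℝ} (hP : SupportedOn S P)
    {s : σ →₀ ℕ} (hs : s ∈ P.support) {h : σ} (hh : h ∉ S) : s h = 0 :=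
  Nat.le_zero.mp (degreeOf_le_iff.mp (hP h hh).le s hs)

lemma SupportedOn.det {k : ℕ} {M : Matrix (Fin k) (Fin k) (MvPolynomial σ ℝ)} {S : Set σ}
    (hM : ∀ i j, SupportedOn S (M i j)) : SupportedOn S M.det := fun h hh =>
  Nat.le_zero.mp ((degreeOf_det_le fun i j => (hM i j h hh).le).trans (mul_zero k).le)

lemma SupportedOn.hasse {S : Set σ} {P : MvPolynomial σ ℝ} (hP : SupportedOn S P)
    (I : σ →₀ ℕ) : SupportedOn S (hasse I P) := fun h hh =>
  Nat.le_zero.mp ((degreeOf_hasse_le I h P).trans (hP h hh).le)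

lemma SupportedOn.hasse_eq_zero {S : Set σ} {P : MvPolynomial σ ℝ} (hP : SupportedOn S P)
    {I : σ →₀ ℕ} {h : σ} (hh : h ∉ S) (hI : I h ≠ 0) : Roth.hasse I P = 0 := by
  ext s
  rw [coeff_hasse]
  by_cases hs : s + I ∈ P.support
  · have := hP.eq_zero hs hh
    rw [Finsupp.add_apply] at this
    omega
  · simp [notMem_support_iff.mp hs]

lemma SupportedOn.translate {S : Set σ} {P : MvPolynomial σ ℝ} (hP : SupportedOn S P)
    (ξ : σ → ℝ) : SupportedOn S (translate ξ P) := by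
  classical
  intro h hh
  rw [← Nat.le_zero, degreeOf_le_iff]
  intro s hs
  by_contra hc
  rw [mem_support_iff, coeff_translate, hP.hasse_eq_zero hh (by omega)] at hs
  simp at hs

lemma coeff_add_mul {S : Set σ} {P Q : MvPolynomial σ ℝ} (hP : SupportedOn S P)
    (hQ : SupportedOn Sᶜ Q) {s t : σ →₀ ℕ} (hs : ∀ h ∉ S, s h = 0) (ht : ∀ h ∈ S, t h = 0) :
    coeff (s + t) (P * Q) = coeff s P * coeff t Q := by
  classical
  rw [coeff_mul, sum_eq_single (s, t)]
  · rintro ⟨a, b⟩ hab hne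
    by_contra hc
    have ha : a ∈ P.support := mem_support_iff.mpr (left_ne_zero_of_mul hc)
    have hb : b ∈ Q.support := mem_support_iff.mpr (right_ne_zero_of_mul hc)
    replace hab : a + b = s + t := by simpa using hab
    have key : ∀ h, a h = s h ∧ b h = t h := by
      intro h
      have h1 := DFunLike.congr_fun hab h
      rw [Finsupp.add_apply, Finsupp.add_apply] at h1
      by_cases hh : h ∈ S
      · have := hQ.eq_zero hb (h := h) (by simpa using hh)
        have := ht h hh
        omega
      · have := hP.eq_zero ha hh
        have := hs h hh
        omega
    have e1 : a = s := Finsupp.ext fun h => (key h).1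
    have e2 : b = t := Finsupp.ext fun h => (key h).2
    exact hne (by rw [e1, e2])
  · intro h
    simp at h

lemma hasse_add_mul {S : Set σ} {P Q : MvPolynomial σ ℝ} (hP : SupportedOn S P)
    (hQ : SupportedOn Sᶜ Q) {I J : σ →₀ ℕ} (hI : ∀ h ∉ S, I h = 0) (hJ : ∀ h ∈ S, J h = 0) :
    hasse (I + J) (P * Q) = hasse I P * hasse J Q := by
  classical
  conv_lhs => rw [P.as_sum, Q.as_sum]
  conv_rhs => rw [P.as_sum, Q.as_sum]
  simp only [sum_mul_sum, map_sum]
  refine sum_congr rfl fun s hs => sum_congr rfl fun t ht => ?_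
  rw [monomial_mul, hasse_monomial, hasse_monomial, hasse_monomial, monomial_mul]
  have h1 : ∀ h, (s h = 0 ∧ I h = 0) ∨ (t h = 0 ∧ J h = 0) := by
    intro h
    by_cases hh : h ∈ S
    · exact Or.inr ⟨hQ.eq_zero ht (by simpa using hh), hJ h hh⟩
    · exact Or.inl ⟨hP.eq_zero hs hh, hI h hh⟩
  have h2 : s + t - (I + J) = s - I + (t - J) := by
    ext h
    simp only [Finsupp.add_apply, Finsupp.tsub_apply]
    rcases h1 h with h | h <;> omega
  have h3 : multichoose (s + t) (I + J) = multichoose s I * multichoose t J := by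
    simp only [multichoose, ← prod_mul_distrib, Finsupp.add_apply]
    refine prod_congr rfl fun h _ => ?_
    rcases h1 h with h | h <;> simp [h.1, h.2]
  rw [h2, h3]
  congr 1
  push_cast
  ring

lemma len_coeff_mul_le {S : Set σ} {P Q : MvPolynomial σ ℝ} (hP : SupportedOn S P)
    (hQ : SupportedOn Sᶜ Q) {s : σ →₀ ℕ} (hs : s ∈ P.support) :
    len (C (coeff s P) * Q) ≤ len (P * Q) := by
  classical
  have h1 : ∀ t ∈ Q.support, coeff (s + t) (P * Q) = coeff s P * coeff t Q := fun t ht =>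
    coeff_add_mul hP hQ (fun h hh => hP.eq_zero hs hh)
      fun h hh => hQ.eq_zero ht (by simpa using hh)
  have h2 : Q.support.map (addLeftEmbedding s) ⊆ (P * Q).support := by
    intro u hu
    obtain ⟨t, ht, rfl⟩ := mem_map.mp hu
    rw [addLeftEmbedding_apply, mem_support_iff, h1 t ht]
    exact mul_ne_zero (mem_support_iff.mp hs) (mem_support_iff.mp ht)
  have h3 : (C (coeff s P) * Q).support ⊆ Q.support := by
    intro t ht
    rw [mem_support_iff, coeff_C_mul] at ht
    exact mem_support_iff.mpr (right_ne_zero_of_mul ht)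
  rw [len_eq_sum h3]
  refine le_trans (le_of_eq ?_) (sum_le_sum_of_subset_of_nonneg h2 fun _ _ _ => abs_nonneg _)
  rw [sum_map]
  exact sum_congr rfl fun t ht => by rw [addLeftEmbedding_apply, h1 t ht, coeff_C_mul]

lemma coeff_mul_mem_integralPolys {S : Set σ} {P Q : MvPolynomial σ ℝ} (hP : SupportedOn S P)
    (hQ : SupportedOn Sᶜ Q) {s : σ →₀ ℕ} (hs : s ∈ P.support) (hPQ : P * Q ∈ integralPolys σ) :
    C (coeff s P) * Q ∈ integralPolys σ := by
  rw [mem_integralPolys] at hPQ ⊢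
  intro t
  rw [coeff_C_mul]
  by_cases ht : t ∈ Q.support
  · obtain ⟨z, hz⟩ := hPQ (s + t)
    refine ⟨z, ?_⟩
    rw [← hz, coeff_add_mul hP hQ (fun h hh => hP.eq_zero hs hh)
      fun h hh => hQ.eq_zero ht (by simpa using hh)]
  · exact ⟨0, by simp [notMem_support_iff.mp ht]⟩

/-! ### Generalized Wronskians -/

lemma eq_zero_of_mul_pderiv_eq {a b : MvPolynomial σ ℝ} (ha : coeff 0 a ≠ 0)
    (hb : coeff 0 b = 0) (hab : ∀ h, a * pderiv h b = b * pderiv h a) : b = 0 := by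
  classical
  by_contra hb0
  obtain ⟨s, hs, hmin⟩ := exists_min_image b.support (fun s => s.degree)
    (support_nonempty.mpr hb0)
  have hs0 : s ≠ 0 := fun h => (mem_support_iff.mp hs) (by rw [h, hb])
  obtain ⟨h, hh⟩ := Finsupp.ne_iff.mp hs0
  obtain ⟨t, rfl⟩ : ∃ t, s = t + Finsupp.single h 1 :=
    ⟨s - Finsupp.single h 1, (tsub_add_cancel_of_le (by
      rw [Finsupp.single_le_iff]; simp at hh; omega)).symm⟩
  have hzero : ∀ u : σ →₀ ℕ, u.degree < t.degree + 1 → coeff u b = 0 := by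
    intro u hu
    by_contra hc
    have := hmin u (mem_support_iff.mpr hc)
    rw [map_add, Finsupp.degree_single] at this
    omega
  have key := congrArg (coeff t) (hab h)
  rw [coeff_mul, coeff_mul] at key
  have hR : ∑ x ∈ antidiagonal t, coeff x.1 b * coeff x.2 (pderiv h a) = 0 := by
    refine sum_eq_zero fun x hx => ?_
    have : x.1 + x.2 = t := by simpa using hx
    rw [hzero x.1 (by rw [← this, map_add]; omega), zero_mul]
  have hL : ∑ x ∈ antidiagonal t, coeff x.1 a * coeff x.2 (pderiv h b)
      = coeff 0 a * coeff t (pderiv h b) := by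
    rw [sum_eq_single (0, t)]
    · rintro ⟨u, v⟩ hx hne
      have huv : u + v = t := by simpa using hx
      have hu : u ≠ 0 := by
        rintro rfl
        exact hne (by rw [← huv, zero_add])
      have : 0 < u.degree := by
        rw [Nat.pos_iff_ne_zero, Ne, Finsupp.degree_eq_zero_iff]
        exact hu
      have hv : coeff (v + Finsupp.single h 1) b = 0 := hzero _ (by
        rw [← huv, map_add, map_add, Finsupp.degree_single]; omega)
      simp [coeff_pderiv, hv]
    · intro h
      simp at h
  rw [hR, hL, coeff_pderiv] at key
  refine mul_ne_zero ha (mul_ne_zero (mem_support_iff.mp hs) ?_) key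
  positivity

lemma exists_eq_C_mul_of_mul_pderiv_eq {a b : MvPolynomial σ ℝ} (ha : a ≠ 0)
    (hab : ∀ h, a * pderiv h b = b * pderiv h a) : ∃ c : ℝ, b = C c * a := by
  obtain ⟨ξ, hξ⟩ : ∃ ξ, eval ξ a ≠ 0 := by
    by_contra! hc
    exact ha (MvPolynomial.funext fun x => by simp [hc x])
  have hc0 : ∀ P : MvPolynomial σ ℝ, coeff 0 (translate ξ P) = eval ξ P := fun P => by
    rw [coeff_translate, hasse_zero]
  set c := eval ξ b / eval ξ a with hc
  refine ⟨c, ?_⟩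
  have h1 : translate ξ (b - C c * a) = 0 := by
    refine eq_zero_of_mul_pderiv_eq (a := translate ξ a) (by rwa [hc0]) ?_ fun h => ?_
    · rw [hc0, map_sub, map_mul, eval_C, hc]
      field_simp
      ring
    · rw [pderiv_translate, pderiv_translate, ← map_mul, ← map_mul, map_sub, pderiv_C_mul]
      congr 1
      linear_combination hab h
  by_contra hne
  exact translate_ne_zero ξ (sub_ne_zero.mpr hne) h1

theorem exists_wronskian_ne_zero {k : ℕ} (f : Fin k → MvPolynomial σ ℝ)
    (hf : LinearIndependent ℝ f) :
    ∃ I : Fin k → σ →₀ ℕ, (∀ i, ∑ h, I i h ≤ i) ∧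
      (Matrix.of fun i j => hasse (I i) (f j)).det ≠ 0 := by
  classical
  induction k with
  | zero => exact ⟨fun i => i.elim0, fun i => i.elim0, by simp⟩
  | succ k ih =>
    obtain ⟨I, hI, hdet⟩ := ih (fun j => f j.castSucc)
      (hf.comp _ (Fin.castSucc_injective k))
    by_contra! hcon
    set c : Fin (k + 1) → MvPolynomial σ ℝ := fun j =>
      (-1) ^ (k + j : ℕ) * (Matrix.of fun i i' => hasse (I i) (f (j.succAbove i'))).det with hc
    have hrel : ∀ J : σ →₀ ℕ, ∑ h, J h ≤ k → ∑ j, c j * hasse J (f j) = 0 := by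
      intro J hJ
      have h1 := hcon (Fin.snoc I J) (by
        intro i
        refine Fin.lastCases ?_ (fun i => ?_) i
        · simpa using hJ
        · simpa using hI i)
      rw [Matrix.det_succ_row _ (Fin.last k)] at h1
      rw [← h1]
      refine sum_congr rfl fun j _ => ?_
      have h2 : (Matrix.of fun (i : Fin (k + 1)) j => hasse ((Fin.snoc I J : Fin (k + 1) → σ →₀ ℕ) i)
          (f j)).submatrix (Fin.last k).succAbove j.succAbove
          = Matrix.of fun i i' => hasse (I i) (f (j.succAbove i')) := by
        ext1 i i'
        simp [Fin.succAbove_last]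
      rw [h2]
      simp only [hc, Matrix.of_apply, Fin.snoc_last, Fin.val_last]
      ring
    have hlast : c (Fin.last k) ≠ 0 := by
      simp only [hc, Fin.succAbove_last]
      exact mul_ne_zero (pow_ne_zero _ (neg_ne_zero.mpr one_ne_zero)) hdet
    have hder : ∀ (h : σ) (J : σ →₀ ℕ), ∑ h, J h < k →
        ∑ j, pderiv h (c j) * hasse J (f j) = 0 := by
      intro h J hJ
      have h1 := congrArg (pderiv h) (hrel J hJ.le)
      rw [map_sum, map_zero] at h1
      have h2 := hrel (J + Finsupp.single h 1) (by
        simp only [Finsupp.add_apply, sum_add_distrib]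
        have : ∑ x, (Finsupp.single h 1 : σ →₀ ℕ) x = 1 := by simp [Finsupp.single_apply]
        omega)
      have h3 : ∀ j, pderiv h (c j * hasse J (f j)) = pderiv h (c j) * hasse J (f j)
          + C ((J h : ℝ) + 1) * (c j * hasse (J + Finsupp.single h 1) (f j)) := by
        intro j
        rw [pderiv_mul, pderiv_hasse, smul_eq_C_mul]
        ring
      simp only [h3, sum_add_distrib, ← mul_sum, h2, mul_zero, add_zero] at h1
      exact h1
    have hconst : ∀ j, ∃ l : ℝ, c j = C l * c (Fin.last k) := by
      intro j
      refine exists_eq_C_mul_of_mul_pderiv_eq hlast fun h => ?_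
      refine Fin.lastCases rfl (fun j => ?_) j
      set v : Fin k → MvPolynomial σ ℝ := fun j =>
        c (Fin.last k) * pderiv h (c j.castSucc) - c j.castSucc * pderiv h (c (Fin.last k)) with hv
      have hv0 : v = 0 := by
        refine Matrix.eq_zero_of_mulVec_eq_zero hdet ?_
        ext1 i
        have hlt : ∑ h, I i h < k := (hI i).trans_lt i.isLt
        have e1 := hrel (I i) hlt.le
        have e2 := hder h (I i) hlt
        rw [Fin.sum_univ_castSucc] at e1 e2
        simp only [Matrix.mulVec, dotProduct, Matrix.of_apply, hv, Pi.zero_apply]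
        have e3 : ∑ x : Fin k, hasse (I i) (f x.castSucc) * (c (Fin.last k) * pderiv h (c x.castSucc)
              - c x.castSucc * pderiv h (c (Fin.last k)))
            = c (Fin.last k) * ∑ x : Fin k, pderiv h (c x.castSucc) * hasse (I i) (f x.castSucc)
              - pderiv h (c (Fin.last k)) * ∑ x : Fin k, c x.castSucc
                * hasse (I i) (f x.castSucc) := by
          rw [mul_sum, mul_sum, ← sum_sub_distrib]
          exact sum_congr rfl fun x _ => by ring
        rw [e3]
        linear_combination c (Fin.last k) * e2 - pderiv h (c (Fin.last k)) * e1
      exact sub_eq_zero.mp (congrFun hv0 j)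
    choose l hl using hconst
    have h0 := hrel 0 (by simp)
    have h1 : c (Fin.last k) * ∑ j, l j • f j = 0 := by
      rw [← h0, mul_sum]
      refine sum_congr rfl fun j _ => ?_
      conv_rhs => rw [hl j]
      rw [hasse_zero, smul_eq_C_mul]
      ring
    have h2 := (mul_eq_zero.mp h1).resolve_left hlast
    have h3 := Fintype.linearIndependent_iff.mp hf l h2 (Fin.last k)
    apply hlast
    rw [hl (Fin.last k), h3, C_0, zero_mul]

/-! ### Polynomials in one variable -/

lemma pow_le_abs_leadingCoeff {g : Polynomial ℤ} {p : ℤ} {q ℓ : ℕ} (hg : g ≠ 0)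
    (hq : 0 < q) (hpq : Int.gcd p q = 1)
    (hdvd : (Polynomial.X - Polynomial.C ((p : ℚ) / q)) ^ ℓ ∣ g.map (Int.castRingHom ℚ)) :
    (q : ℤ) ^ ℓ ≤ |g.leadingCoeff| := by
  set f : Polynomial ℤ := Polynomial.C (q : ℤ) * Polynomial.X + Polynomial.C (-p) with hf
  have hq0 : (q : ℤ) ≠ 0 := by exact_mod_cast hq.ne'
  have hprim : f.IsPrimitive := by
    intro a ha
    rw [Polynomial.C_dvd_iff_dvd_coeff] at ha
    have h0 := ha 0
    have h1 := ha 1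
    rw [hf, Polynomial.coeff_add, Polynomial.coeff_C_mul, Polynomial.coeff_X_zero,
      Polynomial.coeff_C_zero, mul_zero, zero_add, dvd_neg] at h0
    rw [hf, Polynomial.coeff_add, Polynomial.coeff_C_mul, Polynomial.coeff_X_one,
      Polynomial.coeff_C_succ, mul_one, add_zero] at h1
    have h2 := Int.dvd_coe_gcd h0 h1
    rw [hpq] at h2
    exact isUnit_of_dvd_one (by simpa using h2)
  have hprim' : ∀ n : ℕ, (f ^ n).IsPrimitive := by
    intro n
    induction n with
    | zero => rw [pow_zero]; exact Polynomial.isPrimitive_one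
    | succ n ih => rw [pow_succ]; exact ih.mul hprim
  have hfd : f ^ ℓ ∣ g := by
    rw [Polynomial.IsPrimitive.Int.dvd_iff_map_cast_dvd_map_cast _ _ (hprim' ℓ)]
    have hmap : f.map (Int.castRingHom ℚ)
        = Polynomial.C (q : ℚ) * (Polynomial.X - Polynomial.C ((p : ℚ) / q)) := by
      have hq1 : (q : ℚ) ≠ 0 := by exact_mod_cast hq.ne'
      rw [mul_sub, ← Polynomial.C_mul, mul_div_cancel₀ _ hq1]
      simp [hf, sub_eq_add_neg]
    rw [Polynomial.map_pow, hmap, mul_pow, ← Polynomial.C_pow]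
    have hu : IsUnit (Polynomial.C ((q : ℚ) ^ ℓ)) :=
      Polynomial.isUnit_C.mpr (IsUnit.mk0 _ (by positivity))
    exact (hu.mul_left_dvd).mpr hdvd
  obtain ⟨v, rfl⟩ := hfd
  have hlc : f.leadingCoeff = q := Polynomial.leadingCoeff_linear hq0
  have hv : v ≠ 0 := right_ne_zero_of_mul hg
  rw [Polynomial.leadingCoeff_mul, Polynomial.leadingCoeff_pow, hlc, abs_mul, abs_pow,
    Nat.abs_cast]
  have : 1 ≤ |v.leadingCoeff| := Int.one_le_abs (Polynomial.leadingCoeff_ne_zero.mpr hv)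
  exact le_mul_of_one_le_right (by positivity) this

lemma exists_coeff_translate_ne_zero_of_univariate {P : MvPolynomial σ ℝ}
    (hP : P ∈ integralPolys σ) (h0 : P ≠ 0) {t : σ} (ht : SupportedOn {t} P) {p : ℤ} {q : ℕ}
    (hq : 0 < q) (hpq : Int.gcd p q = 1) {ξ : σ → ℝ} (hξ : ξ t = p / q) :
    ∃ ℓ : ℕ, coeff (Finsupp.single t ℓ) (translate ξ P) ≠ 0 ∧ (q : ℝ) ^ ℓ ≤ len P := by
  classical
  choose z hz using mem_integralPolys.mp hP
  set g : Polynomial ℤ := ∑ s ∈ P.support, Polynomial.monomial (s t) (z s) with hg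
  have hs : ∀ s ∈ P.support, s = Finsupp.single t (s t) := by
    intro s hs
    ext h
    by_cases hh : h = t
    · simp [hh]
    · rw [ht.eq_zero hs (by simpa using hh), Finsupp.single_eq_of_ne hh]
  have hPg : P = Polynomial.aeval (X t) (g.map (Int.castRingHom ℝ)) := by
    conv_lhs => rw [P.as_sum]
    rw [hg, Polynomial.map_sum, map_sum]
    refine sum_congr rfl fun s h => ?_
    rw [Polynomial.map_monomial, Polynomial.aeval_monomial, algebraMap_eq, hz s]
    rw [X_pow_eq_monomial, C_mul_monomial, mul_one, ← hs s h]
    simp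
  have hcoeff : ∀ a : ℕ, g.coeff a = z (Finsupp.single t a) := by
    intro a
    rw [hg, Polynomial.finsetSum_coeff]
    simp only [Polynomial.coeff_monomial]
    by_cases ha : Finsupp.single t a ∈ P.support
    · rw [sum_eq_single_of_mem _ ha]
      · simp
      · intro s h hne
        rw [if_neg]
        intro h'
        exact hne (by rw [hs s h, h'])
    · rw [sum_eq_zero]
      · have := notMem_support_iff.mp ha
        rw [hz] at this
        exact_mod_cast this.symm
      · intro s h
        rw [if_neg]
        rintro rfl
        exact ha (by rwa [← hs s h])
  have hg0 : g ≠ 0 := by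
    intro h
    rw [h, Polynomial.map_zero, map_zero] at hPg
    exact h0 hPg
  have hgq : g.map (Int.castRingHom ℚ) ≠ 0 :=
    (Polynomial.map_ne_zero_iff (Int.cast_injective)).mpr hg0
  obtain ⟨u, hu, hnd⟩ := Polynomial.exists_eq_pow_rootMultiplicity_mul_and_not_dvd
    (g.map (Int.castRingHom ℚ)) hgq ((p : ℚ) / q)
  set ℓ := (g.map (Int.castRingHom ℚ)).rootMultiplicity ((p : ℚ) / q)
  refine ⟨ℓ, ?_, ?_⟩
  · have hmap : g.map (Int.castRingHom ℝ)
        = (Polynomial.X - Polynomial.C (ξ t)) ^ ℓ * u.map (Rat.castHom ℝ) := by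
      have := congrArg (Polynomial.map (Rat.castHom ℝ)) hu
      rw [Polynomial.map_map] at this
      rw [show (Int.castRingHom ℝ) = (Rat.castHom ℝ).comp (Int.castRingHom ℚ) from
        RingHom.ext_int _ _, this]
      simp [hξ]
    have ht1 : translate ξ P = monomial (Finsupp.single t ℓ) 1
        * translate ξ (Polynomial.aeval (X t) (u.map (Rat.castHom ℝ))) := by
      rw [hPg, hmap, map_mul, map_mul, map_pow, map_pow]
      congr 1
      simp [translate, algebraMap_eq, X_pow_eq_monomial]
    rw [ht1]
    have := coeff_monomial_mul (0 : σ →₀ ℕ) (Finsupp.single t ℓ) (1 : ℝ)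
      (translate ξ (Polynomial.aeval (X t) (u.map (Rat.castHom ℝ))))
    rw [add_zero] at this
    rw [this, one_mul, coeff_translate, hasse_zero]
    have e : eval ξ (Polynomial.aeval (X t) (u.map (Rat.castHom ℝ)))
        = (u.map (Rat.castHom ℝ)).eval (ξ t) := by
      rw [Polynomial.aeval_def, Polynomial.hom_eval₂, eval_X, Polynomial.eval, algebraMap_eq,
        show (eval ξ).comp (C : ℝ →+* MvPolynomial σ ℝ) = RingHom.id ℝ from RingHom.ext (by simp)]
    rw [e, hξ, show ((p : ℝ) / q) = (Rat.castHom ℝ) ((p : ℚ) / q) by simp,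
      Polynomial.eval_map, Polynomial.eval₂_at_apply]
    rw [Polynomial.dvd_iff_isRoot, Polynomial.IsRoot] at hnd
    simpa using hnd
  · have h1 := pow_le_abs_leadingCoeff hg0 hq hpq (Dvd.intro _ hu.symm)
    refine le_trans ?_ (abs_coeff_le_len (Finsupp.single t g.natDegree) P)
    rw [hz, ← hcoeff]
    exact_mod_cast h1

/-! ### Separating one variable -/

/-- The coefficient of `X t ^ a` in `P`, a polynomial in the other variables. -/
def slice (t : σ) (a : ℕ) (P : MvPolynomial σ ℝ) : MvPolynomial σ ℝ :=
  ∑ s ∈ P.support with s t = a, monomial (s.erase t) (coeff s P)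

lemma sum_slice_mul (t : σ) (P : MvPolynomial σ ℝ) {D : ℕ} (hD : degreeOf t P ≤ D) :
    ∑ a : Fin (D + 1), slice t a P * X t ^ (a : ℕ) = P := by
  classical
  rw [Fin.sum_univ_eq_sum_range (fun a => slice t a P * X t ^ a)]
  conv_rhs => rw [P.as_sum]
  have hmaps : ∀ s ∈ P.support, s t ∈ range (D + 1) := fun s hs =>
    mem_range.mpr (Nat.lt_succ_of_le (degreeOf_le_iff.mp hD s hs))
  rw [← sum_fiberwise_of_maps_to hmaps]
  refine sum_congr rfl fun a _ => ?_
  rw [slice, sum_mul]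
  refine sum_congr rfl fun s hs => ?_
  rw [X_pow_eq_monomial, monomial_mul, mul_one, ← (mem_filter.mp hs).2, Finsupp.erase_add_single]

lemma degreeOf_slice_le (t h : σ) (a : ℕ) (P : MvPolynomial σ ℝ) :
    degreeOf h (slice t a P) ≤ degreeOf h P := by
  classical
  refine (degreeOf_sum_le _ _ _).trans (Finset.sup_le fun s hs => ?_)
  rw [degreeOf_le_iff]
  intro u hu
  rw [mem_singleton.mp (support_monomial_subset hu)]
  refine le_trans ?_ (degreeOf_le_iff.mp le_rfl s (mem_filter.mp hs).1)
  by_cases hh : h = t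
  · simp [hh]
  · rw [Finsupp.erase_ne hh]

lemma degreeOf_slice_self (t : σ) (a : ℕ) (P : MvPolynomial σ ℝ) :
    degreeOf t (slice t a P) = 0 := by
  classical
  rw [← Nat.le_zero]
  refine (degreeOf_sum_le _ _ _).trans (Finset.sup_le fun s hs => ?_)
  rw [degreeOf_le_iff]
  intro u hu
  rw [mem_singleton.mp (support_monomial_subset hu)]
  simp

lemma exists_separation {P : MvPolynomial σ ℝ} (h0 : P ≠ 0) {t : σ} {S : Set σ}
    (hP : ∀ h ∉ S, h ≠ t → degreeOf h P = 0) :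
    ∃ (k : ℕ) (φ ψ : Fin k → MvPolynomial σ ℝ), 0 < k ∧ k ≤ degreeOf t P + 1 ∧
      P = ∑ j, φ j * ψ j ∧ LinearIndependent ℝ φ ∧ LinearIndependent ℝ ψ ∧
      (∀ j, SupportedOn S (φ j)) ∧ (∀ j, SupportedOn {t} (ψ j)) ∧
      ∀ j h, degreeOf h (φ j) ≤ degreeOf h P := by
  classical
  set D := degreeOf t P with hD
  set v : Fin (D + 1) → MvPolynomial σ ℝ := fun a => slice t a P with hv
  obtain ⟨κ, a, ha, hspan, hli⟩ := exists_linearIndependent' ℝ v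
  have : Finite κ := Finite.of_injective a ha
  obtain ⟨k, ⟨e⟩⟩ := Finite.exists_equiv_fin κ
  set φ : Fin k → MvPolynomial σ ℝ := fun j => v (a (e.symm j)) with hφ
  have hφli : LinearIndependent ℝ φ := hli.comp _ e.symm.injective
  have hmem : ∀ b, ∃ c : Fin k → ℝ, ∑ j, c j • φ j = v b := by
    intro b
    rw [← Submodule.mem_span_range_iff_exists_fun]
    have h1 : Set.range φ = Set.range (v ∘ a) := e.symm.surjective.range_comp (v ∘ a)
    rw [h1, hspan]
    exact Submodule.subset_span (Set.mem_range_self b)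
  choose c hc using hmem
  set ψ : Fin k → MvPolynomial σ ℝ := fun j =>
    ∑ b : Fin (D + 1), monomial (Finsupp.single t (b : ℕ)) (c b j) with hψ
  have hsum : P = ∑ j, φ j * ψ j := by
    conv_lhs => rw [← sum_slice_mul t P hD.ge]
    simp only [hψ, mul_sum]
    rw [sum_comm]
    refine sum_congr rfl fun b _ => ?_
    change v b * _ = _
    rw [← hc b, sum_mul]
    refine sum_congr rfl fun j _ => ?_
    rw [X_pow_eq_monomial, smul_mul_assoc, ← mul_smul_comm, smul_monomial, smul_eq_mul, mul_one]
  have hcδ : ∀ i j, c (a (e.symm i)) j = if i = j then 1 else 0 := by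
    intro i j
    have h1 : ∑ j, (c (a (e.symm i)) j - if i = j then 1 else 0) • φ j = 0 := by
      simp only [sub_smul, sum_sub_distrib, hc, ite_smul, one_smul, zero_smul]
      simp [hφ]
    exact sub_eq_zero.mp (Fintype.linearIndependent_iff.mp hφli _ h1 j)
  have hψcoeff : ∀ j (b : Fin (D + 1)), coeff (Finsupp.single t (b : ℕ)) (ψ j) = c b j := by
    intro j b
    rw [hψ, coeff_sum, sum_eq_single_of_mem b (mem_univ b)]
    · simp
    · intro b' _ hne
      rw [coeff_monomial, if_neg]
      intro h
      exact hne (Fin.ext (Finsupp.single_injective t h))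
  have hψli : LinearIndependent ℝ ψ := by
    rw [Fintype.linearIndependent_iff]
    intro l hl i
    have h1 := congrArg (coeff (Finsupp.single t (a (e.symm i) : ℕ))) hl
    simp only [coeff_sum, coeff_smul, hψcoeff, hcδ, coeff_zero] at h1
    simpa using h1
  refine ⟨k, φ, ψ, ?_, ?_, hsum, hφli, hψli, ?_, ?_, fun j h => degreeOf_slice_le _ _ _ _⟩
  · rw [Nat.pos_iff_ne_zero]
    rintro rfl
    exact h0 (by rw [hsum]; simp)
  · have := Fintype.card_le_of_injective (fun j => a (e.symm j)) (ha.comp e.symm.injective)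
    simpa using this
  · intro j h hh
    by_cases hht : h = t
    · rw [hht]
      exact degreeOf_slice_self _ _ _
    · rw [← Nat.le_zero, ← hP h hh hht]
      exact degreeOf_slice_le _ _ _ _
  · intro j h hh
    rw [← Nat.le_zero]
    refine (degreeOf_sum_le _ _ _).trans (Finset.sup_le fun b _ => ?_)
    rw [degreeOf_le_iff]
    intro u hu
    rw [mem_singleton.mp (support_monomial_subset hu), Finsupp.single_eq_of_ne (by simpa using hh)]

/-! ### Elementary estimates -/

lemma sum_max_sub_div_ge {θ : ℝ} (hθ : 0 ≤ θ) (hθ1 : θ ≤ 1) {k r : ℕ} (hr : 0 < r)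
    (hk : k ≤ r + 1) : k * θ ^ 2 / 8 ≤ ∑ j : Fin k, max 0 (θ - (j : ℕ) / r) := by
  set N := ⌈θ * k / 4⌉₊ with hN
  have hNk : N ≤ k := by
    rw [hN, Nat.ceil_le]
    nlinarith [Nat.cast_nonneg (α := ℝ) k]
  rw [Fin.sum_univ_eq_sum_range (fun j => max 0 (θ - (j : ℝ) / r))]
  have h1 : ∑ j ∈ range N, θ / 2 ≤ ∑ j ∈ range N, max 0 (θ - (j : ℝ) / r) := by
    refine sum_le_sum fun j hj => le_max_of_le_right ?_
    have hj' : (j : ℝ) < θ * k / 4 := Nat.lt_ceil.mp (mem_range.mp hj)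
    have hr' : (1 : ℝ) ≤ r := by exact_mod_cast hr
    have hk' : (k : ℝ) ≤ r + 1 := by exact_mod_cast hk
    have h2 : (j : ℝ) / r ≤ θ / 2 := by
      rw [div_le_iff₀ (by linarith)]
      nlinarith
    linarith
  have h2 : ∑ j ∈ range N, max 0 (θ - (j : ℝ) / r) ≤ ∑ j ∈ range k, max 0 (θ - (j : ℝ) / r) :=
    sum_le_sum_of_subset_of_nonneg (range_subset_range.mpr hNk) fun _ _ _ => le_max_left _ _
  refine le_trans ?_ (h1.trans h2)
  rw [sum_const, card_range, nsmul_eq_mul]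
  have : θ * k / 4 ≤ N := Nat.le_ceil _
  nlinarith

lemma log_factorial_le (k : ℕ) : Real.log k.factorial ≤ k * (k - 1) := by
  rcases Nat.eq_zero_or_pos k with rfl | hk
  · simp
  have hk' : (0 : ℝ) < k := by exact_mod_cast hk
  have h1 : (k.factorial : ℝ) ≤ (k : ℝ) ^ k := by exact_mod_cast Nat.factorial_le_pow k
  calc Real.log k.factorial ≤ Real.log ((k : ℝ) ^ k) :=
        Real.log_le_log (by exact_mod_cast k.factorial_pos) h1
    _ = k * Real.log k := Real.log_pow _ _
    _ ≤ k * (k - 1) := by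
        gcongr
        exact Real.log_le_sub_one_of_pos hk'

/-! ### Roth's lemma -/

lemma SupportedOn.mono {S T : Set σ} {P : MvPolynomial σ ℝ} (hP : SupportedOn S P) (h : S ⊆ T) :
    SupportedOn T P := fun i hi => hP i fun hS => hi (h hS)

lemma det_hasse_eq_zero {k : ℕ} {S : Set σ} {f : Fin k → MvPolynomial σ ℝ}
    (hf : ∀ j, SupportedOn S (f j)) {I : Fin k → σ →₀ ℕ} {i : Fin k} {h : σ} (hh : h ∉ S)
    (hI : I i h ≠ 0) : (Matrix.of fun i j => hasse (I i) (f j)).det = 0 :=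
  Matrix.det_eq_zero_of_row_eq_zero i fun j => (hf j).hasse_eq_zero hh hI

lemma exists_det_hasse_eq_mul {P : MvPolynomial σ ℝ} (h0 : P ≠ 0) {S : Set σ} {t : σ}
    (htS : t ∉ S) (hP : SupportedOn (insert t S) P) {r : σ → ℕ} (hr : ∀ h, degreeOf h P ≤ r h) :
    ∃ (k : ℕ) (I : Fin k → σ →₀ ℕ) (c : Fin k → ℕ) (V U : MvPolynomial σ ℝ),
      0 < k ∧ k ≤ r t + 1 ∧ V ≠ 0 ∧ U ≠ 0 ∧ SupportedOn S V ∧ SupportedOn {t} U ∧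
      (∀ h, degreeOf h V ≤ k * r h) ∧ (∀ i, ∀ h ∉ S, I i h = 0) ∧ (∀ i, ∑ h, I i h ≤ i) ∧
      (∀ j, c j ≤ j) ∧
      V * U = (Matrix.of fun i j => hasse (I i + Finsupp.single t (c j)) P).det := by
  classical
  obtain ⟨k, φ, ψ, hk, hkr, hsum, hφ, hψ, hφS, hψt, hdeg⟩ := exists_separation h0 (t := t) (S := S)
    fun h hS ht => hP h (by simp [hS, ht])
  obtain ⟨I, hI, hV⟩ := exists_wronskian_ne_zero φ hφ
  obtain ⟨J, hJ, hU⟩ := exists_wronskian_ne_zero ψ hψ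
  have hIS : ∀ i, ∀ h ∉ S, I i h = 0 := fun i h hh => by
    by_contra hc
    exact hV (det_hasse_eq_zero hφS hh hc)
  have hJt : ∀ j, ∀ h ≠ t, J j h = 0 := fun j h hh => by
    by_contra hc
    exact hU (det_hasse_eq_zero hψt (by simpa using hh) hc)
  have hJ' : ∀ j, J j = Finsupp.single t (J j t) := fun j => by
    ext h
    by_cases hh : h = t
    · simp [hh]
    · rw [hJt j h hh, Finsupp.single_eq_of_ne hh]
  refine ⟨k, I, fun j => J j t, _, _, hk, hkr.trans (by simpa using hr t), hV, hU,
    SupportedOn.det fun i j => (hφS j).hasse _, SupportedOn.det fun i j => (hψt j).hasse _,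
    fun h => degreeOf_det_le fun i j => (degreeOf_hasse_le _ _ _).trans ((hdeg j h).trans (hr h)),
    hIS, hI, fun j => (single_le_sum (fun _ _ => Nat.zero_le _) (mem_univ t)).trans (hJ j), ?_⟩
  rw [← Matrix.det_transpose (Matrix.of fun i j => hasse (J i) (ψ j)), ← Matrix.det_mul]
  congr 1
  ext1 i j
  simp only [Matrix.mul_apply, Matrix.of_apply, Matrix.transpose_apply]
  rw [← hJ' j, hsum, map_sum]
  refine sum_congr rfl fun l _ => (hasse_add_mul (hφS l) ((hψt l).mono ?_) (hIS i) ?_).symm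
  · simpa using htS
  · exact fun h hh => hJt j h fun e => htS (e ▸ hh)

lemma translate_det_hasse {k : ℕ} (ξ : σ → ℝ) (I : Fin k → Fin k → σ →₀ ℕ)
    (P : MvPolynomial σ ℝ) :
    translate ξ (Matrix.of fun i j => hasse (I i j) P).det =
      (Matrix.of fun i j => hasse (I i j) (translate ξ P)).det := by
  rw [AlgHom.map_det]
  congr 1
  ext1 i j
  simp [hasse_translate]

lemma WtGE.det_hasse {k : ℕ} {Q : MvPolynomial σ ℝ} {w : σ → ℝ} (hw : ∀ h, 0 ≤ w h) {ε θ : ℝ}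
    (hQ : WtGE w ε Q) {I : Fin k → σ →₀ ℕ} {t : σ} {c : Fin k → ℕ} (hθ : 0 ≤ θ) (hθ1 : θ ≤ 1)
    {r : ℕ} (hr : 0 < r) (hk : k ≤ r + 1) (hwt : w t = 1 / r) (hI : ∀ i, wt w (I i) ≤ ε - θ)
    (hc : ∀ j, c j ≤ j) :
    WtGE w (k * θ ^ 2 / 8)
      (Matrix.of fun i j => Roth.hasse (I i + Finsupp.single t (c j)) Q).det := by
  classical
  have h1 := WtGE.det (M := Matrix.of fun i j => Roth.hasse (I i + Finsupp.single t (c j)) Q)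
    (w := w) (b := fun j : Fin k => max 0 (θ - (j : ℕ) / r)) ?_
  · exact fun s hs => (sum_max_sub_div_ge hθ hθ1 hr hk).trans (h1 s hs)
  intro i j s hs
  refine max_le (wt_nonneg hw s) (le_trans ?_ (hQ.hasse _ s hs))
  have h2 : wt w (Finsupp.single t (c j)) ≤ (j : ℕ) / r := by
    rw [wt, sum_eq_single t]
    · rw [hwt, Finsupp.single_eq_same, one_div_mul_eq_div]
      have : (c j : ℝ) ≤ (j : ℕ) := by exact_mod_cast hc j
      gcongr
    · intro b _ hb
      rw [Finsupp.single_eq_of_ne hb]; simp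
    · simp
  rw [wt_add]
  linarith [hI i]

lemma log_len_det_hasse_le {k : ℕ} {P : MvPolynomial σ ℝ} {r : σ → ℕ}
    (hr : ∀ h, degreeOf h P ≤ r h) (hP : P ∈ integralPolys σ) (h0 : P ≠ 0) {t : σ}
    (hk : k ≤ r t + 1) {I : Fin k → Fin k → σ →₀ ℕ} {M : ℝ} (hM : ∑ h, (r h : ℝ) ≤ M)
    (hlen : Real.log (len P) ≤ M)
    (hdet : (Matrix.of fun i j => hasse (I i j) P).det ≠ 0) :
    Real.log (len (Matrix.of fun i j => hasse (I i j) P).det) ≤ k * (3 * M) := by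
  have hlen1 := one_le_len hP h0
  have h1 : len (Matrix.of fun i j => hasse (I i j) P).det ≤
      k.factorial * (2 ^ (∑ h, r h) * len P) ^ k :=
    len_det_le _ fun i j => len_hasse_le _ (sum_le_of_degreeOf_le hr)
  have h2 := one_le_len (det_mem_integralPolys fun i j => hasse_mem_integralPolys (I i j) hP) hdet
  have h2' : 0 < len (Matrix.of fun i j => hasse (I i j) P).det := lt_of_lt_of_le one_pos h2
  refine (Real.log_le_log h2' h1).trans ?_
  have hlp : len P ≠ 0 := by positivity
  rw [Real.log_mul (by positivity) (by positivity), Real.log_pow,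
    Real.log_mul (by positivity) hlp, Real.log_pow]
  have h3 := log_factorial_le k
  have h4 : (k : ℝ) - 1 ≤ M := by
    have : (k : ℝ) ≤ r t + 1 := by exact_mod_cast hk
    have h5 : (r t : ℝ) ≤ ∑ h, (r h : ℝ) :=
      single_le_sum (fun h _ => Nat.cast_nonneg (r h)) (mem_univ t)
    linarith
  have h6 : ((∑ h, r h : ℕ) : ℝ) * Real.log 2 ≤ M := by
    have : Real.log 2 ≤ 1 := by linarith [Real.log_two_lt_d9]
    refine le_trans (mul_le_of_le_one_right (Nat.cast_nonneg _) this) (by push_cast; exact hM)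
  have hk0 : (0 : ℝ) ≤ k := Nat.cast_nonneg k
  nlinarith [mul_le_mul_of_nonneg_left h4 hk0, mul_le_mul_of_nonneg_left h6 hk0,
    mul_le_mul_of_nonneg_left hlen hk0]

lemma wt_single (w : σ → ℝ) (t : σ) (ℓ : ℕ) : wt w (Finsupp.single t ℓ) = w t * ℓ := by
  classical
  rw [wt, sum_eq_single t]
  · simp
  · intro b _ hb
    rw [Finsupp.single_eq_of_ne hb]; simp
  · simp

lemma wt_le_of_lacunary {S : Set σ} {r : σ → ℕ} {t : σ} (hr : ∀ h, 0 < r h) {ω : ℝ} (hω : 0 ≤ ω)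
    (hrt : ∀ h ∈ S, (r t : ℝ) ≤ ω * r h) {I : σ →₀ ℕ} (hI : ∀ h ∉ S, I h = 0)
    (hsum : ∑ h, I h ≤ r t) : wt (fun h => 1 / (r h : ℝ)) I ≤ ω := by
  have ht : (0 : ℝ) < r t := by exact_mod_cast hr t
  calc wt (fun h => 1 / (r h : ℝ)) I ≤ ∑ h, ω / r t * I h := by
        refine sum_le_sum fun h _ => ?_
        by_cases hh : h ∈ S
        · refine mul_le_mul_of_nonneg_right ?_ (Nat.cast_nonneg _)
          have : (0 : ℝ) < r h := by exact_mod_cast hr h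
          rw [div_le_div_iff₀ this ht]
          linarith [hrt h hh]
        · simp [hI h hh]
    _ = ω / r t * (∑ h, I h : ℕ) := by rw [← mul_sum]; push_cast; rfl
    _ ≤ ω / r t * r t := by
        have : ((∑ h, I h : ℕ) : ℝ) ≤ r t := by exact_mod_cast hsum
        gcongr
    _ = ω := by field_simp

/-- Roth's lemma, for polynomials in the first `n` of `m` variables. -/
theorem exists_wt_le_of_lacunary {m : ℕ} (n : ℕ) (hn : n ≤ m) : ∀ ε : ℝ, 0 < ε → ε ≤ 1 →
    ∃ ω : ℝ, 0 < ω ∧ ∀ (r : Fin m → ℕ) (p : Fin m → ℤ) (q : Fin m → ℕ) (B : ℝ), 0 < B →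
      (∀ h, 0 < r h) → (∀ h, 0 < q h) → (∀ h, Int.gcd (p h) (q h) = 1) →
      (∀ h h', h < h' → (r h' : ℝ) ≤ ω * r h) → (∀ h, B ≤ r h * Real.log (q h)) →
      ∀ P ∈ integralPolys (Fin m), P ≠ 0 → SupportedOn {h : Fin m | h.val < n} P →
        (∀ h, degreeOf h P ≤ r h) → ∑ h, (r h : ℝ) ≤ ω * B → Real.log (len P) ≤ ω * B →
        ∃ I, coeff I (translate (fun h => (p h : ℝ) / q h) P) ≠ 0 ∧
          wt (fun h => 1 / (r h : ℝ)) I ≤ ε := by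
  induction n with
  | zero =>
    intro ε hε _
    refine ⟨1, one_pos, fun r p q B _ _ _ _ _ _ P _ h0 hS _ _ _ => ?_⟩
    obtain ⟨I, hI⟩ := ne_zero_iff.mp (translate_ne_zero (fun h => (p h : ℝ) / q h) h0)
    refine ⟨I, hI, ?_⟩
    have : ∀ h, I h = 0 := fun h =>
      (hS.translate _).eq_zero (mem_support_iff.mpr hI) (h := h) (by simp)
    simp [wt, this, hε.le]
  | succ n ih =>
    intro ε hε hε1
    have hε' : 0 < ε ^ 2 / 100 := by positivity
    obtain ⟨ω', hω', H⟩ := ih (by omega) (ε ^ 2 / 100) hε' (by nlinarith)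
    refine ⟨min (ω' / 3) (ε ^ 2 / 300), by positivity, ?_⟩
    set ω := min (ω' / 3) (ε ^ 2 / 300) with hωdef
    have hω1 : 3 * ω ≤ ω' := by linarith [min_le_left (ω' / 3) (ε ^ 2 / 300)]
    have hω2 : 3 * ω ≤ ε ^ 2 / 100 := by linarith [min_le_right (ω' / 3) (ε ^ 2 / 300)]
    have hω : 0 < ω := by positivity
    clear_value ω
    intro r p q B hB hr hq hpq hlac hBq P hP h0 hS hdeg hsum hlen
    set ξ : Fin m → ℝ := fun h => (p h : ℝ) / q h with hξ
    set w : Fin m → ℝ := fun h => 1 / (r h : ℝ) with hw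
    have hw0 : ∀ h, 0 ≤ w h := fun h => by positivity
    by_contra! hcon
    have hWt : WtGE w ε (translate ξ P) := fun s hs => (hcon s (mem_support_iff.mp hs)).le
    set t : Fin m := ⟨n, by omega⟩ with ht
    set S : Set (Fin m) := {h | h.val < n} with hSdef
    have htS : t ∉ S := by simp [hSdef, ht]
    obtain ⟨k, I, c, V, U, hk, hkr, hV0, hU0, hVS, hUt, hVdeg, hIS, hI, hc, hVU⟩ :=
      exists_det_hasse_eq_mul h0 htS (hS.mono fun h hh => by
        simp only [Set.mem_ofPred_eq] at hh
        simp only [Set.mem_insert_iff, hSdef, ht, Fin.ext_iff, Set.mem_ofPred_eq]; omega) hdeg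
    have hk0 : (0 : ℝ) < k := by exact_mod_cast hk
    have hVUint : V * U ∈ integralPolys (Fin m) := by
      rw [hVU]
      exact det_mem_integralPolys fun i j => hasse_mem_integralPolys _ hP
    have hVUlen : Real.log (len (V * U)) ≤ k * (3 * (ω * B)) := by
      rw [hVU]
      exact log_len_det_hasse_le hdeg hP h0 hkr hsum hlen (hVU ▸ mul_ne_zero hV0 hU0)
    have hUS : SupportedOn Sᶜ U := hUt.mono (by simpa using htS)
    have hVt : SupportedOn {t}ᶜ V := hVS.mono fun h hh => by
      rintro rfl; exact htS hh
    obtain ⟨b, hb⟩ := ne_zero_iff.mp hV0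
    obtain ⟨a, ha⟩ := ne_zero_iff.mp hU0
    have hbU : C (coeff b V) * U ∈ integralPolys (Fin m) :=
      coeff_mul_mem_integralPolys hVS hUS (mem_support_iff.mpr hb) hVUint
    have hbU0 : C (coeff b V) * U ≠ 0 := mul_ne_zero (C_ne_zero.mpr hb) hU0
    have hbUlen : len (C (coeff b V) * U) ≤ len (V * U) :=
      len_coeff_mul_le hVS hUS (mem_support_iff.mpr hb)
    have haV : C (coeff a U) * V ∈ integralPolys (Fin m) :=
      coeff_mul_mem_integralPolys hUt hVt (mem_support_iff.mpr ha) (mul_comm V U ▸ hVUint)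
    have haV0 : C (coeff a U) * V ≠ 0 := mul_ne_zero (C_ne_zero.mpr ha) hV0
    have haVlen : len (C (coeff a U) * V) ≤ len (V * U) :=
      mul_comm V U ▸ len_coeff_mul_le hUt hVt (mem_support_iff.mpr ha)
    have hCmul : ∀ (x : ℝ) (Q : MvPolynomial (Fin m) ℝ) (h : Fin m),
        degreeOf h (C x * Q) ≤ degreeOf h Q := fun x Q h =>
      (degreeOf_mul_le _ _ _).trans (by simp)
    obtain ⟨ℓ, hℓ0, hℓ⟩ := exists_coeff_translate_ne_zero_of_univariate hbU hbU0
      (fun h hh => Nat.le_zero.mp ((hCmul _ _ _).trans (hUt h hh).le)) (hq t) (hpq t) (ξ := ξ) rfl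
    obtain ⟨I₀, hI₀, hI₀wt⟩ := H (fun h => k * r h) p q (k * B) (by positivity)
      (fun h => Nat.mul_pos hk (hr h)) hq hpq
      (fun h h' hh => by
        have h1 := hlac h h' hh
        have h2 : (0 : ℝ) ≤ r h := Nat.cast_nonneg _
        push_cast
        nlinarith [mul_le_mul_of_nonneg_right (show ω ≤ ω' by linarith) h2])
      (fun h => by
        push_cast
        rw [mul_assoc]
        exact mul_le_mul_of_nonneg_left (hBq h) hk0.le)
      _ haV haV0 (fun h hh => Nat.le_zero.mp ((hCmul _ _ _).trans (hVS h hh).le))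
      (fun h => (hCmul _ _ _).trans (hVdeg h))
      (by
        push_cast
        rw [← mul_sum]
        have : ω * B ≤ ω' * B := by nlinarith
        nlinarith)
      (by
        have h1 := Real.log_le_log (lt_of_lt_of_le one_pos (one_le_len haV haV0)) haVlen
        have : 3 * ω * B ≤ ω' * B := by nlinarith
        nlinarith)
    have hI₀wt' : wt w I₀ ≤ k * (ε ^ 2 / 100) := by
      have : wt w I₀ = k * wt (fun h => 1 / ((k * r h : ℕ) : ℝ)) I₀ := by
        rw [wt, wt, mul_sum]
        refine sum_congr rfl fun h _ => ?_
        have : (r h : ℝ) ≠ 0 := by exact_mod_cast (hr h).ne'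
        simp only [hw]; push_cast; field_simp
      rw [this]
      exact mul_le_mul_of_nonneg_left hI₀wt hk0.le
    have hlogq : 0 < Real.log (q t) := by
      by_contra! hc
      have : (0 : ℝ) ≤ r t := Nat.cast_nonneg _
      nlinarith [hBq t]
    have hrt : (0 : ℝ) < r t := by exact_mod_cast hr t
    have hℓwt : wt w (Finsupp.single t ℓ) ≤ k * (ε ^ 2 / 100) := by
      have hq0 : (0 : ℝ) < q t := by exact_mod_cast hq t
      have h1 := Real.log_le_log (by positivity) (hℓ.trans hbUlen)
      rw [Real.log_pow] at h1
      have h2 : (ℓ : ℝ) * Real.log (q t) ≤ k * (ε ^ 2 / 100) * r t * Real.log (q t) := by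
        have h3 : k * (3 * (ω * B)) ≤ k * (3 * ω) * (r t * Real.log (q t)) := by
          have := mul_le_mul_of_nonneg_left (hBq t) (show 0 ≤ k * (3 * ω) by positivity)
          linarith
        have h4 : k * (3 * ω) * (r t * Real.log (q t)) ≤
            k * (ε ^ 2 / 100) * (r t * Real.log (q t)) := by gcongr
        linarith
      rw [wt_single, hw, one_div_mul_eq_div, div_le_iff₀ hrt]
      exact le_of_mul_le_mul_right h2 hlogq
    have hne : coeff (I₀ + Finsupp.single t ℓ) (translate ξ (V * U)) ≠ 0 := by
      have e : ∀ (x : ℝ) Q, translate ξ (C x * Q) = C x * translate ξ Q := fun x Q => by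
        rw [map_mul]; congr 1; exact (translate ξ).commutes x
      rw [e, coeff_C_mul] at hI₀ hℓ0
      have h1 := right_ne_zero_of_mul hI₀
      rw [map_mul, coeff_add_mul (hVS.translate ξ) (hUS.translate ξ)
        (fun h hh => (hVS.translate ξ).eq_zero (mem_support_iff.mpr h1) hh)
        (fun h hh => Finsupp.single_eq_of_ne (by rintro rfl; exact htS hh))]
      exact mul_ne_zero h1 (right_ne_zero_of_mul hℓ0)
    have hlow : WtGE w (k * (ε - ω) ^ 2 / 8) (translate ξ (V * U)) := by
      rw [hVU, translate_det_hasse ξ (fun i j => I i + Finsupp.single t (c j))]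
      refine hWt.det_hasse hw0 (by nlinarith) (by linarith) (hr t) hkr rfl (fun i => ?_) hc
      rw [sub_sub_cancel]
      refine wt_le_of_lacunary hr hω.le (fun h hh => hlac h t ?_) (hIS i)
        ((hI i).trans (by have := i.2; omega))
      exact Fin.lt_def.mpr hh
    have h1 := hlow _ (mem_support_iff.mpr hne)
    rw [wt_add] at h1
    have h2 : (ε / 2) ^ 2 ≤ (ε - ω) ^ 2 := by
      apply pow_le_pow_left₀ (by positivity)
      nlinarith
    nlinarith [mul_le_mul_of_nonneg_left h2 hk0.le, mul_pos hk0 (pow_pos hε 2)]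

/-! ### Powers of an algebraic number -/

lemma exists_int_coords_pow {α : ℝ} (hα : IsAlgebraic ℚ α) :
    ∃ (d : ℕ) (a : ℤ) (A : ℝ), 0 < d ∧ a ≠ 0 ∧ 1 ≤ A ∧ ∀ R e : ℕ, e ≤ R →
      ∃ b : ℕ → ℤ, (a : ℝ) ^ R * α ^ e = ∑ l ∈ range d, b l * α ^ l ∧ ∀ l, |(b l : ℝ)| ≤ A ^ R := by
  obtain ⟨g, hg0, hg⟩ := (IsFractionRing.isAlgebraic_iff ℤ ℚ ℝ).mpr hα
  have hd : g.natDegree ≠ 0 := fun h => by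
    rw [Polynomial.natDegree_eq_zero] at h
    obtain ⟨c, rfl⟩ := h
    simp at hg
    simp [hg] at hg0
  obtain ⟨n, hn⟩ := Nat.exists_eq_succ_of_ne_zero hd
  set a := g.leadingCoeff with ha
  have ha0 : a ≠ 0 := Polynomial.leadingCoeff_ne_zero.mpr hg0
  set G : ℝ := ∑ l ∈ range (n + 1), |(g.coeff l : ℝ)| with hG
  have hG0 : 0 ≤ G := sum_nonneg fun _ _ => abs_nonneg _
  have hgl : ∀ l < n + 1, |(g.coeff l : ℝ)| ≤ G := fun l hl =>
    single_le_sum (f := fun l => |(g.coeff l : ℝ)|) (fun _ _ => abs_nonneg _) (mem_range.mpr hl)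
  have hrel : (a : ℝ) * α ^ (n + 1) = -∑ l ∈ range (n + 1), g.coeff l * α ^ l := by
    rw [Polynomial.aeval_eq_sum_range, hn, sum_range_succ] at hg
    have : g.coeff n.succ = a := by rw [ha, Polynomial.leadingCoeff, hn]
    rw [this] at hg
    simp only [zsmul_eq_mul] at hg
    linarith
  have key : ∀ e : ℕ, ∃ b : ℕ → ℤ, (a : ℝ) ^ e * α ^ e = ∑ l ∈ range (n + 1), b l * α ^ l ∧
      ∀ l, |(b l : ℝ)| ≤ (|(a : ℝ)| + G + 1) ^ e := by
    intro e
    induction e with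
    | zero =>
      refine ⟨fun l => if l = 0 then 1 else 0, ?_, fun l => ?_⟩
      · simp
      · by_cases h : l = 0 <;> simp [h]
    | succ e ih =>
      obtain ⟨b, hb, hbA⟩ := ih
      refine ⟨fun l => (if l = 0 then 0 else a * b (l - 1)) -
        (if l < n + 1 then g.coeff l else 0) * b n, ?_, fun l => ?_⟩
      · have h1 : (a : ℝ) ^ (e + 1) * α ^ (e + 1) = a * α * ∑ l ∈ range (n + 1), b l * α ^ l := by
          rw [← hb]; ring
        rw [h1, sum_range_succ, mul_add]
        have h2 : (a : ℝ) * α * (b n * α ^ n) =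
            -∑ l ∈ range (n + 1), g.coeff l * b n * α ^ l := by
          calc (a : ℝ) * α * (b n * α ^ n) = b n * (a * α ^ (n + 1)) := by ring
            _ = _ := by
              rw [hrel, mul_neg, mul_sum]
              congr 1
              exact sum_congr rfl fun l _ => by ring
        rw [h2]
        push_cast
        simp only [sub_mul, sum_sub_distrib]
        rw [sub_eq_add_neg]
        congr 1
        · rw [sum_range_succ', mul_sum]
          simp only [Nat.add_eq_zero_iff, one_ne_zero, and_false, if_false, if_true,
            Nat.add_sub_cancel, zero_mul, add_zero]
          exact sum_congr rfl fun l _ => by ring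
        · congr 1
          refine sum_congr rfl fun l hl => ?_
          rw [if_pos (mem_range.mp hl)]
      · have h1 : |((if l = 0 then 0 else a * b (l - 1) : ℤ) : ℝ)| ≤
            |(a : ℝ)| * (|(a : ℝ)| + G + 1) ^ e := by
          by_cases h : l = 0
          · rw [if_pos h]; simp; positivity
          · rw [if_neg h]; push_cast; rw [abs_mul]; gcongr; exact hbA _
        have h2 : |(((if l < n + 1 then g.coeff l else 0) * b n : ℤ) : ℝ)| ≤
            G * (|(a : ℝ)| + G + 1) ^ e := by
          by_cases h : l < n + 1
          · rw [if_pos h]; push_cast; rw [abs_mul]; gcongr; exacts [hgl l h, hbA _]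
          · rw [if_neg h]; simp; positivity
        rw [Int.cast_sub]
        refine (abs_sub _ _).trans ?_
        have : 0 ≤ (|(a : ℝ)| + G + 1) ^ e := by positivity
        rw [pow_succ]
        linarith
  refine ⟨n + 1, a, |(a : ℝ)| + G + 1, Nat.succ_pos _, ha0, by linarith [abs_nonneg (a : ℝ)],
    fun R e he => ?_⟩
  obtain ⟨b, hb, hbA⟩ := key e
  refine ⟨fun l => a ^ (R - e) * b l, ?_, fun l => ?_⟩
  · rw [← Nat.sub_add_cancel he, pow_add, mul_assoc, hb, mul_sum, Nat.add_sub_cancel]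
    exact sum_congr rfl fun l _ => by push_cast; ring
  · push_cast
    rw [abs_mul, abs_pow]
    calc |(a : ℝ)| ^ (R - e) * |(b l : ℝ)| ≤
        (|(a : ℝ)| + G + 1) ^ (R - e) * (|(a : ℝ)| + G + 1) ^ e := by
          gcongr
          · linarith
          · exact hbA l
      _ = _ := by rw [← pow_add, Nat.sub_add_cancel he]

/-! ### Counting exponents of small weight -/

lemma sum_exp_half_sub_le {r : ℕ} (hr : 0 < r) (t : ℝ) :
    ∑ i : Fin (r + 1), Real.exp (t * (1 / 2 - (i : ℕ) / r)) ≤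
      (r + 1) * Real.exp (t ^ 2 / 8) := by
  have hr0 : (0 : ℝ) < r := by exact_mod_cast hr
  have h1 : ∑ i : Fin (r + 1), Real.exp (t * (1 / 2 - (i : ℕ) / r)) =
      ∑ i : Fin (r + 1), Real.exp (-(t * (1 / 2 - (i : ℕ) / r))) := by
    rw [← Equiv.sum_comp Fin.revPerm]
    refine sum_congr rfl fun i _ => ?_
    congr 1
    have h2 : ((Fin.revPerm i : Fin (r + 1)) : ℕ) + (i : ℕ) = r := by
      have := i.2
      simp [Fin.val_rev]; omega
    have h3 : (((Fin.revPerm i : Fin (r + 1)) : ℕ) : ℝ) = r - (i : ℕ) := by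
      rw [eq_sub_iff_add_eq]; exact_mod_cast h2
    rw [h3]
    field_simp
    ring
  have h2 : ∑ i : Fin (r + 1), Real.exp (t * (1 / 2 - (i : ℕ) / r)) =
      ∑ i : Fin (r + 1), Real.cosh (t * (1 / 2 - (i : ℕ) / r)) := by
    simp only [Real.cosh_eq]
    rw [← sum_div, sum_add_distrib, ← h1]
    ring
  rw [h2]
  refine (sum_le_card_nsmul _ _ (Real.exp (t ^ 2 / 8)) fun i _ => ?_).trans (by simp)
  refine (Real.cosh_le_exp_half_sq _).trans (Real.exp_le_exp.mpr ?_)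
  have h3 : ((i : ℕ) : ℝ) / r ≤ 1 := by
    rw [div_le_one hr0]; exact_mod_cast Nat.lt_succ_iff.mp i.2
  have h4 : 0 ≤ ((i : ℕ) : ℝ) / r := by positivity
  have h5 : (1 / 2 - ((i : ℕ) : ℝ) / r) ^ 2 ≤ 1 / 4 := by nlinarith
  nlinarith [mul_le_mul_of_nonneg_left h5 (sq_nonneg t)]

lemma card_filter_sum_div_lt_le {m : ℕ} {r : Fin m → ℕ} (hr : ∀ h, 0 < r h) {δ : ℝ} (hδ : 0 ≤ δ) :
    (#{s : (h : Fin m) → Fin (r h + 1) | ∑ h, ((s h : ℕ) : ℝ) / r h < m * (1 / 2 - δ)} : ℝ) ≤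
      Real.exp (-(2 * δ ^ 2) * m) * ∏ h, ((r h : ℝ) + 1) := by
  calc (#{s : (h : Fin m) → Fin (r h + 1) | ∑ h, ((s h : ℕ) : ℝ) / r h < m * (1 / 2 - δ)} : ℝ)
      = ∑ s : (h : Fin m) → Fin (r h + 1),
          if ∑ h, ((s h : ℕ) : ℝ) / r h < m * (1 / 2 - δ) then (1 : ℝ) else 0 := by
        rw [card_filter]; push_cast; rfl
    _ ≤ ∑ s : (h : Fin m) → Fin (r h + 1),
          ∏ h, (Real.exp (-(4 * δ ^ 2)) * Real.exp (4 * δ * (1 / 2 - ((s h : ℕ) : ℝ) / r h))) := by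
        refine sum_le_sum fun s _ => ?_
        split_ifs with h
        · simp only [← Real.exp_add]
          rw [← Real.exp_sum]
          refine Real.one_le_exp ?_
          simp only [mul_sub]
          rw [sum_add_distrib, sum_sub_distrib, ← mul_sum, ← mul_sum]
          simp only [sum_const, card_univ, Fintype.card_fin, nsmul_eq_mul]
          nlinarith [mul_le_mul_of_nonneg_left h.le hδ]
        · positivity
    _ = ∏ h, ∑ i : Fin (r h + 1),
          (Real.exp (-(4 * δ ^ 2)) * Real.exp (4 * δ * (1 / 2 - ((i : ℕ) : ℝ) / r h))) := by
        rw [prod_univ_sum, Fintype.piFinset_univ]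
    _ ≤ ∏ h, (Real.exp (-(2 * δ ^ 2)) * ((r h : ℝ) + 1)) := by
        refine prod_le_prod (fun h _ => by positivity) fun h _ => ?_
        rw [← mul_sum]
        refine (mul_le_mul_of_nonneg_left (sum_exp_half_sub_le (hr h) _)
          (Real.exp_nonneg _)).trans (le_of_eq ?_)
        rw [mul_left_comm, ← Real.exp_add, mul_comm]
        congr 2
        ring
    _ = _ := by
        rw [prod_mul_distrib, prod_const, card_univ, Fintype.card_fin, ← Real.exp_nat_mul,
          mul_comm (m : ℝ)]

/-! ### The auxiliary polynomial -/

lemma exists_int_vec_abs_le_of_two_mul_card_le {ι κ : Type*} [Fintype ι] [Fintype κ] [Nonempty ι]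
    (hcard : 2 * Fintype.card ι ≤ Fintype.card κ) (M : Matrix ι κ ℤ) {B : ℝ} (hB : 1 ≤ B)
    (hM : ∀ i j, |(M i j : ℝ)| ≤ B) :
    ∃ c : κ → ℤ, c ≠ 0 ∧ (∀ i, ∑ j, M i j * c j = 0) ∧
      ∀ j, |(c j : ℝ)| ≤ Fintype.card κ * B := by
  classical
  let _ := Matrix.seminormedAddCommGroup (m := ι) (n := κ) (α := ℤ)
  have hpos : 0 < Fintype.card ι := Fintype.card_pos
  obtain ⟨c, hc0, hc, hcn⟩ := Int.Matrix.exists_ne_zero_int_vec_norm_le M (by omega) hpos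
  refine ⟨c, hc0, fun i => congrFun hc i, fun j => ?_⟩
  have h1 : max 1 ‖M‖ ≤ B := max_le hB <| (Matrix.norm_le_iff (by linarith)).mpr fun i j => by
    rw [Int.norm_eq_abs]; exact hM i j
  have h2 : |(c j : ℝ)| ≤ ‖c‖ := by
    rw [← Int.norm_eq_abs]; exact norm_le_pi_norm c j
  have hκ : (1 : ℝ) ≤ Fintype.card κ := by exact_mod_cast (by omega : 1 ≤ Fintype.card κ)
  have hcard' : 2 * (Fintype.card ι : ℝ) ≤ Fintype.card κ := by exact_mod_cast hcard
  have hpos' : (0 : ℝ) < Fintype.card ι := by exact_mod_cast hpos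
  have h3 : (1 : ℝ) ≤ Fintype.card κ * max 1 ‖M‖ := by
    nlinarith [le_max_left 1 ‖M‖]
  refine h2.trans (hcn.trans ((Real.rpow_le_rpow_of_exponent_le h3 (y := _) (z := 1) ?_).trans ?_))
  · rw [div_le_one (by linarith)]; linarith
  · rw [Real.rpow_one]; gcongr

section

variable {m : ℕ} {r : Fin m → ℕ}

/-- The exponent vector given by an element of a box. -/
def boxExp (s : (h : Fin m) → Fin (r h + 1)) : Fin m →₀ ℕ :=
  Finsupp.equivFunOnFinite.symm fun h => (s h : ℕ)

@[simp] lemma boxExp_apply (s : (h : Fin m) → Fin (r h + 1)) (h : Fin m) :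
    boxExp s h = (s h : ℕ) := rfl

lemma boxExp_injective : Function.Injective (boxExp (r := r)) := fun s t h => by
  funext i
  have := DFunLike.congr_fun h i
  simpa [Fin.ext_iff] using this

lemma exists_boxExp_eq {s : Fin m →₀ ℕ} (hs : ∀ h, s h ≤ r h) :
    ∃ t : (h : Fin m) → Fin (r h + 1), boxExp t = s :=
  ⟨fun h => ⟨s h, Nat.lt_succ_of_le (hs h)⟩, by ext; simp⟩

/-- The polynomial with given coefficients on a box. -/
def boxPoly (c : ((h : Fin m) → Fin (r h + 1)) → ℝ) : MvPolynomial (Fin m) ℝ :=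
  ∑ s, monomial (boxExp s) (c s)

lemma coeff_boxPoly (c : ((h : Fin m) → Fin (r h + 1)) → ℝ)
    (t : (h : Fin m) → Fin (r h + 1)) : coeff (boxExp t) (boxPoly c) = c t := by
  classical
  rw [boxPoly, coeff_sum, sum_eq_single t]
  · simp
  · intro s _ hs
    rw [coeff_monomial, if_neg fun h => hs (boxExp_injective h)]
  · simp

lemma degreeOf_boxPoly_le (c : ((h : Fin m) → Fin (r h + 1)) → ℝ) (h : Fin m) :
    degreeOf h (boxPoly c) ≤ r h := by
  classical
  refine (degreeOf_sum_le _ _ _).trans (Finset.sup_le fun s _ => ?_)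
  rw [degreeOf_le_iff]
  intro u hu
  rw [mem_singleton.mp (support_monomial_subset hu)]
  exact Nat.lt_succ_iff.mp (s h).2

lemma boxPoly_mem_integralPolys (c : ((h : Fin m) → Fin (r h + 1)) → ℤ) :
    boxPoly (fun s => (c s : ℝ)) ∈ integralPolys (Fin m) := by
  classical
  refine Subring.sum_mem _ fun s _ => mem_integralPolys.mpr fun t => ?_
  rw [coeff_monomial]
  split_ifs
  exacts [⟨c s, rfl⟩, ⟨0, by simp⟩]

lemma len_boxPoly_le (c : ((h : Fin m) → Fin (r h + 1)) → ℝ) {B : ℝ} (hc : ∀ s, |c s| ≤ B) :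
    len (boxPoly c) ≤ (∏ h, ((r h : ℝ) + 1)) * B := by
  refine (len_sum_le _ _).trans ?_
  refine (sum_le_card_nsmul _ _ B fun s _ => (len_monomial _ _).le.trans (hc s)).trans ?_
  rw [card_univ, Fintype.card_pi]
  simp

lemma eval_hasse_boxPoly (α : ℝ) (I : Fin m →₀ ℕ) (c : ((h : Fin m) → Fin (r h + 1)) → ℝ) :
    eval (fun _ => α) (hasse I (boxPoly c)) =
      ∑ s, c s * (multichoose (boxExp s) I * α ^ ∑ h, ((s h : ℕ) - I h)) := by
  rw [boxPoly, map_sum, map_sum]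
  refine sum_congr rfl fun s _ => ?_
  rw [hasse_monomial, eval_monomial, Finsupp.prod_fintype _ _ (fun _ => pow_zero _),
    prod_pow_eq_pow_sum]
  simp only [Finsupp.tsub_apply, boxExp_apply]
  ring

end

theorem exists_auxiliary_poly {α : ℝ} (hα : IsAlgebraic ℚ α) {δ : ℝ} (hδ : 0 < δ)
    (hδ2 : δ < 1 / 2) : ∃ (m : ℕ) (K : ℝ), 0 < m ∧ 1 ≤ K ∧ ∀ r : Fin m → ℕ, (∀ h, 0 < r h) →
      ∃ P ∈ integralPolys (Fin m), P ≠ 0 ∧ (∀ h, degreeOf h P ≤ r h) ∧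
        len P ≤ K ^ ∑ h, r h ∧
        WtGE (fun h => 1 / (r h : ℝ)) (m * (1 / 2 - δ)) (translate (fun _ => α) P) := by
  classical
  obtain ⟨d, a, A, hd, ha, hA, hb⟩ := exists_int_coords_pow hα
  obtain ⟨m₀, hm₀⟩ := exists_nat_gt (Real.log (2 * d) / (2 * δ ^ 2))
  obtain ⟨m, hm0, hm⟩ : ∃ m : ℕ, 0 < m ∧ Real.log (2 * d) / (2 * δ ^ 2) ≤ m :=
    ⟨m₀ + 1, Nat.succ_pos _, by push_cast; linarith⟩
  refine ⟨m, 2 * (2 * (2 * A)), hm0, by linarith, fun r hr => ?_⟩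
  have hexp : Real.exp (-(2 * δ ^ 2) * m) * (2 * d) ≤ 1 := by
    have hd' : (0 : ℝ) < 2 * d := by positivity
    rw [← Real.exp_log hd', ← Real.exp_add, ← Real.exp_zero, Real.exp_le_exp]
    rw [div_le_iff₀ (by positivity)] at hm
    linarith
  set R := ∑ h, r h with hR
  set w : Fin m → ℝ := fun h => 1 / (r h : ℝ) with hw
  set T : Finset ((h : Fin m) → Fin (r h + 1)) :=
    {s | ∑ h, ((s h : ℕ) : ℝ) / r h < m * (1 / 2 - δ)} with hT
  have hN : (∏ h, ((r h : ℝ) + 1)) ≤ 2 ^ R := by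
    rw [hR, ← prod_pow_eq_pow_sum]
    refine prod_le_prod (fun _ _ => by positivity) fun h _ => ?_
    exact_mod_cast Nat.lt_two_pow_self
  choose b hbeq hbA using hb R
  have he : ∀ (s I : (h : Fin m) → Fin (r h + 1)), ∑ h, ((s h : ℕ) - (I h : ℕ)) ≤ R :=
    fun s I => sum_le_sum fun h _ => (Nat.sub_le _ _).trans (Nat.lt_succ_iff.mp (s h).2)
  set M : Matrix (T × Fin d) ((h : Fin m) → Fin (r h + 1)) ℤ := Matrix.of fun i s =>
    multichoose (boxExp s) (boxExp i.1.1) * b _ (he s i.1.1) i.2 with hM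
  have hT0 : (fun _ => 0) ∈ T := by
    simp only [hT, mem_filter, mem_univ, true_and, Fin.val_zero, Nat.cast_zero, zero_div,
      sum_const_zero]
    have : (0 : ℝ) < m := by positivity
    nlinarith
  have : Nonempty (T × Fin d) := ⟨⟨_, hT0⟩, ⟨0, hd⟩⟩
  obtain ⟨c, hc0, hc, hcB⟩ := exists_int_vec_abs_le_of_two_mul_card_le (B := (2 * A) ^ R)
    (by
      rw [Fintype.card_prod, Fintype.card_coe, Fintype.card_fin, Fintype.card_pi]
      simp only [Fintype.card_fin]
      have h1 := card_filter_sum_div_lt_le hr hδ.le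
      rw [← hT] at h1
      have h2 : (0 : ℝ) ≤ ∏ h, ((r h : ℝ) + 1) := by positivity
      have h3 : (2 : ℝ) * (#T * d) ≤ ∏ h, ((r h : ℝ) + 1) := by
        have hd' : (0 : ℝ) ≤ 2 * d := by positivity
        nlinarith [mul_le_mul_of_nonneg_right h1 hd', mul_le_mul_of_nonneg_right hexp h2]
      exact_mod_cast h3)
    M (one_le_pow₀ (by linarith)) fun i s => by
      simp only [hM, Matrix.of_apply]
      push_cast
      rw [abs_mul, mul_pow, Nat.abs_cast]
      refine mul_le_mul ?_ (hbA _ _ _) (abs_nonneg _) (by positivity)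
      have h1 := multichoose_le (boxExp s) (boxExp i.1.1)
      have h2 : ∑ h, boxExp s h ≤ R := sum_le_sum fun h _ => Nat.lt_succ_iff.mp (s h).2
      exact_mod_cast h1.trans (Nat.pow_le_pow_right two_pos h2)
  have hcard : (Fintype.card ((h : Fin m) → Fin (r h + 1)) : ℝ) ≤ 2 ^ R := by
    rw [Fintype.card_pi]; simpa using hN
  refine ⟨boxPoly fun s => (c s : ℝ), boxPoly_mem_integralPolys c, fun h => hc0 ?_,
    degreeOf_boxPoly_le _, ?_, fun u hu => ?_⟩
  · funext s
    have := coeff_boxPoly (fun s => (c s : ℝ)) s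
    rw [h, coeff_zero] at this
    exact_mod_cast this.symm
  · refine (len_boxPoly_le _ hcB).trans ?_
    rw [mul_pow 2 (2 * (2 * A)), mul_pow 2 (2 * A)]
    gcongr
  · by_contra! hlt
    rw [mem_support_iff, coeff_translate] at hu
    have hur : ∀ h, u h ≤ r h := by
      by_contra! hex
      obtain ⟨h, hh⟩ := hex
      refine hu ?_
      have : hasse u (boxPoly fun s => (c s : ℝ)) = 0 := by
        ext s
        rw [coeff_hasse, coeff_zero]
        refine mul_eq_zero_of_right _ (notMem_support_iff.mp fun hs => ?_)
        have := degreeOf_le_iff.mp (degreeOf_boxPoly_le (fun s => (c s : ℝ)) h) _ hs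
        rw [Finsupp.add_apply] at this
        omega
      rw [this, map_zero]
    obtain ⟨I, rfl⟩ := exists_boxExp_eq hur
    have hI : I ∈ T := by
      simp only [hT, mem_filter, mem_univ, true_and]
      refine lt_of_le_of_lt (le_of_eq ?_) hlt
      simp [wt, hw, div_eq_inv_mul]
    refine hu ?_
    have ha' : (a : ℝ) ^ R ≠ 0 := pow_ne_zero _ (by exact_mod_cast ha)
    refine (mul_eq_zero_iff_left ha').mp ?_
    rw [eval_hasse_boxPoly, mul_sum]
    calc ∑ s, (a : ℝ) ^ R * (c s * (multichoose (boxExp s) (boxExp I) *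
            α ^ ∑ h, ((s h : ℕ) - boxExp I h)))
        = ∑ s, ∑ l : Fin d, ((M (⟨I, hI⟩, l) s * c s : ℤ) : ℝ) * α ^ (l : ℕ) := by
          refine sum_congr rfl fun s _ => ?_
          calc _ = (c s * multichoose (boxExp s) (boxExp I) : ℝ) *
                (a ^ R * α ^ ∑ h, ((s h : ℕ) - (I h : ℕ))) := by simp only [boxExp_apply]; ring
            _ = _ := by
              rw [hbeq _ (he s I), mul_sum, ← Fin.sum_univ_eq_sum_range
                (fun l => (c s * multichoose (boxExp s) (boxExp I) : ℝ) *
                  (b _ (he s I) l * α ^ l))]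
              refine sum_congr rfl fun l _ => ?_
              simp only [hM, Matrix.of_apply]
              push_cast
              ring
      _ = 0 := by
          rw [sum_comm]
          refine sum_eq_zero fun l _ => ?_
          rw [← sum_mul, ← Int.cast_sum, hc, Int.cast_zero, zero_mul]

/-! ### Comparison of upper and lower bounds -/

lemma abs_eval_hasse_le {m : ℕ} {r : Fin m → ℕ}
    {P : MvPolynomial (Fin m) ℝ} (hdeg : ∀ h, degreeOf h P ≤ r h) {K : ℝ}
    (hlen : len P ≤ K ^ ∑ h, r h) {α b E : ℝ} (hE : 0 ≤ E)
    (hP : WtGE (fun h => 1 / (r h : ℝ)) b (translate (fun _ => α) P)) {ξ : Fin m → ℝ}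
    (hξ : ∀ h, |ξ h - α| ≤ Real.exp (-(E / r h))) (I : Fin m →₀ ℕ) :
    |eval ξ (hasse I P)| ≤ (2 * (1 + |α|) * K) ^ (∑ h, r h) *
      Real.exp (-(E * (b - wt (fun h => 1 / (r h : ℝ)) I))) := by
  have hdeg' : ∀ h, degreeOf h (hasse I P) ≤ r h := fun h =>
    (degreeOf_hasse_le I h P).trans (hdeg h)
  have h1 : eval ξ (hasse I P) = eval (fun h => ξ h - α) (translate (fun _ => α) (hasse I P)) := by
    rw [eval_translate]
    congr 2
    funext h
    simp
  have h2 : len (translate (fun _ => α) (hasse I P)) ≤ (2 * (1 + |α|) * K) ^ (∑ h, r h) := by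
    refine (len_translate_le _ (abs_nonneg α) (fun _ => le_rfl)
      (sum_le_of_degreeOf_le hdeg')).trans ?_
    rw [mul_pow, mul_pow, mul_comm (2 ^ _), mul_assoc]
    refine mul_le_mul_of_nonneg_left ?_ (by positivity)
    exact (len_hasse_le I (sum_le_of_degreeOf_le hdeg)).trans (by gcongr)
  rw [h1]
  refine (abs_eval_le fun s hs => ?_).trans
    (mul_le_mul_of_nonneg_right h2 (Real.exp_nonneg _))
  rw [← hasse_translate] at hs
  have h3 := hP.hasse I s hs
  calc ∏ h, |ξ h - α| ^ s h ≤ ∏ h, Real.exp (-(E / r h)) ^ s h :=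
        prod_le_prod (fun _ _ => by positivity) fun h _ =>
          pow_le_pow_left₀ (abs_nonneg _) (hξ h) _
    _ = Real.exp (-(E * wt (fun h => 1 / (r h : ℝ)) s)) := by
        simp only [← Real.exp_nat_mul]
        rw [← Real.exp_sum, wt, mul_sum, ← sum_neg_distrib]
        congr 1
        exact sum_congr rfl fun h _ => by ring
    _ ≤ _ := by
        apply Real.exp_le_exp.mpr
        nlinarith

lemma exp_le_abs_eval {m : ℕ} {r : Fin m → ℕ} {Q : MvPolynomial (Fin m) ℝ}
    (hQ : Q ∈ integralPolys (Fin m)) (hdeg : ∀ h, degreeOf h Q ≤ r h) {p : Fin m → ℤ}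
    {q : Fin m → ℕ} (hq : ∀ h, 0 < q h) (h0 : eval (fun h => (p h : ℝ) / q h) Q ≠ 0) :
    Real.exp (-∑ h, r h * Real.log (q h)) ≤ |eval (fun h => (p h : ℝ) / q h) Q| := by
  have hq' : ∀ h, (0 : ℝ) < q h := fun h => by exact_mod_cast hq h
  have hD : (0 : ℝ) < ∏ h, (q h : ℝ) ^ r h := prod_pos fun h _ => pow_pos (hq' h) _
  have h1 : Real.exp (-∑ h, r h * Real.log (q h)) = (∏ h, (q h : ℝ) ^ r h)⁻¹ := by
    rw [Real.exp_neg, Real.exp_sum]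
    congr 1
    refine prod_congr rfl fun h _ => ?_
    rw [Real.exp_nat_mul, Real.exp_log (hq' h)]
  choose z hz using mem_integralPolys.mp hQ
  have h2 : eval (fun h => (p h : ℝ) / q h) Q * ∏ h, (q h : ℝ) ^ r h =
      ((∑ s ∈ Q.support, z s * ∏ h, (p h ^ s h * (q h : ℤ) ^ (r h - s h)) : ℤ) : ℝ) := by
    rw [eval_eq', sum_mul]
    push_cast
    refine sum_congr rfl fun s hs => ?_
    rw [hz, mul_assoc, ← prod_mul_distrib]
    congr 1
    refine prod_congr rfl fun h _ => ?_
    have h3 : s h ≤ r h := degreeOf_le_iff.mp (hdeg h) s hs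
    obtain ⟨e, he⟩ := Nat.exists_eq_add_of_le h3
    have := (hq' h).ne'
    rw [he, Nat.add_sub_cancel_left, pow_add, div_pow]
    field_simp
  rw [h1, inv_le_iff_one_le_mul₀ hD]
  have h3 := mul_ne_zero h0 hD.ne'
  have h4 : |eval (fun h => (p h : ℝ) / q h) Q| * ∏ h, (q h : ℝ) ^ r h =
      |eval (fun h => (p h : ℝ) / q h) Q * ∏ h, (q h : ℝ) ^ r h| := by
    rw [abs_mul, abs_of_pos hD]
  rw [h4]
  rw [h2] at h3 ⊢
  exact_mod_cast Int.one_le_abs (by exact_mod_cast h3)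

/-! ### Sequences of approximations -/

lemma exists_le_log_of_infinite {α ε : ℝ} (hε : 0 < ε) {T : Set (ℤ × ℕ)} (hT : T.Infinite)
    (hTα : ∀ x ∈ T, 1 ≤ x.2 ∧ |α - (x.1 : ℝ) / (x.2 : ℝ)| < 1 / (x.2 : ℝ) ^ ((2 : ℝ) + ε))
    (L : ℝ) : ∃ x ∈ T, L ≤ Real.log x.2 := by
  by_contra! hc
  refine hT ?_
  obtain ⟨N, hN⟩ := exists_nat_gt (Real.exp L)
  obtain ⟨M, hM⟩ := exists_nat_gt ((|α| + 1) * N)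
  refine ((Set.finite_Icc (-(M : ℤ)) M).prod (Set.finite_Iic N)).subset fun x hx => ?_
  obtain ⟨h1, h2⟩ := hTα x hx
  have hx0 : (1 : ℝ) ≤ x.2 := by exact_mod_cast h1
  have hxN : (x.2 : ℝ) ≤ N := by
    rw [← Real.exp_log (show (0 : ℝ) < x.2 by linarith)]
    exact (Real.exp_le_exp.mpr (hc x hx).le).trans hN.le
  have h3 : |α - (x.1 : ℝ) / x.2| < 1 := by
    refine h2.trans_le ?_
    rw [div_le_one (by positivity)]
    exact Real.one_le_rpow hx0 (by linarith)
  have h4 : |(x.1 : ℝ) / x.2| ≤ |α| + 1 := by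
    have := abs_sub_abs_le_abs_sub ((x.1 : ℝ) / x.2) α
    rw [abs_sub_comm] at this
    linarith
  rw [abs_div, Nat.abs_cast, div_le_iff₀ (by linarith)] at h4
  have h5 : |(x.1 : ℝ)| ≤ M :=
    h4.trans ((mul_le_mul_of_nonneg_left hxN (by positivity)).trans hM.le)
  have h6 : |x.1| ≤ (M : ℤ) := by exact_mod_cast h5
  exact ⟨abs_le.mp h6, by exact_mod_cast hxN⟩

lemma exists_lacunary_seq {T : Set (ℤ × ℕ)} (hT : ∀ L, ∃ x ∈ T, L ≤ Real.log x.2) {L Λ : ℝ}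
    (hL : 0 < L) (hΛ : 1 ≤ Λ) : ∃ f : ℕ → ℤ × ℕ, (∀ n, f n ∈ T) ∧ (∀ n, L ≤ Real.log (f n).2) ∧
      ∀ n n', n < n' → Λ * Real.log (f n).2 ≤ Real.log (f n').2 := by
  choose F hF hFL using hT
  let f : ℕ → ℤ × ℕ := fun n => Nat.rec (F L) (fun _ x => F (Λ * Real.log x.2)) n
  have hsucc : ∀ n, Λ * Real.log (f n).2 ≤ Real.log (f (n + 1)).2 := fun n => hFL _
  have hL' : ∀ n, L ≤ Real.log (f n).2 := fun n => by
    induction n with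
    | zero => exact hFL L
    | succ n ih => nlinarith [hsucc n]
  refine ⟨f, fun n => by cases n <;> exact hF _, hL', fun n n' h => ?_⟩
  induction n', h using Nat.le_induction with
  | base => exact hsucc n
  | succ k _ ih => nlinarith [hsucc k, hL' k]

theorem finite_approximations {α : ℝ} (hα : IsAlgebraic ℚ α) {ε : ℝ} (hε : 0 < ε) :
    {pq : ℤ × ℕ | 1 ≤ pq.2 ∧ Int.gcd pq.1 pq.2 = 1 ∧
      |α - (pq.1 : ℝ) / (pq.2 : ℝ)| < 1 / (pq.2 : ℝ) ^ ((2 : ℝ) + ε)}.Finite := by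
  by_contra hinf
  set δ := ε / (8 * (2 + ε)) with hδdef
  have hδε : (2 + ε) * δ = ε / 8 := by rw [hδdef]; field_simp
  have hδ : 0 < δ := by positivity
  have hδ1 : δ < 1 / 8 := by nlinarith
  clear_value δ
  obtain ⟨m, K, hm, hK, haux⟩ := exists_auxiliary_poly hα hδ (by linarith)
  obtain ⟨ω, hω, hroth⟩ := exists_wt_le_of_lacunary m le_rfl δ hδ (by linarith)
  set η := min (ε / 16) 1 with hηdef
  have hη : 0 < η := by positivity
  have hη1 : η ≤ 1 := min_le_right _ _
  have hηε : η ≤ ε / 16 := min_le_left _ _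
  clear_value η
  have hm1 : (1 : ℝ) ≤ m := by exact_mod_cast hm
  have hKα : 1 ≤ 2 * (1 + |α|) * K := by nlinarith [abs_nonneg α]
  set M := Real.log (2 * (1 + |α|) * K) + 1 with hM
  have hM1 : 1 ≤ M := by linarith [Real.log_nonneg hKα]
  have hKM : Real.log K ≤ M := by
    have : K ≤ 2 * (1 + |α|) * K := by nlinarith [abs_nonneg α]
    linarith [Real.log_le_log (by linarith) this]
  set L := 2 * m * M / min ω η with hLdef
  have hL : 0 < L := by positivity
  have hLmin : 2 * m * M = L * min ω η := by rw [hLdef]; field_simp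
  clear_value L
  obtain ⟨f, hfT, hfL, hlac⟩ := exists_lacunary_seq
    (exists_le_log_of_infinite hε hinf fun x hx => ⟨hx.1, hx.2.2⟩) hL
    (le_max_left 1 (2 / ω))
  set p : Fin m → ℤ := fun h => (f h).1
  set q : Fin m → ℕ := fun h => (f h).2
  have hq : ∀ h, 0 < q h := fun h => (hfT h).1
  have hqL : ∀ h, L ≤ Real.log (q h) := fun h => hfL h
  have hlogq : ∀ h, 0 < Real.log (q h) := fun h => hL.trans_le (hqL h)
  set B := (∑ h, Real.log (q h)) / η with hBdef
  have hBq : ∀ h, Real.log (q h) ≤ η * B := fun h => by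
    rw [hBdef, mul_div_cancel₀ _ hη.ne']
    exact single_le_sum (fun h _ => (hlogq h).le) (mem_univ h)
  have hB : 0 < B := by nlinarith [hBq ⟨0, hm⟩, hlogq ⟨0, hm⟩]
  clear_value B
  set r : Fin m → ℕ := fun h => ⌈B / Real.log (q h)⌉₊ with hrdef
  have hr : ∀ h, 0 < r h := fun h => Nat.ceil_pos.mpr (div_pos hB (hlogq h))
  have hBr : ∀ h, B ≤ r h * Real.log (q h) := fun h => by
    rw [← div_le_iff₀ (hlogq h)]; exact Nat.le_ceil _
  have hrB : ∀ h, r h * Real.log (q h) ≤ (1 + η) * B := fun h => by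
    have h1 : (r h : ℝ) ≤ B / Real.log (q h) + 1 :=
      (Nat.ceil_lt_add_one (div_pos hB (hlogq h)).le).le
    have h2 := mul_le_mul_of_nonneg_right h1 (hlogq h).le
    rw [add_mul, div_mul_cancel₀ _ (hlogq h).ne'] at h2
    linarith [hBq h]
  have hrL : ∑ h, (r h : ℝ) * M ≤ min ω η * B := by
    have h1 : ∀ h, (r h : ℝ) * L ≤ 2 * B := fun h => by
      have h2 := mul_le_mul_of_nonneg_left (hqL h) (Nat.cast_nonneg (α := ℝ) (r h))
      nlinarith [hrB h]
    have h2 : (∑ h, (r h : ℝ)) * L ≤ m * (2 * B) := by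
      rw [sum_mul]
      exact (sum_le_card_nsmul _ _ _ fun h _ => h1 h).trans (by simp)
    rw [← sum_mul]
    refine le_of_mul_le_mul_right ?_ hL
    nlinarith [mul_le_mul_of_nonneg_left h2 (by linarith : 0 ≤ M)]
  rw [← sum_mul] at hrL
  have hr0 : (0 : ℝ) ≤ ∑ h, (r h : ℝ) := sum_nonneg fun _ _ => Nat.cast_nonneg _
  have hωB : min ω η * B ≤ ω * B := mul_le_mul_of_nonneg_right (min_le_left _ _) hB.le
  have hηB : min ω η * B ≤ η * B := mul_le_mul_of_nonneg_right (min_le_right _ _) hB.le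
  obtain ⟨P, hPint, hP0, hPdeg, hPlen, hPwt⟩ := haux r hr
  have hlenP := one_le_len hPint hP0
  obtain ⟨I, hI, hIwt⟩ := hroth r p q B hB hr hq (fun h => (hfT h).2.1)
    (fun h h' hh => by
      have h1 : 2 / ω * Real.log (q h) ≤ Real.log (q h') :=
        (mul_le_mul_of_nonneg_right (le_max_right 1 _) (hlogq h).le).trans (hlac h h' hh)
      have h2 : 2 * Real.log (q h) ≤ ω * Real.log (q h') := by
        rw [div_mul_eq_mul_div, div_le_iff₀ hω] at h1
        linarith
      refine le_of_mul_le_mul_right ?_ (hlogq h')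
      have h3 := mul_le_mul_of_nonneg_left h2 (Nat.cast_nonneg (α := ℝ) (r h))
      nlinarith [hrB h', hBr h])
    hBr P hPint hP0 (fun h hh => absurd h.2 hh) hPdeg
    ((le_mul_of_one_le_right hr0 hM1).trans (hrL.trans hωB))
    (by
      refine (Real.log_le_log (by linarith) hPlen).trans ?_
      rw [Real.log_pow]
      push_cast
      exact (mul_le_mul_of_nonneg_left hKM hr0).trans (hrL.trans hωB))
  rw [coeff_translate] at hI
  have hlow := exp_le_abs_eval (hasse_mem_integralPolys I hPint)
    (fun h => (degreeOf_hasse_le I h P).trans (hPdeg h)) hq hI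
  have hup := abs_eval_hasse_le hPdeg hPlen (E := (2 + ε) * B) (by positivity) hPwt
    (ξ := fun h => (p h : ℝ) / q h) (fun h => by
      have hq' : (0 : ℝ) < q h := by exact_mod_cast hq h
      have hr' : (0 : ℝ) < r h := by exact_mod_cast hr h
      rw [abs_sub_comm]
      refine (hfT h).2.2.le.trans ?_
      rw [one_div, ← Real.rpow_neg hq'.le, Real.rpow_def_of_pos hq']
      apply Real.exp_le_exp.mpr
      have : (2 + ε) * B / r h ≤ (2 + ε) * Real.log (q h) := by
        rw [div_le_iff₀ hr']
        nlinarith [mul_le_mul_of_nonneg_left (hBr h) (by linarith : 0 ≤ 2 + ε)]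
      linarith) I
  have hlog := hlow.trans hup
  rw [← Real.exp_log (show 0 < 2 * (1 + |α|) * K by linarith), ← Real.exp_nat_mul,
    ← Real.exp_add, Real.exp_le_exp] at hlog
  push_cast at hlog
  have h1 : (∑ h, (r h : ℝ)) * Real.log (2 * (1 + |α|) * K) ≤ η * B :=
    (mul_le_mul_of_nonneg_left (by linarith) hr0).trans (hrL.trans hηB)
  have h2 : ∑ h, r h * Real.log (q h) ≤ m * ((1 + η) * B) :=
    (sum_le_card_nsmul _ _ _ fun h _ => hrB h).trans (by simp)
  have h3 := mul_le_mul_of_nonneg_left hIwt (show 0 ≤ (2 + ε) * B by positivity)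
  have h4 : (2 + ε) * (m * (1 / 2 - δ) - δ) * B ≤ (m * (1 + η) + η) * B := by linarith
  have h5 := le_of_mul_le_mul_right h4 hB
  have h6 : (m : ℝ) * ((2 + ε) * δ) = m * (ε / 8) := by rw [hδε]
  have h7 : (m : ℝ) * η ≤ m * (ε / 16) := by gcongr
  have h8 : ε ≤ m * ε := le_mul_of_one_le_left hε.le hm1
  linarith

end

end Roth

/-- Roth's theorem (1955): if `α` is an irrational algebraic real number and `ε > 0`,
then there are only finitely many reduced rationals `p/q` with `q ≥ 1` and
`|α - p/q| < 1/q^{2+ε}`. -/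
theorem roth_theorem (α : ℝ) (hα : IsAlgebraic ℚ α) (hirr : Irrational α)
    (ε : ℝ) (hε : 0 < ε) :
    {pq : ℤ × ℕ | 1 ≤ pq.2 ∧ Int.gcd pq.1 pq.2 = 1 ∧
      |α - (pq.1 : ℝ) / (pq.2 : ℝ)| < 1 / (pq.2 : ℝ) ^ ((2 : ℝ) + ε)}.Finite :=
  Roth.finite_approximations hα hε
end

section
/- The number ζ(3) = ∑_{n=1}^∞ 1/n³ is irrational. -/
open Finset

/-- The product `C(n, k) C(n + k, k)`, whose square is the summand of the Apéry numbers. -/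
noncomputable def aperyCoeff (n k : ℕ) : ℝ := n.choose k * (n + k).choose k

/-- The inner sums `c_{n,k}` in the numerators of Apéry's approximations to `ζ(3)`. -/
noncomputable def aperyInner (n k : ℕ) : ℝ :=
  ∑ m ∈ range n, 1 / ((m : ℝ) + 1) ^ 3 +
    ∑ m ∈ range k, (-1) ^ m / (2 * ((m : ℝ) + 1) ^ 3 * aperyCoeff n (m + 1))

/-- The Apéry numbers, the denominators of Apéry's approximations to `ζ(3)`. -/
noncomputable def aperyDen (n : ℕ) : ℝ := ∑ k ∈ range (n + 1), aperyCoeff n k ^ 2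

/-- The numerators of Apéry's approximations to `ζ(3)`. -/
noncomputable def aperyNum (n : ℕ) : ℝ :=
  ∑ k ∈ range (n + 1), aperyCoeff n k ^ 2 * aperyInner n k

theorem aperyCoeff_zero_right (n : ℕ) : aperyCoeff n 0 = 1 := by simp [aperyCoeff]

theorem aperyCoeff_eq_zero {n k : ℕ} (h : n < k) : aperyCoeff n k = 0 := by
  simp [aperyCoeff, Nat.choose_eq_zero_of_lt h]

theorem aperyCoeff_pos {n k : ℕ} (h : k ≤ n) : 0 < aperyCoeff n k := by
  have h1 := Nat.choose_pos h
  have h2 := Nat.choose_pos (Nat.le_add_left k n)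
  unfold aperyCoeff
  positivity

theorem cast_choose_succ_right (n k : ℕ) :
    (n.choose (k + 1) : ℝ) * (k + 1) = n.choose k * ((n : ℝ) - k) := by
  rcases le_or_gt k n with h | h
  · have := Nat.choose_succ_right_eq n k
    rw [← Nat.cast_sub h]
    exact_mod_cast this
  · simp [Nat.choose_eq_zero_of_lt h, Nat.choose_eq_zero_of_lt (h.trans (Nat.lt_succ_self k))]

theorem cast_choose_succ_left (n k : ℕ) :
    ((n + 1).choose k : ℝ) * ((n : ℝ) + 1 - k) = n.choose k * (n + 1) := by
  rcases le_or_gt k (n + 1) with h | h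
  · have := Nat.choose_mul_succ_eq n k
    have e : ((n : ℝ) + 1 - k) = ((n + 1 - k : ℕ) : ℝ) := by rw [Nat.cast_sub h]; push_cast; ring
    rw [e]
    exact_mod_cast this.symm
  · simp [Nat.choose_eq_zero_of_lt h, Nat.choose_eq_zero_of_lt ((Nat.lt_succ_self n).trans h)]

theorem cast_choose_succ_succ (n k : ℕ) :
    ((n + 1).choose (k + 1) : ℝ) * (k + 1) = (n + 1) * n.choose k := by
  exact_mod_cast (Nat.add_one_mul_choose_eq n k).symm

theorem cast_choose_add_succ (n k : ℕ) :
    ((n + 1 + k).choose k : ℝ) * (n + 1) = (n + k + 1) * (n + k).choose k := by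
  have h := cast_choose_succ_left (n + k) k
  rw [show n + k + 1 = n + 1 + k by ring] at h
  push_cast at h
  linear_combination h

theorem aperyCoeff_succ_right (n k : ℕ) :
    aperyCoeff n (k + 1) = ((n : ℝ) - k) * (n + k + 1) / (k + 1) ^ 2 * aperyCoeff n k := by
  have h1 := cast_choose_succ_right n k
  have h2 := cast_choose_succ_succ (n + k) k
  have hk : (k : ℝ) + 1 ≠ 0 := by positivity
  push_cast at h2
  rw [← eq_div_iff hk] at h1 h2
  simp only [aperyCoeff, ← add_assoc, h1, h2]
  field_simp

theorem aperyCoeff_succ_succ (n k : ℕ) :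
    aperyCoeff (n + 1) (k + 1) = ((n : ℝ) + k + 2) * (n + k + 1) / (k + 1) ^ 2 * aperyCoeff n k := by
  have h1 := cast_choose_succ_succ n k
  have h2 := cast_choose_succ_succ (n + 1 + k) k
  have h3 := cast_choose_add_succ n k
  have hk : (k : ℝ) + 1 ≠ 0 := by positivity
  have hn : (n : ℝ) + 1 ≠ 0 := by positivity
  push_cast at h2
  rw [← eq_div_iff hk] at h1 h2
  rw [← eq_div_iff hn] at h3
  simp only [aperyCoeff, ← add_assoc, h1, h2, h3]
  field_simp
  ring

theorem aperyCoeff_succ_right_eq_left (n k : ℕ) :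
    aperyCoeff n (k + 1) = ((n : ℝ) + 1 - k) * (n - k) / (k + 1) ^ 2 * aperyCoeff (n + 1) k := by
  rw [aperyCoeff_succ_right]
  have h1 := cast_choose_succ_left n k
  have h2 := cast_choose_add_succ n k
  have hn : (n : ℝ) + 1 ≠ 0 := by positivity
  have key : ((n : ℝ) + 1 - k) * aperyCoeff (n + 1) k = (n + k + 1) * aperyCoeff n k := by
    rw [← mul_left_inj' hn]
    simp only [aperyCoeff]
    linear_combination ((n + 1 + k).choose k : ℝ) * (n + 1) * h1 + (n.choose k : ℝ) * (n + 1) * h2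
  linear_combination (-((n : ℝ) - k) / (k + 1) ^ 2) * key

theorem aperyInner_succ_right (n k : ℕ) :
    aperyInner n (k + 1) =
      aperyInner n k + (-1) ^ k / (2 * ((k : ℝ) + 1) ^ 3 * aperyCoeff n (k + 1)) := by
  simp only [aperyInner, sum_range_succ]
  ring

theorem aperyInner_succ_left {n k : ℕ} (h : k ≤ n) :
    aperyInner (n + 1) k =
      aperyInner n k + (-1) ^ k / (((n : ℝ) + 1) ^ 2 * (n + 1 + k) * aperyCoeff n k) := by
  induction k with
  | zero =>
    simp [aperyInner, sum_range_succ, aperyCoeff_zero_right]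
    field_simp
  | succ k ih =>
    have hx := aperyCoeff_pos (Nat.le_of_succ_le h)
    have hnk : (0 : ℝ) < n - k := by
      rw [sub_pos]; exact_mod_cast h
    rw [aperyInner_succ_right, aperyInner_succ_right, ih (Nat.le_of_succ_le h),
      aperyCoeff_succ_right n k, aperyCoeff_succ_succ n k, pow_succ]
    have h1 : (n : ℝ) + k + 1 ≠ 0 := by positivity
    have h2 : (n : ℝ) + k + 2 ≠ 0 := by positivity
    have h3 : (n : ℝ) + 1 + k ≠ 0 := by positivity
    have h4 : (n : ℝ) + 1 + (k + 1) ≠ 0 := by positivity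
    have := hnk.ne'
    have := hx.ne'
    push_cast
    generalize aperyCoeff n k = x at *
    field_simp
    ring

theorem aperyCoeff_recurrence (n k : ℕ) :
    ((n : ℝ) + 2) ^ 3 * aperyCoeff (n + 2) (k + 1) ^ 2
      - (34 * ((n : ℝ) + 1) ^ 3 + 51 * (n + 1) ^ 2 + 27 * (n + 1) + 5)
        * aperyCoeff (n + 1) (k + 1) ^ 2
      + ((n : ℝ) + 1) ^ 3 * aperyCoeff n (k + 1) ^ 2 =
    4 * (2 * n + 3) * ((k + 1) * (2 * k + 3) - (2 * n + 3) ^ 2) * aperyCoeff (n + 1) (k + 1) ^ 2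
      - 4 * (2 * n + 3) * (k * (2 * k + 1) - (2 * n + 3) ^ 2) * aperyCoeff (n + 1) k ^ 2 := by
  rw [aperyCoeff_succ_succ (n + 1) k, aperyCoeff_succ_right (n + 1) k,
    aperyCoeff_succ_right_eq_left n k]
  have : (k : ℝ) + 1 ≠ 0 := by positivity
  push_cast
  field_simp
  ring

theorem aperyDen_eq_sum {n N : ℕ} (h : n < N) :
    aperyDen n = ∑ k ∈ range N, aperyCoeff n k ^ 2 := by
  refine sum_subset (range_mono h) fun k _ hk ↦ ?_
  rw [aperyCoeff_eq_zero (by simpa using hk)]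
  simp

theorem aperyNum_eq_sum {n N : ℕ} (h : n < N) :
    aperyNum n = ∑ k ∈ range N, aperyCoeff n k ^ 2 * aperyInner n k := by
  refine sum_subset (range_mono h) fun k _ hk ↦ ?_
  rw [aperyCoeff_eq_zero (by simpa using hk)]
  simp

theorem aperyDen_recurrence (n : ℕ) :
    ((n : ℝ) + 2) ^ 3 * aperyDen (n + 2)
      - (34 * ((n : ℝ) + 1) ^ 3 + 51 * (n + 1) ^ 2 + 27 * (n + 1) + 5) * aperyDen (n + 1)
      + ((n : ℝ) + 1) ^ 3 * aperyDen n = 0 := by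
  rw [aperyDen_eq_sum (show n < n + 2 + 1 by lia), aperyDen_eq_sum (show n + 1 < n + 2 + 1 by lia),
    aperyDen_eq_sum (show n + 2 < n + 2 + 1 by lia), mul_sum, mul_sum, mul_sum,
    ← sum_sub_distrib, ← sum_add_distrib, sum_range_succ']
  simp only [aperyCoeff_recurrence]
  have := sum_range_sub (fun k : ℕ ↦ 4 * (2 * (n : ℝ) + 3) * (k * (2 * k + 1) - (2 * n + 3) ^ 2)
    * aperyCoeff (n + 1) k ^ 2) (n + 2)
  rw [aperyCoeff_eq_zero (show n + 1 < n + 2 by lia)] at this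
  simp only [aperyCoeff_zero_right] at this ⊢
  push_cast at this
  ring_nf at this ⊢
  linear_combination this

theorem aperyNum_summand_recurrence {n k : ℕ} (h : k ≤ n + 1) :
    ((n : ℝ) + 2) ^ 3 * (aperyCoeff (n + 2) (k + 1) ^ 2 * aperyInner (n + 2) (k + 1))
      - (34 * ((n : ℝ) + 1) ^ 3 + 51 * (n + 1) ^ 2 + 27 * (n + 1) + 5)
        * (aperyCoeff (n + 1) (k + 1) ^ 2 * aperyInner (n + 1) (k + 1))
      + ((n : ℝ) + 1) ^ 3 * (aperyCoeff n (k + 1) ^ 2 * aperyInner n (k + 1)) =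
    (4 * (2 * n + 3) * ((k + 1) * (2 * k + 3) - (2 * n + 3) ^ 2)
        * (aperyCoeff (n + 1) (k + 1) ^ 2 * aperyInner (n + 1) (k + 1))
      - 5 * (2 * n + 3) * (-1) ^ (k + 1) * (k + 1) / ((n + 1) * (n + 2))
        * aperyCoeff (n + 1) (k + 1))
    - (4 * (2 * n + 3) * (k * (2 * k + 1) - (2 * n + 3) ^ 2)
        * (aperyCoeff (n + 1) k ^ 2 * aperyInner (n + 1) k)
      - 5 * (2 * n + 3) * (-1) ^ k * k / ((n + 1) * (n + 2)) * aperyCoeff (n + 1) k) := by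
  have hx := (aperyCoeff_pos h).ne'
  have hk : (k : ℝ) + 1 ≠ 0 := by positivity
  have hn1 : (n : ℝ) + 1 ≠ 0 := by positivity
  have hn2 : (n : ℝ) + 2 ≠ 0 := by positivity
  have sq_mul_inner (N : ℕ) : aperyCoeff N (k + 1) ^ 2 * aperyInner N (k + 1) =
      aperyCoeff N (k + 1) ^ 2 * aperyInner N k
        + (-1) ^ k * aperyCoeff N (k + 1) / (2 * ((k : ℝ) + 1) ^ 3) := by
    rw [aperyInner_succ_right]
    rcases eq_or_ne (aperyCoeff N (k + 1)) 0 with h0 | h0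
    · simp [h0]
    · field_simp
  have upper : aperyCoeff (n + 2) (k + 1) ^ 2 * aperyInner (n + 2) k =
      aperyCoeff (n + 2) (k + 1) ^ 2 * aperyInner (n + 1) k
        + aperyCoeff (n + 2) (k + 1) * (-1) ^ k * (n + k + 3) / ((n + 2) ^ 2 * (k + 1) ^ 2) := by
    rw [aperyInner_succ_left h, aperyCoeff_succ_succ (n + 1) k]
    have : (n : ℝ) + k + 2 ≠ 0 := by positivity
    have : (n : ℝ) + 1 + 1 + k ≠ 0 := by positivity
    have : (n : ℝ) + 1 + 1 ≠ 0 := by positivity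
    push_cast
    field_simp
    ring
  have lower : aperyCoeff n (k + 1) ^ 2 * aperyInner n k =
      aperyCoeff n (k + 1) ^ 2 * aperyInner (n + 1) k
        - aperyCoeff n (k + 1) * (-1) ^ k * (n - k) / ((n + 1) ^ 2 * (k + 1) ^ 2) := by
    rcases Nat.lt_or_ge n k with h' | h'
    · simp [aperyCoeff_eq_zero (h'.trans (Nat.lt_succ_self k))]
    · rw [aperyInner_succ_left h', aperyCoeff_succ_right n k]
      have := (aperyCoeff_pos h').ne'
      have : (n : ℝ) + k + 1 ≠ 0 := by positivity
      have : (n : ℝ) + 1 + k ≠ 0 := by positivity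
      field_simp
      ring
  rw [sq_mul_inner, sq_mul_inner, sq_mul_inner, upper, lower, aperyCoeff_succ_succ (n + 1) k,
    aperyCoeff_succ_right (n + 1) k, aperyCoeff_succ_right_eq_left n k, pow_succ]
  push_cast
  generalize aperyCoeff (n + 1) k = x
  generalize aperyInner (n + 1) k = c
  field_simp
  ring

theorem aperyNum_recurrence (n : ℕ) :
    ((n : ℝ) + 2) ^ 3 * aperyNum (n + 2)
      - (34 * ((n : ℝ) + 1) ^ 3 + 51 * (n + 1) ^ 2 + 27 * (n + 1) + 5) * aperyNum (n + 1)
      + ((n : ℝ) + 1) ^ 3 * aperyNum n = 0 := by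
  rw [aperyNum_eq_sum (show n < n + 2 + 1 by lia), aperyNum_eq_sum (show n + 1 < n + 2 + 1 by lia),
    aperyNum_eq_sum (show n + 2 < n + 2 + 1 by lia), mul_sum, mul_sum, mul_sum,
    ← sum_sub_distrib, ← sum_add_distrib, sum_range_succ',
    sum_congr rfl fun k hk ↦ aperyNum_summand_recurrence (Nat.lt_succ_iff.mp (mem_range.mp hk))]
  have := sum_range_sub (fun k : ℕ ↦ 4 * (2 * (n : ℝ) + 3) * (k * (2 * k + 1) - (2 * n + 3) ^ 2)
    * (aperyCoeff (n + 1) k ^ 2 * aperyInner (n + 1) k)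
    - 5 * (2 * n + 3) * (-1) ^ k * k / ((n + 1) * (n + 2)) * aperyCoeff (n + 1) k) (n + 2)
  rw [aperyCoeff_eq_zero (show n + 1 < n + 2 by lia)] at this
  have e1 : aperyInner (n + 2) 0 = aperyInner (n + 1) 0 + 1 / ((n : ℝ) + 2) ^ 3 := by
    simp only [aperyInner, sum_range_succ _ (n + 1)]
    push_cast
    ring
  have e2 : aperyInner (n + 1) 0 = aperyInner n 0 + 1 / ((n : ℝ) + 1) ^ 3 := by
    simp only [aperyInner, sum_range_succ _ n]
    ring
  push_cast at this
  have e : ∀ k : ℕ, (2 * ((k : ℝ) + 1) + 1) = 2 * k + 3 := fun k ↦ by ring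
  simp only [e] at this
  rw [this, e1, e2]
  simp only [aperyCoeff_zero_right]
  field_simp
  ring

theorem aperyDen_pos (n : ℕ) : 0 < aperyDen n :=
  sum_pos (fun _ hk ↦ pow_pos (aperyCoeff_pos (Nat.lt_succ_iff.mp (mem_range.mp hk))) 2)
    nonempty_range_add_one

theorem casoratian (n : ℕ) :
    aperyNum (n + 1) * aperyDen n - aperyNum n * aperyDen (n + 1) = 6 / ((n : ℝ) + 1) ^ 3 := by
  induction n with
  | zero =>
    norm_num [aperyNum, aperyDen, aperyInner, aperyCoeff, sum_range_succ, Nat.choose]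
  | succ n ih =>
    have hn1 : (n : ℝ) + 1 ≠ 0 := by positivity
    have hn2 : (n : ℝ) + 2 ≠ 0 := by positivity
    rw [eq_div_iff (by positivity)] at ih ⊢
    push_cast
    linear_combination ih + aperyDen (n + 1) * aperyNum_recurrence n
      - aperyNum (n + 1) * aperyDen_recurrence n

open Chebyshev Nat

theorem succ_mul_choose_dvd {D m n : ℕ} (hm : m < n) (hD : ∀ j, 1 ≤ j → j ≤ n → j ∣ D) :
    (m + 1) * n.choose (m + 1) ∣ D := by
  induction m generalizing n with
  | zero => simpa using hD n hm le_rfl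
  | succ m ih =>
    obtain ⟨n, rfl⟩ := Nat.exists_eq_succ_of_ne_zero (Nat.ne_zero_of_lt hm)
    obtain ⟨x, hx⟩ := ih (by lia) hD
    obtain ⟨y, hy⟩ := ih (n := n) (by lia) fun j h1 h2 ↦ hD j h1 (by lia)
    have h1 := Nat.add_one_mul_choose_eq n (m + 1)
    have h2 := Nat.add_one_mul_choose_eq n m
    have h3 := Nat.choose_succ_right_eq n m
    zify [show m ≤ n by lia] at hx hy h1 h2 h3
    rw [← Int.natCast_dvd_natCast]
    refine ⟨y - x, ?_⟩
    have hm0 : (m : ℤ) + 1 ≠ 0 := by positivity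
    refine mul_left_cancel₀ hm0 ?_
    push_cast
    linear_combination ((n : ℤ) + 1) * hy - ((n : ℤ) - m) * hx + x * ((n : ℤ) - m) * h2
      + (m + 1) * (y - x) * h1 + (n + 1) * x * h3

theorem prime_dvd_choose_mul_choose_mul_choose {m p : ℕ} (hp : p.Prime) (h : m < p)
    (h' : p ≤ 42 * m) :
    p ∣ (42 * m).choose (21 * m) * (21 * m).choose (14 * m) * (7 * m).choose (6 * m) := by
  set M := (42 * m).choose (21 * m) * (21 * m).choose (14 * m) * (7 * m).choose (6 * m)
  have hM : M * ((21 * m)! * (14 * m)! * (6 * m)! * m !) = (42 * m)! := by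
    have h1 := Nat.choose_mul_factorial_mul_factorial (show 21 * m ≤ 42 * m by lia)
    have h2 := Nat.choose_mul_factorial_mul_factorial (show 14 * m ≤ 21 * m by lia)
    have h3 := Nat.choose_mul_factorial_mul_factorial (show 6 * m ≤ 7 * m by lia)
    rw [show 42 * m - 21 * m = 21 * m by lia] at h1
    rw [show 21 * m - 14 * m = 7 * m by lia] at h2
    rw [show 7 * m - 6 * m = m by lia] at h3
    calc _ = (42 * m).choose (21 * m) * (21 * m)! * ((21 * m).choose (14 * m) * (14 * m)! *
          ((7 * m).choose (6 * m) * (6 * m)! * m !)) := by ring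
      _ = _ := by rw [h3, h2, h1]
  have := Fact.mk hp
  have hM0 : M ≠ 0 := by
    rintro h0
    rw [h0, zero_mul] at hM
    exact (Nat.factorial_ne_zero _ hM.symm)
  refine dvd_of_one_le_padicValNat ?_
  have hv := congrArg (padicValNat p) hM
  have f0 (k : ℕ) := Nat.factorial_ne_zero k
  rw [padicValNat.mul hM0 (by simp [f0]), padicValNat.mul (by simp [f0]) (f0 _),
    padicValNat.mul (by simp [f0]) (f0 _), padicValNat.mul (f0 _) (f0 _)] at hv
  have hlog (k : ℕ) (hk : k ≤ 42 * m) : Nat.log p k < Nat.log p (42 * m) + 1 :=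
    Nat.lt_succ_of_le (Nat.log_mono_right hk)
  rw [padicValNat_factorial (hlog _ le_rfl), padicValNat_factorial (hlog (21 * m) (by lia)),
    padicValNat_factorial (hlog (14 * m) (by lia)), padicValNat_factorial (hlog (6 * m) (by lia)),
    padicValNat_factorial (hlog m (by lia)), ← sum_add_distrib, ← sum_add_distrib,
    ← sum_add_distrib] at hv
  have hdiv (q : ℕ) : 21 * m / q = 42 * m / q / 2 ∧ 14 * m / q = 42 * m / q / 3 ∧
      6 * m / q = 42 * m / q / 7 ∧ m / q = 42 * m / q / 42 := by
    simp only [Nat.div_div_eq_div_mul]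
    refine ⟨?_, ?_, ?_, ?_⟩ <;> rw [mul_comm q]
    · rw [← Nat.mul_div_mul_left (21 * m) q (show 0 < 2 by simp)]; ring_nf
    · rw [← Nat.mul_div_mul_left (14 * m) q (show 0 < 3 by simp)]; ring_nf
    · rw [← Nat.mul_div_mul_left (6 * m) q (show 0 < 7 by simp)]; ring_nf
    · rw [← Nat.mul_div_mul_left m q (show 0 < 42 by simp)]
  have hlt : ∑ i ∈ Ico 1 (Nat.log p (42 * m) + 1),
      (21 * m / p ^ i + 14 * m / p ^ i + 6 * m / p ^ i + m / p ^ i) <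
      ∑ i ∈ Ico 1 (Nat.log p (42 * m) + 1), 42 * m / p ^ i := by
    refine sum_lt_sum (fun i _ ↦ ?_) ⟨1, ?_, ?_⟩
    · obtain ⟨h1, h2, h3, h4⟩ := hdiv (p ^ i)
      lia
    · have := Nat.log_pos hp.one_lt h'
      simp only [mem_Ico]
      lia
    · obtain ⟨h1, h2, h3, h4⟩ := hdiv p
      have hq : 1 ≤ 42 * m / p := (Nat.one_le_div_iff hp.pos).2 h'
      have hm : m / p = 0 := Nat.div_eq_of_lt h
      rw [pow_one]
      lia
  lia

theorem choose_mul_choose_mul_choose_le (m : ℕ) :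
    (42 * m).choose (21 * m) * (21 * m).choose (14 * m) * (7 * m).choose (6 * m) ≤
      (2 ^ 22 * 3 ^ 15 * 7 ^ 7) ^ m := by
  have term (n k x : ℕ) (h : k ≤ n) : x ^ k * n.choose k ≤ (x + 1) ^ n := by
    rw [add_pow]
    simpa using single_le_sum (f := fun k ↦ x ^ k * 1 ^ (n - k) * n.choose k)
      (fun _ _ ↦ Nat.zero_le _) (mem_range.2 (Nat.lt_succ_of_le h))
  have h1 := term (42 * m) (21 * m) 1 (by lia)
  have h2 := term (21 * m) (14 * m) 2 (by lia)
  have h3 := term (7 * m) (6 * m) 6 (by lia)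
  have h := Nat.mul_le_mul (Nat.mul_le_mul h1 h2) h3
  have hpos : 0 < (2 ^ 14 * 6 ^ 6) ^ m := by positivity
  refine Nat.le_of_mul_le_mul_left ?_ hpos
  calc _ = _ := ?_
    _ ≤ _ := h
    _ = _ := ?_
  · rw [mul_pow, ← pow_mul, ← pow_mul, one_pow]
    ring
  · simp only [pow_mul, ← mul_pow]
    norm_num

theorem theta_mul_le (m : ℕ) :
    θ ((42 * m : ℕ) : ℝ) ≤ θ (m : ℝ) + m * Real.log (2 ^ 22 * 3 ^ 15 * 7 ^ 7) := by
  set M := (42 * m).choose (21 * m) * (21 * m).choose (14 * m) * (7 * m).choose (6 * m) with hM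
  have hM0 : 0 < M := by
    have hpos (a b : ℕ) (h : a ≤ b) : 0 < (b * m).choose (a * m) :=
      Nat.choose_pos (Nat.mul_le_mul_right m h)
    have := hpos 21 42 (by simp)
    have := hpos 14 21 (by simp)
    have := hpos 6 7 (by simp)
    positivity
  have hdvd : ∏ p ∈ primesLE (42 * m) \ primesLE m, p ∣ M := by
    refine prod_primes_dvd M (fun p hp ↦ ?_) fun p hp ↦ ?_ <;>
      simp only [mem_sdiff, mem_primesLE] at hp
    · exact hp.1.2.prime
    · exact prime_dvd_choose_mul_choose_mul_choose hp.1.2 (by lia) hp.1.1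
  have hle : primorial (42 * m) ≤ primorial m * (2 ^ 22 * 3 ^ 15 * 7 ^ 7) ^ m := by
    rw [primorial_eq_prod_primesLE, primorial_eq_prod_primesLE,
      ← prod_sdiff (primesLE_mono (show m ≤ 42 * m by lia)), mul_comm]
    exact Nat.mul_le_mul_left _ ((Nat.le_of_dvd hM0 hdvd).trans (choose_mul_choose_mul_choose_le m))
  have hpos (k : ℕ) : (0 : ℝ) < primorial k := by exact_mod_cast primorial_pos k
  rw [theta_eq_log_primorial, theta_eq_log_primorial, Nat.floor_natCast, Nat.floor_natCast,
    ← Real.log_pow, ← Real.log_mul (hpos _).ne' (by positivity)]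
  exact Real.log_le_log (hpos _) (by exact_mod_cast hle)

theorem exists_theta_le : ∃ E : ℝ, ∀ n : ℕ, θ (n : ℝ) ≤ 1.15 * n + E := by
  have hlog : Real.log (2 ^ 22 * 3 ^ 15 * 7 ^ 7) ≤ 45.5 := by
    have h1 : Real.log ((2 ^ 22 * 3 ^ 15 * 7 ^ 7) ^ 2) ≤ 91 := by
      rw [Real.log_le_iff_le_exp (by positivity), ← mul_one (91 : ℝ), ← Nat.cast_ofNat (n := 91),
        Real.exp_nat_mul]
      refine le_trans ?_ (pow_le_pow_left₀ (by norm_num) Real.exp_one_gt_d9.le 91)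
      norm_num
    rw [Real.log_pow] at h1
    generalize Real.log (2 ^ 22 * 3 ^ 15 * 7 ^ 7) = L at h1 ⊢
    push_cast at h1
    linarith
  refine ⟨Real.log 4 * 1200, fun n ↦ ?_⟩
  induction n using Nat.strong_induction_on with
  | _ n ih =>
    rcases le_or_gt n 1200 with hn | hn
    · have hn' : (n : ℝ) ≤ 1200 := by exact_mod_cast hn
      have := theta_le_log4_mul_x (Nat.cast_nonneg (α := ℝ) n)
      have := mul_le_mul_of_nonneg_left hn' (Real.log_nonneg (show (1 : ℝ) ≤ 4 by norm_num))
      have : (0 : ℝ) ≤ n := Nat.cast_nonneg n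
      linarith
    · have h1 : θ (n : ℝ) ≤ θ ((42 * (n / 42 + 1) : ℕ) : ℝ) :=
        theta_mono (by exact_mod_cast (by lia : n ≤ 42 * (n / 42 + 1)))
      have h2 := theta_mul_le (n / 42 + 1)
      have h3 := ih (n / 42 + 1) (by lia)
      have h4 : ((n / 42 + 1 : ℕ) : ℝ) ≤ n / 42 + 1 := by
        push_cast
        gcongr
        exact Nat.cast_div_le
      have h5 : (1200 : ℝ) ≤ n := by exact_mod_cast hn.le
      have h6 := mul_le_mul_of_nonneg_left hlog (Nat.cast_nonneg (α := ℝ) (n / 42 + 1))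
      linarith

theorem exists_psi_le : ∃ E : ℝ, ∀ n : ℕ, ψ (n : ℝ) ≤ 1.155 * n + E := by
  obtain ⟨E, hE⟩ := exists_theta_le
  obtain ⟨C, hC⟩ := psi_sub_theta_le_mul_sqrt
  refine ⟨E + 50 * C ^ 2, fun n ↦ ?_⟩
  have h1 := hE n
  have h2 := hC n
  have h3 := Real.sq_sqrt (Nat.cast_nonneg (α := ℝ) n)
  nlinarith [sq_nonneg (√(n : ℝ) - 100 * C)]

theorem succ_dvd_lcmUpto {m n : ℕ} (h : m < n) : m + 1 ∣ lcmUpto n :=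
  dvd_lcm (f := id) (mem_Icc.2 ⟨by lia, by lia⟩)

theorem succ_mul_choose_dvd_lcmUpto {m k n : ℕ} (hm : m < k) (hk : k ≤ n) :
    (m + 1) * k.choose (m + 1) ∣ lcmUpto n :=
  succ_mul_choose_dvd hm fun _ h1 h2 ↦ dvd_lcm (f := id) (mem_Icc.2 ⟨h1, h2.trans hk⟩)

theorem natCast_mem_range_intCast (n : ℕ) : (n : ℝ) ∈ (Int.castRingHom ℝ).range :=
  natCast_mem _ n

theorem lcmUpto_pow_mul_choose_div_mem {n k m : ℕ} (hm : m < k) (hk : k ≤ n) :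
    (lcmUpto n : ℝ) ^ 3 * (n + k).choose k / (((m : ℝ) + 1) ^ 3 * aperyCoeff n (m + 1)) ∈
      (Int.castRingHom ℝ).range := by
  obtain ⟨x, hx⟩ := succ_dvd_lcmUpto (hm.trans_le hk)
  obtain ⟨y, hy⟩ := succ_mul_choose_dvd_lcmUpto (hm.trans_le hk) le_rfl
  obtain ⟨z, hz⟩ := succ_mul_choose_dvd_lcmUpto hm hk
  have h := Nat.choose_mul (n := n + k) (k := k) (s := k - (m + 1)) (by lia)
  rw [show n + k - (k - (m + 1)) = n + (m + 1) by lia,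
    show k - (k - (m + 1)) = m + 1 by lia, Nat.choose_symm (by lia)] at h
  convert natCast_mem_range_intCast (x * y * z * (n + k).choose (k - (m + 1))) using 1
  have := aperyCoeff_pos (show m + 1 ≤ n by lia)
  rw [div_eq_iff (by positivity), aperyCoeff]
  have hx' : (lcmUpto n : ℝ) = (m + 1) * x := by exact_mod_cast hx
  have hy' : (lcmUpto n : ℝ) = (m + 1) * n.choose (m + 1) * y := by exact_mod_cast hy
  have hz' : (lcmUpto n : ℝ) = (m + 1) * k.choose (m + 1) * z := by exact_mod_cast hz
  have h' : ((n + k).choose k : ℝ) * k.choose (m + 1) =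
    (n + k).choose (k - (m + 1)) * (n + (m + 1)).choose (m + 1) := by exact_mod_cast h
  have e : (lcmUpto n : ℝ) ^ 3 =
      ((m + 1) * x) * ((m + 1) * n.choose (m + 1) * y) * ((m + 1) * k.choose (m + 1) * z) := by
    rw [← hx', ← hy', ← hz']
    ring
  rw [e]
  push_cast
  linear_combination ((m : ℝ) + 1) ^ 3 * x * y * z * n.choose (m + 1) * h'

theorem two_mul_lcmUpto_pow_mul_aperyNum_mem (n : ℕ) :
    2 * (lcmUpto n : ℝ) ^ 3 * aperyNum n ∈ (Int.castRingHom ℝ).range := by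
  rw [aperyNum, mul_sum]
  refine sum_mem fun k hk ↦ ?_
  have hk' : k ≤ n := Nat.lt_succ_iff.mp (mem_range.mp hk)
  have h1 : (lcmUpto n : ℝ) ^ 3 * ∑ m ∈ range n, 1 / ((m : ℝ) + 1) ^ 3 ∈
      (Int.castRingHom ℝ).range := by
    rw [mul_sum]
    refine sum_mem fun m hm ↦ ?_
    obtain ⟨x, hx⟩ := succ_dvd_lcmUpto (mem_range.mp hm)
    convert natCast_mem_range_intCast (x ^ 3) using 1
    rw [hx]
    push_cast
    field_simp
  have h2 : (lcmUpto n : ℝ) ^ 3 * (n + k).choose k * ∑ m ∈ range k,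
      (-1) ^ m / (((m : ℝ) + 1) ^ 3 * aperyCoeff n (m + 1)) ∈ (Int.castRingHom ℝ).range := by
    rw [mul_sum]
    refine sum_mem fun m hm ↦ ?_
    convert mul_mem (lcmUpto_pow_mul_choose_div_mem (mem_range.mp hm) hk')
      (pow_mem (neg_mem (one_mem (Int.castRingHom ℝ).range)) m) using 1
    ring
  have e : ∑ m ∈ range k, (-1) ^ m / (2 * ((m : ℝ) + 1) ^ 3 * aperyCoeff n (m + 1)) =
      (∑ m ∈ range k, (-1) ^ m / (((m : ℝ) + 1) ^ 3 * aperyCoeff n (m + 1))) / 2 := by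
    rw [sum_div]
    refine sum_congr rfl fun m _ ↦ ?_
    rw [div_div]
    ring
  convert add_mem
    (mul_mem (natCast_mem_range_intCast (2 * (n.choose k * (n + k).choose k) ^ 2)) h1)
    (mul_mem (natCast_mem_range_intCast (n.choose k ^ 2 * (n + k).choose k)) h2) using 1
  rw [aperyInner, e, aperyCoeff]
  push_cast
  ring

theorem aperyDen_mem (n : ℕ) : aperyDen n ∈ (Int.castRingHom ℝ).range := by
  refine sum_mem fun k _ ↦ pow_mem (mul_mem ?_ ?_) 2 <;> exact natCast_mem_range_intCast _

theorem summable_one_div_succ_pow_three : Summable fun n : ℕ ↦ (1 : ℝ) / ((n : ℝ) + 1) ^ 3 := by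
  have := (summable_nat_add_iff 1).2 (Real.summable_one_div_nat_pow.2 (show 1 < 3 by simp))
  exact_mod_cast this

theorem succ_le_aperyCoeff {n m : ℕ} (h : m < n) : (n : ℝ) + 1 ≤ aperyCoeff n (m + 1) := by
  have h1 : 1 ≤ n.choose (m + 1) := Nat.choose_pos h
  have h2 : n + 1 ≤ (n + (m + 1)).choose (m + 1) := by
    rw [← Nat.choose_symm_add, ← Nat.choose_succ_self_right n]
    exact Nat.choose_le_choose n (by lia)
  rw [aperyCoeff]
  exact_mod_cast h2.trans (Nat.le_mul_of_pos_left _ h1)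

theorem abs_aperyInner_sub_le {n k : ℕ} (h : k ≤ n) :
    |aperyInner n k - ∑ m ∈ range n, 1 / ((m : ℝ) + 1) ^ 3| ≤
      (∑' m : ℕ, (1 : ℝ) / ((m : ℝ) + 1) ^ 3) / (n + 1) := by
  rw [aperyInner, add_sub_cancel_left]
  calc _ ≤ ∑ m ∈ range k, (1 / ((m : ℝ) + 1) ^ 3) / (n + 1) := by
        refine (abs_sum_le_sum_abs _ _).trans (sum_le_sum fun m hm ↦ ?_)
        have h1 := succ_le_aperyCoeff ((mem_range.mp hm).trans_le h)
        have h2 : (0 : ℝ) < n + 1 := by positivity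
        have h3 := h2.trans_le h1
        rw [abs_div, abs_pow, abs_neg, abs_one, one_pow, abs_of_pos (by positivity), div_div]
        refine one_div_le_one_div_of_le (by positivity) ?_
        refine mul_le_mul ?_ h1 h2.le (by positivity)
        have : (0 : ℝ) < ((m : ℝ) + 1) ^ 3 := by positivity
        linarith
    _ ≤ _ := by
        rw [← sum_div]
        gcongr
        exact summable_one_div_succ_pow_three.sum_le_tsum _ fun _ _ ↦ by positivity

open Filter Topology

theorem tendsto_aperyNum_div_aperyDen :
    Tendsto (fun n ↦ aperyNum n / aperyDen n) atTop
      (𝓝 (∑' m : ℕ, (1 : ℝ) / ((m : ℝ) + 1) ^ 3)) := by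
  have h1 := summable_one_div_succ_pow_three.hasSum.tendsto_sum_nat
  have h2 : Tendsto (fun n : ℕ ↦ (∑' m : ℕ, (1 : ℝ) / ((m : ℝ) + 1) ^ 3) / ((n : ℝ) + 1))
      atTop (𝓝 0) := by
    generalize (∑' m : ℕ, (1 : ℝ) / ((m : ℝ) + 1) ^ 3) = Z
    simpa [div_eq_mul_inv] using (tendsto_one_div_add_atTop_nhds_zero_nat (𝕜 := ℝ)).const_mul Z
  have h3 : Tendsto (fun n ↦ aperyNum n / aperyDen n - ∑ m ∈ range n, 1 / ((m : ℝ) + 1) ^ 3)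
      atTop (𝓝 0) := by
    refine squeeze_zero_norm (fun n ↦ ?_) h2
    rw [Real.norm_eq_abs, div_sub' (aperyDen_pos n).ne', abs_div, abs_of_pos (aperyDen_pos n),
      div_le_iff₀ (aperyDen_pos n)]
    have e : aperyNum n - aperyDen n * ∑ m ∈ range n, 1 / ((m : ℝ) + 1) ^ 3 =
        ∑ k ∈ range (n + 1), aperyCoeff n k ^ 2 *
          (aperyInner n k - ∑ m ∈ range n, 1 / ((m : ℝ) + 1) ^ 3) := by
      simp only [mul_sub, sum_sub_distrib, aperyNum, aperyDen, sum_mul]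
    rw [e, aperyDen, mul_sum]
    refine (abs_sum_le_sum_abs _ _).trans (sum_le_sum fun k hk ↦ ?_)
    rw [abs_mul, abs_of_nonneg (sq_nonneg _), mul_comm]
    gcongr
    exact abs_aperyInner_sub_le (Nat.lt_succ_iff.mp (mem_range.mp hk))
  simpa using h3.add h1

theorem aperyNum_div_aperyDen_succ_sub (n : ℕ) :
    aperyNum (n + 1) / aperyDen (n + 1) - aperyNum n / aperyDen n =
      6 / (((n : ℝ) + 1) ^ 3 * aperyDen n * aperyDen (n + 1)) := by
  have h := casoratian n
  have h1 := (aperyDen_pos n).ne'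
  have h2 := (aperyDen_pos (n + 1)).ne'
  rw [div_sub_div _ _ h2 h1, mul_comm (aperyDen (n + 1)) (aperyNum n), h]
  field_simp

theorem strictMono_aperyNum_div_aperyDen : StrictMono fun n ↦ aperyNum n / aperyDen n := by
  refine strictMono_nat_of_lt_succ fun n ↦ ?_
  rw [← sub_pos, aperyNum_div_aperyDen_succ_sub]
  have := aperyDen_pos n
  have := aperyDen_pos (n + 1)
  positivity

theorem aperyCoeff_le_succ (n k : ℕ) : aperyCoeff n k ≤ aperyCoeff (n + 1) k := by
  simp only [aperyCoeff]
  have h1 := Nat.choose_le_choose k (Nat.le_succ n)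
  have h2 := Nat.choose_le_choose k (show n + k ≤ n + 1 + k by lia)
  exact_mod_cast Nat.mul_le_mul h1 h2

theorem aperyDen_mono : Monotone aperyDen := by
  refine monotone_nat_of_le_succ fun n ↦ ?_
  rw [aperyDen_eq_sum (show n < n + 1 + 1 by lia), aperyDen]
  refine sum_le_sum fun k _ ↦ ?_
  have : 0 ≤ aperyCoeff n k := by unfold aperyCoeff; positivity
  gcongr
  exact aperyCoeff_le_succ n k

theorem aperyNum_div_aperyDen_add_le (n d : ℕ) :
    aperyNum (n + 1 + d) / aperyDen (n + 1 + d) ≤ aperyNum (n + 1) / aperyDen (n + 1)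
      + 6 / aperyDen (n + 1) ^ 2 * (1 / ((n : ℝ) + 1) - 1 / (n + 1 + d)) := by
  induction d with
  | zero => simp
  | succ d ih =>
    have h := aperyNum_div_aperyDen_succ_sub (n + 1 + d)
    have h0 := aperyDen_pos (n + 1)
    have h1 : aperyDen (n + 1) ≤ aperyDen (n + 1 + d) := aperyDen_mono (by lia)
    have h2 : aperyDen (n + 1) ≤ aperyDen (n + 1 + d + 1) := aperyDen_mono (by lia)
    have h3 : 6 / ((((n + 1 + d : ℕ) : ℝ) + 1) ^ 3 * aperyDen (n + 1 + d) *
        aperyDen (n + 1 + d + 1)) ≤ 6 / aperyDen (n + 1) ^ 2 *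
          (1 / ((n : ℝ) + 1 + d) - 1 / (n + 1 + (d + 1))) := by
      have e : 1 / ((n : ℝ) + 1 + d) - 1 / (n + 1 + (d + 1)) =
          1 / ((n + 1 + d) * (n + 1 + d + 1)) := by
        have : (n : ℝ) + 1 + d ≠ 0 := by positivity
        have : (n : ℝ) + 1 + (d + 1) ≠ 0 := by positivity
        field_simp
        ring
      rw [e, _root_.div_mul_div_comm, mul_one]
      refine div_le_div_of_nonneg_left (by norm_num) (by positivity) ?_
      push_cast
      have h4 : ((n : ℝ) + 1 + d) * (n + 1 + d + 1) ≤ (n + 1 + d + 1) ^ 3 := by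
        have : (0 : ℝ) ≤ (n : ℝ) + 1 + d := by positivity
        generalize (n : ℝ) + 1 + d = t at *
        nlinarith [mul_nonneg this this, mul_nonneg (mul_nonneg this this) this]
      calc _ ≤ (((n : ℝ) + 1 + d + 1) ^ 3) * (aperyDen (n + 1 + d) * aperyDen (n + 1 + d + 1)) := by
            have := h0.trans_le h1
            rw [mul_comm, sq]
            gcongr
        _ = _ := by ring
    rw [← add_assoc]
    push_cast
    linarith

theorem aperyDen_mul_sub_le (n : ℕ) :
    aperyDen (n + 1) * (∑' m : ℕ, (1 : ℝ) / ((m : ℝ) + 1) ^ 3) - aperyNum (n + 1) ≤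
      6 / aperyDen (n + 1) := by
  have h0 := aperyDen_pos (n + 1)
  have h : (∑' m : ℕ, (1 : ℝ) / ((m : ℝ) + 1) ^ 3) ≤
      aperyNum (n + 1) / aperyDen (n + 1) + 6 / aperyDen (n + 1) ^ 2 := by
    refine le_of_tendsto tendsto_aperyNum_div_aperyDen (eventually_atTop.2 ⟨n + 1, fun m hm ↦ ?_⟩)
    obtain ⟨d, rfl⟩ := Nat.exists_eq_add_of_le hm
    refine (aperyNum_div_aperyDen_add_le n d).trans ?_
    gcongr
    refine mul_le_of_le_one_right (by positivity) ?_
    have h1 : 1 / ((n : ℝ) + 1) ≤ 1 := by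
      rw [div_le_one (by positivity)]
      linarith [Nat.cast_nonneg (α := ℝ) n]
    have h2 : 0 ≤ 1 / ((n : ℝ) + 1 + d) := by positivity
    linarith
  have := mul_le_mul_of_nonneg_left h h0.le
  have e : aperyDen (n + 1) * (aperyNum (n + 1) / aperyDen (n + 1) + 6 / aperyDen (n + 1) ^ 2) =
      aperyNum (n + 1) + 6 / aperyDen (n + 1) := by
    field_simp
  linarith

theorem aperyDen_mul_sub_pos (n : ℕ) :
    0 < aperyDen n * (∑' m : ℕ, (1 : ℝ) / ((m : ℝ) + 1) ^ 3) - aperyNum n := by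
  have h := (strictMono_aperyNum_div_aperyDen (Nat.lt_succ_self n)).trans_le
    (strictMono_aperyNum_div_aperyDen.monotone.ge_of_tendsto tendsto_aperyNum_div_aperyDen (n + 1))
  rw [div_lt_iff₀ (aperyDen_pos n)] at h
  linarith

theorem mul_aperyDen_le_of_mul_aperyDen_le {n : ℕ} (hn : 100 ≤ n) {r s : ℝ} (hr : 0 < r)
    (hrs : s + 1 / r ≤ 33.1) (h : r * aperyDen n ≤ aperyDen (n + 1)) :
    s * aperyDen (n + 1) ≤ aperyDen (n + 2) := by
  have hrec := aperyDen_recurrence n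
  have hb := aperyDen_pos (n + 1)
  have hn' : (100 : ℝ) ≤ n := by exact_mod_cast hn
  have h1 : aperyDen n ≤ 1 / r * aperyDen (n + 1) := by
    rw [one_div, ← div_eq_inv_mul, le_div_iff₀ hr]
    linarith
  have h2 : ((n : ℝ) + 1) ^ 3 * aperyDen n ≤ (n + 2) ^ 3 * (1 / r * aperyDen (n + 1)) := by
    have := (aperyDen_pos n).le
    gcongr
    norm_num
  have h3 : 33.1 * ((n : ℝ) + 2) ^ 3 ≤
      34 * ((n : ℝ) + 1) ^ 3 + 51 * (n + 1) ^ 2 + 27 * (n + 1) + 5 := by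
    obtain ⟨t, ht⟩ : ∃ t : ℝ, (n : ℝ) = 100 + t := ⟨n - 100, by ring⟩
    have : 0 ≤ t := by linarith
    rw [ht]
    ring_nf
    have := pow_nonneg this 2
    have := pow_nonneg ‹0 ≤ t› 3
    linarith
  have h4 := mul_le_mul_of_nonneg_right h3 hb.le
  have h5 := mul_le_mul_of_nonneg_right hrs
    (show 0 ≤ ((n : ℝ) + 2) ^ 3 * aperyDen (n + 1) by positivity)
  have h6 : (0 : ℝ) < ((n : ℝ) + 2) ^ 3 := by positivity
  refine le_of_mul_le_mul_left ?_ h6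
  linarith

theorem exists_le_aperyDen : ∃ c : ℝ, 0 < c ∧ ∀ n ≥ 102, c * 33 ^ n ≤ aperyDen n := by
  have ratio : ∀ n ≥ 102, 33 * aperyDen n ≤ aperyDen (n + 1) := by
    intro n hn
    obtain ⟨n, rfl⟩ := Nat.exists_eq_add_of_le' (show 2 ≤ n by lia)
    refine mul_aperyDen_le_of_mul_aperyDen_le (n := n + 1) (by lia) (r := 32) (by norm_num)
      (by norm_num) ?_
    refine mul_aperyDen_le_of_mul_aperyDen_le (by lia) (r := 1) (by norm_num) (by norm_num) ?_
    simpa using aperyDen_mono (Nat.le_succ n)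
  refine ⟨aperyDen 102 / 33 ^ 102, div_pos (aperyDen_pos _) (by positivity), fun n hn ↦ ?_⟩
  induction n, hn using Nat.le_induction with
  | base => rw [div_mul_cancel₀ _ (by positivity)]
  | succ n hn ih =>
    generalize aperyDen 102 / 33 ^ 102 = c at ih ⊢
    rw [pow_succ]
    linarith [ratio n hn]

theorem exists_lcmUpto_pow_le : ∃ C : ℝ, 0 < C ∧
    ∀ n : ℕ, (lcmUpto n : ℝ) ^ 3 ≤ C * Real.exp (3.465 * n) := by
  obtain ⟨E, hE⟩ := exists_psi_le
  refine ⟨Real.exp (3 * E), Real.exp_pos _, fun n ↦ ?_⟩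
  have h := hE n
  have hpos : (0 : ℝ) < lcmUpto n := by exact_mod_cast lcmUpto_pos n
  rw [psi_eq_log_lcmUpto, Real.log_le_iff_le_exp hpos] at h
  calc _ ≤ Real.exp (1.155 * n + E) ^ 3 := by gcongr
    _ = _ := by
      rw [← Real.exp_nat_mul, ← Real.exp_add]
      congr 1
      push_cast
      ring

theorem exp_le_thirty_three : Real.exp 3.48 ≤ 33 := by
  have h : Real.exp 3.48 ^ 25 ≤ 33 ^ 25 := by
    rw [← Real.exp_nat_mul, show ((25 : ℕ) : ℝ) * 3.48 = (87 : ℕ) * 1 by norm_num,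
      Real.exp_nat_mul]
    refine (pow_le_pow_left₀ (Real.exp_pos 1).le Real.exp_one_lt_d9.le 87).trans ?_
    norm_num
  exact le_of_pow_le_pow_left₀ (by norm_num) (by norm_num) h

theorem tendsto_lcmUpto_pow_div_aperyDen :
    Tendsto (fun n ↦ (lcmUpto n : ℝ) ^ 3 / aperyDen n) atTop (𝓝 0) := by
  obtain ⟨c, hc, hden⟩ := exists_le_aperyDen
  obtain ⟨C, hC, hlcm⟩ := exists_lcmUpto_pow_le
  have hlim : Tendsto (fun n : ℕ ↦ C / c * Real.exp (-0.015) ^ n) atTop (𝓝 0) := by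
    simpa using (tendsto_pow_atTop_nhds_zero_of_lt_one (Real.exp_pos (-0.015)).le
      (Real.exp_lt_one_iff.2 (by norm_num))).const_mul (C / c)
  refine squeeze_zero' (Eventually.of_forall fun n ↦ ?_)
    (eventually_atTop.2 ⟨102, fun n hn ↦ ?_⟩) hlim
  · have := aperyDen_pos n
    positivity
  · have h : c * Real.exp 3.48 ^ n ≤ aperyDen n :=
      le_trans (by gcongr; exact exp_le_thirty_three) (hden n hn)
    rw [div_le_iff₀ (aperyDen_pos n)]
    calc _ ≤ C * Real.exp (3.465 * n) := hlcm n
      _ = C / c * Real.exp (-0.015) ^ n * (c * Real.exp 3.48 ^ n) := by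
        rw [← Real.exp_nat_mul, ← Real.exp_nat_mul,
          show (3.465 : ℝ) * n = n * (-0.015) + n * 3.48 by ring, Real.exp_add]
        field_simp
      _ ≤ _ := by gcongr

/-- Apéry's theorem (1978): `ζ(3) = ∑_{n=1}^∞ 1/n³` is irrational. -/
theorem apery : Irrational (∑' n : ℕ, (1 : ℝ) / (n + 1) ^ 3) := by
  rintro ⟨x, hx⟩
  set Z := ∑' n : ℕ, (1 : ℝ) / ((n : ℝ) + 1) ^ 3 with hZ
  have hq : (0 : ℝ) < x.den := by exact_mod_cast x.den_pos
  have hZq : x.den * Z = x.num := by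
    rw [← hx]
    exact_mod_cast Rat.den_mul_eq_num x
  have hsmall : ∀ᶠ n in atTop, (lcmUpto n : ℝ) ^ 3 / aperyDen n < 1 / (12 * x.den) :=
    tendsto_lcmUpto_pow_div_aperyDen.eventually_lt_const (by positivity)
  obtain ⟨n, hn, hn1⟩ := (hsmall.and (eventually_ge_atTop 1)).exists
  obtain ⟨n, rfl⟩ := Nat.exists_eq_add_of_le' hn1
  have hd : (0 : ℝ) < lcmUpto (n + 1) := by exact_mod_cast lcmUpto_pos (n + 1)
  have hmem : 2 * (lcmUpto (n + 1) : ℝ) ^ 3 * x.den * (aperyDen (n + 1) * Z - aperyNum (n + 1)) ∈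
      (Int.castRingHom ℝ).range := by
    have h1 : (x.num : ℝ) ∈ (Int.castRingHom ℝ).range := ⟨x.num, rfl⟩
    convert sub_mem (mul_mem (mul_mem (natCast_mem_range_intCast (2 * lcmUpto (n + 1) ^ 3))
      (aperyDen_mem (n + 1))) h1) (mul_mem (natCast_mem_range_intCast x.den)
        (two_mul_lcmUpto_pow_mul_aperyNum_mem (n + 1))) using 1
    rw [← hZq]
    push_cast
    ring
  obtain ⟨z, hz⟩ := hmem
  have hpos := aperyDen_mul_sub_pos (n + 1)
  have hle := aperyDen_mul_sub_le n
  rw [← hZ] at hpos hle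
  have hz0 : (0 : ℝ) < (Int.castRingHom ℝ) z := by rw [hz]; positivity
  have hz1 : (Int.castRingHom ℝ) z < 1 := by
    rw [hz]
    calc _ ≤ 2 * (lcmUpto (n + 1) : ℝ) ^ 3 * x.den * (6 / aperyDen (n + 1)) := by gcongr
      _ = 12 * x.den * ((lcmUpto (n + 1) : ℝ) ^ 3 / aperyDen (n + 1)) := by ring
      _ < 12 * x.den * (1 / (12 * x.den)) := by gcongr
      _ = 1 := by field_simp
  rw [eq_intCast] at hz0 hz1
  have h0 : 0 < z := by exact_mod_cast hz0
  have h1 : z < 1 := by exact_mod_cast hz1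
  lia
end
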